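/- arXiv:2308.07740 — 2 statements merged into one kernel-verified Lean document; each statement's English description precedes it below -/
import Mathlib

section
/- Let d ≥ 1, let k be an integer with 2 ≤ k ≤ 5, let σ ∈ ℝ, and let s < −1/k. Fix (u₀,u₁) ∈ 𝓗^s(ℝ^d). Then for every ε > 0 there exist initial data (v₀,v₁) ∈ F⃗L¹ ∩ 𝓗^s, a time T > 0, a Duhamel solution u ∈ C([0,T]; FL^{0,1}(ℝ^d)) of vNLW with initial data (v₀,v₁), and a time t_ε ∈ (0, ε) with t_ε ≤ T, such that ‖(v₀,v₁) − (u₀,u₁)‖_{𝓗^s} < ε and ‖u(t_ε)‖_{H^σ} > 1/ε. In particular, taking σ < s arbitrarily negative, vNLW exhibits norm inflation at general initial data with infinite loss of regularity. -/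
open MeasureTheory Real Set Filter Topology
open scoped ENNReal NNReal BigOperators

noncomputable section

/-- Frequency space `ℝ^d` with the Euclidean norm. -/
abbrev Edim (d : ℕ) := EuclideanSpace ℝ (Fin d)

/-! We work entirely on the Fourier side: a function `f` on `ℝ^d` is represented by
its Fourier transform `F = f̂ : ℝ^d → ℂ`. -/

/-- Squared `H^s` norm, computed on the Fourier side:
`‖f‖_{H^s}² = ∫ ⟨ξ⟩^{2s} |f̂(ξ)|² dξ`. -/
def HsNormSq (d : ℕ) (s : ℝ) (F : Edim d → ℂ) : ℝ≥0∞ :=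
  ∫⁻ ξ, ENNReal.ofReal ((1 + ‖ξ‖ ^ 2) ^ s * ‖F ξ‖ ^ 2)

/-- `H^s` norm on the Fourier side. -/
def HsNorm (d : ℕ) (s : ℝ) (F : Edim d → ℂ) : ℝ≥0∞ :=
  HsNormSq d s F ^ (1 / 2 : ℝ)

/-- Norm of `𝓗^s = H^s × H^{s-1}` on the Fourier side. -/
def pairHsNorm (d : ℕ) (s : ℝ) (F G : Edim d → ℂ) : ℝ≥0∞ :=
  (HsNormSq d s F + HsNormSq d (s - 1) G) ^ (1 / 2 : ℝ)

/-- Membership in `H^s`, on the Fourier side. -/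
def MemHs (d : ℕ) (s : ℝ) (F : Edim d → ℂ) : Prop :=
  Measurable F ∧ HsNormSq d s F < ⊤

/-- Membership in `𝓗^s = H^s × H^{s-1}`, on the Fourier side. -/
def MemHsPair (d : ℕ) (s : ℝ) (F G : Edim d → ℂ) : Prop :=
  MemHs d s F ∧ MemHs d (s - 1) G

/-- The Wiener-algebra norm `‖f‖_{FL^{0,1}} = ‖f̂‖_{L¹}`, on the Fourier side. -/
def FLNorm (d : ℕ) (F : Edim d → ℂ) : ℝ≥0∞ :=
  ∫⁻ ξ, (‖F ξ‖₊ : ℝ≥0∞)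

/-- The norm `‖g‖_{FL^{-1,1}} = ‖⟨ξ⟩⁻¹ ĝ‖_{L¹}`, on the Fourier side. -/
def FLm1Norm (d : ℕ) (F : Edim d → ℂ) : ℝ≥0∞ :=
  ∫⁻ ξ, ENNReal.ofReal ((1 + ‖ξ‖ ^ 2) ^ (-(1 : ℝ) / 2) * ‖F ξ‖)

/-- Norm of `F⃗L¹ = FL^{0,1} × FL^{-1,1}`. -/
def pairFLNorm (d : ℕ) (F G : Edim d → ℂ) : ℝ≥0∞ :=
  FLNorm d F + FLm1Norm d G

/-- Membership in `F⃗L¹ = FL^{0,1} × FL^{-1,1}`, on the Fourier side. -/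
def MemFLPair (d : ℕ) (F G : Edim d → ℂ) : Prop :=
  Measurable F ∧ Measurable G ∧ pairFLNorm d F G < ⊤

/-- Symbol of `V₀(t)`: `cos((√3/2)|ξ|t) + (1/√3) sin((√3/2)|ξ|t)`. -/
def V0sym (t r : ℝ) : ℝ :=
  Real.cos (Real.sqrt 3 / 2 * r * t) + 1 / Real.sqrt 3 * Real.sin (Real.sqrt 3 / 2 * r * t)

/-- Symbol of `V₁(t)`: `sin((√3/2)|ξ|t) / ((√3/2)|ξ|)`. -/
def V1sym (t r : ℝ) : ℝ :=
  Real.sin (Real.sqrt 3 / 2 * r * t) / (Real.sqrt 3 / 2 * r)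

/-- Symbol of the Poisson kernel `P(t)`: `e^{-|ξ|t/2}`. -/
def Psym (t r : ℝ) : ℝ := Real.exp (-(r * t) / 2)

/-- Symbol of `W(t) = P(t)V₁(t)`. -/
def Wsym (t r : ℝ) : ℝ := Psym t r * V1sym t r

/-- Fourier side of the linear flow `V(t)(u₀,u₁) = P(t)(V₀(t)u₀ + V₁(t)u₁)`. -/
def Vflow (d : ℕ) (F₀ F₁ : Edim d → ℂ) (t : ℝ) (ξ : Edim d) : ℂ :=
  ((Psym t ‖ξ‖ * V0sym t ‖ξ‖ : ℝ) : ℂ) * F₀ ξ + ((Psym t ‖ξ‖ * V1sym t ‖ξ‖ : ℝ) : ℂ) * F₁ ξ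

/-- Convolution on `ℝ^d`. -/
def conv (d : ℕ) (f g : Edim d → ℂ) (ξ : Edim d) : ℂ :=
  ∫ η, f (ξ - η) * g η

/-- `convIter d f n` is the `(n+1)`-fold convolution `f ∗ ⋯ ∗ f`. -/
def convIter (d : ℕ) (f : Edim d → ℂ) : ℕ → Edim d → ℂ
  | 0 => f
  | n + 1 => conv d (convIter d f n) f

/-- Convolution of a (nonempty) list of functions. -/
def listConv (d : ℕ) : List (Edim d → ℂ) → Edim d → ℂ
  | [] => fun _ => 0
  | f :: fs => fs.foldl (conv d) f

/-- Fourier side of the Duhamel operator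
`I_k(u₁,…,u_k)(t) = -∫₀ᵗ W(t-t') ∏ u_j(t') dt'`. -/
def Ik (d k : ℕ) (us : Fin k → ℝ → Edim d → ℂ) (t : ℝ) (ξ : Edim d) : ℂ :=
  -(∫ t' in (0 : ℝ)..t,
      ((Wsym (t - t') ‖ξ‖ : ℝ) : ℂ) * listConv d (List.ofFn fun i => us i t') ξ)

/-- Picard iterates `Ξ_j` of vNLW, on the Fourier side:
`Ξ₀(u⃗₀)(t) = V(t)u⃗₀` and
`Ξ_j(u⃗₀) = ∑_{j₁+⋯+j_k = j-1} I_k(Ξ_{j₁}(u⃗₀),…,Ξ_{j_k}(u⃗₀))`. -/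
def Xi (d k : ℕ) (F₀ F₁ : Edim d → ℂ) : ℕ → ℝ → Edim d → ℂ
  | 0 => Vflow d F₀ F₁
  | j + 1 => fun t ξ =>
      ∑ l ∈ (Finset.Nat.antidiagonalTuple k j).attach,
        Ik d k (fun i => Xi d k F₀ F₁ (l.1 i)) t ξ
  decreasing_by
    have h := Finset.Nat.mem_antidiagonalTuple.mp l.2
    have hle := Finset.single_le_sum (f := l.1) (fun j _ => Nat.zero_le (l.1 j))
      (Finset.mem_univ i)
    omega

/-- `u : [0,T] → FL^{0,1}(ℝ^d)` (represented on the Fourier side) is a Duhamel solution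
of vNLW with nonlinearity `-u^k` and initial data `(u₀,u₁)` with `û₀ = F₀`, `û₁ = F₁`. -/
structure IsDuhamelSolution (d k : ℕ) (T : ℝ) (F₀ F₁ : Edim d → ℂ)
    (u : ℝ → Edim d → ℂ) : Prop where
  measurable : ∀ t ∈ Set.Icc (0 : ℝ) T, Measurable (u t)
  finite : ∀ t ∈ Set.Icc (0 : ℝ) T, FLNorm d (u t) < ⊤
  continuous : ∀ t₀ ∈ Set.Icc (0 : ℝ) T, ∀ ε : ℝ, 0 < ε → ∃ δ : ℝ, 0 < δ ∧
    ∀ t ∈ Set.Icc (0 : ℝ) T, |t - t₀| < δ →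
      FLNorm d (fun ξ => u t ξ - u t₀ ξ) < ENNReal.ofReal ε
  duhamel : ∀ t ∈ Set.Icc (0 : ℝ) T, ∀ᵐ ξ : Edim d, u t ξ =
    ((Psym t ‖ξ‖ * V0sym t ‖ξ‖ : ℝ) : ℂ) * F₀ ξ
      + ((Psym t ‖ξ‖ * V1sym t ‖ξ‖ : ℝ) : ℂ) * F₁ ξ
      - ∫ t' in (0 : ℝ)..t,
          ((Wsym (t - t') ‖ξ‖ : ℝ) : ℂ) * convIter d (u t') (k - 1) ξ

/-- The cube `Q_A = [-A/8, A/8]^d`. -/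
def cubeSet (d : ℕ) (A : ℝ) : Set (Edim d) := {ξ | ∀ i, |ξ i| ≤ A / 8}

/-- `Ω = ⋃_{η ∈ Σ} (η + Q_A)` with `Σ = {-2Ne₁, -Ne₁, Ne₁, 2Ne₁}`. -/
def OmegaSet (d : ℕ) (N A : ℝ) : Set (Edim d) :=
  {ξ | ∃ c : ℝ, (c = -2 * N ∨ c = -N ∨ c = N ∨ c = 2 * N) ∧
    ∀ i : Fin d, |ξ i - (if (i : ℕ) = 0 then c else 0)| ≤ A / 8}

/-- `Ω_k = ⋃_{η ∈ Σ_k} (η + Q_A)` with `Σ_k = {-Ne₁, Ne₁}` for even `k` and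
`Σ_k = {-2Ne₁, -Ne₁, Ne₁, 2Ne₁}` for odd `k`. -/
def OmegaKSet (d k : ℕ) (N A : ℝ) : Set (Edim d) :=
  {ξ | ∃ c : ℝ, (if k % 2 = 0 then c = -N ∨ c = N
      else c = -2 * N ∨ c = -N ∨ c = N ∨ c = 2 * N) ∧
    ∀ i : Fin d, |ξ i - (if (i : ℕ) = 0 then c else 0)| ≤ A / 8}

/-- `φ̂ = R·𝟙_Ω`. -/
def phiHat (d : ℕ) (N A R : ℝ) : Edim d → ℂ :=
  Set.indicator (OmegaSet d N A) fun _ => (R : ℂ)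

/-- `φ̂ = R·𝟙_{Ω_k}`. -/
def phiHatK (d k : ℕ) (N A R : ℝ) : Edim d → ℂ :=
  Set.indicator (OmegaKSet d k N A) fun _ => (R : ℂ)

/-- `g_s(A)`: `1` if `s < -d/2`; `(log⟨A⟩)^{1/2}` if `s = -d/2`; `A^{d/2+s}` if `s > -d/2`. -/
def gs (d : ℕ) (s A : ℝ) : ℝ :=
  if s < -(d : ℝ) / 2 then 1
  else if s = -(d : ℝ) / 2 then Real.sqrt (Real.log (Real.sqrt (1 + A ^ 2)))
  else A ^ ((d : ℝ) / 2 + s)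

/-! ### Convolution estimates in `L¹` -/

lemma FLNorm_eq (d : ℕ) (F : Edim d → ℂ) : FLNorm d F = ∫⁻ ξ, ‖F ξ‖ₑ := rfl

lemma FLNorm_congr {d : ℕ} {F G : Edim d → ℂ} (h : ∀ᵐ ξ, F ξ = G ξ) : FLNorm d F = FLNorm d G :=
  lintegral_congr_ae (h.mono fun ξ hξ => by simp only [hξ])

lemma FLNorm_add_le {d : ℕ} {F G : Edim d → ℂ} (hF : Measurable F) :
    FLNorm d (fun ξ => F ξ + G ξ) ≤ FLNorm d F + FLNorm d G := by
  simp only [FLNorm_eq]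
  rw [← lintegral_add_left hF.enorm]
  exact lintegral_mono fun ξ => enorm_add_le _ _

lemma FLNorm_sub_le {d : ℕ} {F G : Edim d → ℂ} (hF : Measurable F) :
    FLNorm d (fun ξ => F ξ - G ξ) ≤ FLNorm d F + FLNorm d G := by
  simp only [FLNorm_eq]
  rw [← lintegral_add_left hF.enorm]
  exact lintegral_mono fun ξ => enorm_sub_le

lemma FLNorm_le_add_sub {d : ℕ} {F G : Edim d → ℂ} (hG : Measurable G) :
    FLNorm d F ≤ FLNorm d G + FLNorm d (fun ξ => F ξ - G ξ) := by
  simpa using FLNorm_add_le (G := fun ξ => F ξ - G ξ) hG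

lemma FLNorm_sub_comm {d : ℕ} (F G : Edim d → ℂ) :
    FLNorm d (fun ξ => F ξ - G ξ) = FLNorm d (fun ξ => G ξ - F ξ) := by
  simp only [FLNorm_eq, enorm_sub_rev]

lemma measurable_conv_param {α : Type*} [MeasurableSpace α] {d : ℕ} {F G : α → Edim d → ℂ}
    (hF : Measurable (fun p : α × Edim d => F p.1 p.2))
    (hG : Measurable (fun p : α × Edim d => G p.1 p.2)) :
    Measurable (fun p : α × Edim d => conv d (F p.1) (G p.1) p.2) := by
  unfold conv
  have h : Measurable (fun q : (α × Edim d) × Edim d =>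
      F q.1.1 (q.1.2 - q.2) * G q.1.1 q.2) := by
    have h1 : Measurable (fun q : (α × Edim d) × Edim d => (q.1.1, q.1.2 - q.2)) := by fun_prop
    have h2 : Measurable (fun q : (α × Edim d) × Edim d => (q.1.1, q.2)) := by fun_prop
    exact (hF.comp h1).mul (hG.comp h2)
  exact h.stronglyMeasurable.integral_prod_right.measurable

lemma measurable_convIter_param {α : Type*} [MeasurableSpace α] {d : ℕ} {F : α → Edim d → ℂ}
    (hF : Measurable (fun p : α × Edim d => F p.1 p.2)) (n : ℕ) :
    Measurable (fun p : α × Edim d => convIter d (F p.1) n p.2) := by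
  induction n with
  | zero => exact hF
  | succ n ih => exact measurable_conv_param (F := fun a => convIter d (F a) n) ih hF

lemma measurable_conv {d : ℕ} {f g : Edim d → ℂ} (hf : Measurable f) (hg : Measurable g) :
    Measurable (conv d f g) :=
  (measurable_conv_param (α := Unit) (F := fun _ => f) (G := fun _ => g)
    (hf.comp measurable_snd) (hg.comp measurable_snd)).comp (measurable_prodMk_left (x := ()))

lemma measurable_convIter {d : ℕ} {f : Edim d → ℂ} (hf : Measurable f) (n : ℕ) :
    Measurable (convIter d f n) := by
  induction n with
  | zero => exact hf
  | succ n ih => exact measurable_conv ih hf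

lemma lintegral_lintegral_conv {d : ℕ} {f g : Edim d → ℂ} (hf : Measurable f)
    (hg : Measurable g) :
    ∫⁻ ξ, ∫⁻ η, ‖f (ξ - η) * g η‖ₑ = FLNorm d f * FLNorm d g := by
  rw [lintegral_lintegral_swap (by fun_prop)]
  simp only [enorm_mul]
  have : ∀ η : Edim d, ∫⁻ ξ, ‖f (ξ - η)‖ₑ * ‖g η‖ₑ = FLNorm d f * ‖g η‖ₑ := by
    intro η
    rw [lintegral_mul_const _ (by fun_prop), lintegral_sub_right_eq_self (fun ξ => ‖f ξ‖ₑ) η]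
    rfl
  simp only [this]
  rw [lintegral_const_mul _ (by fun_prop)]
  rfl

lemma FLNorm_conv_le {d : ℕ} {f g : Edim d → ℂ} (hf : Measurable f) (hg : Measurable g) :
    FLNorm d (conv d f g) ≤ FLNorm d f * FLNorm d g := by
  rw [← lintegral_lintegral_conv hf hg, FLNorm_eq]
  exact lintegral_mono fun ξ => enorm_integral_le_lintegral_enorm _

lemma ae_integrable_conv {d : ℕ} {f g : Edim d → ℂ} (hf : Measurable f) (hg : Measurable g)
    (hf' : FLNorm d f < ⊤) (hg' : FLNorm d g < ⊤) :
    ∀ᵐ ξ : Edim d, Integrable (fun η => f (ξ - η) * g η) := by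
  have h := lintegral_lintegral_conv hf hg
  have hm : Measurable (fun ξ : Edim d => ∫⁻ η, ‖f (ξ - η) * g η‖ₑ) :=
    Measurable.lintegral_prod_right' (f := fun p : Edim d × Edim d => ‖f (p.1 - p.2) * g p.2‖ₑ)
      (by fun_prop)
  have := ae_lt_top hm (by rw [h]; exact (ENNReal.mul_lt_top hf' hg').ne)
  filter_upwards [this] with ξ hξ
  exact ⟨by fun_prop, hξ⟩

lemma FLNorm_conv_sub_le {d : ℕ} {f g f' g' : Edim d → ℂ} (hf : Measurable f) (hg : Measurable g)
    (hf' : Measurable f') (hg' : Measurable g') (nf : FLNorm d f < ⊤) (ng : FLNorm d g < ⊤)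
    (nf' : FLNorm d f' < ⊤) (ng' : FLNorm d g' < ⊤) :
    FLNorm d (fun ξ => conv d f g ξ - conv d f' g' ξ) ≤
      FLNorm d (fun ξ => f ξ - f' ξ) * FLNorm d g + FLNorm d f' * FLNorm d (fun ξ => g ξ - g' ξ) := by
  have h : ∀ᵐ ξ, conv d f g ξ - conv d f' g' ξ =
      conv d (fun ξ => f ξ - f' ξ) g ξ + conv d f' (fun ξ => g ξ - g' ξ) ξ := by
    filter_upwards [ae_integrable_conv hf hg nf ng, ae_integrable_conv hf' hg' nf' ng',
      ae_integrable_conv hf' hg nf' ng] with ξ h1 h2 h3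
    unfold conv
    simp only [sub_mul, mul_sub]
    rw [integral_sub h1 h3, integral_sub h3 h2]
    ring
  rw [FLNorm_congr h]
  exact (FLNorm_add_le (measurable_conv (hf.sub hf') hg)).trans
    (add_le_add (FLNorm_conv_le (hf.sub hf') hg) (FLNorm_conv_le hf' (hg.sub hg')))

lemma FLNorm_convIter_le {d : ℕ} {f : Edim d → ℂ} {A : ℝ≥0∞} (hf : Measurable f)
    (nf : FLNorm d f ≤ A) (n : ℕ) : FLNorm d (convIter d f n) ≤ A ^ (n + 1) := by
  induction n with
  | zero => simpa [convIter] using nf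
  | succ n ih =>
    rw [pow_succ]
    exact (FLNorm_conv_le (measurable_convIter hf n) hf).trans (mul_le_mul' ih nf)

lemma FLNorm_convIter_sub_le {d : ℕ} {f g : Edim d → ℂ} {A : ℝ≥0∞} (hA : A < ⊤)
    (hf : Measurable f) (hg : Measurable g) (nf : FLNorm d f ≤ A) (ng : FLNorm d g ≤ A) (n : ℕ) :
    FLNorm d (fun ξ => convIter d f n ξ - convIter d g n ξ) ≤
      (n + 1) * A ^ n * FLNorm d (fun ξ => f ξ - g ξ) := by
  induction n with
  | zero => simp [convIter]
  | succ n ih =>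
    have hp : A ^ (n + 1) < ⊤ := ENNReal.pow_lt_top hA
    have h1 := FLNorm_convIter_le hf nf n
    have h2 := FLNorm_convIter_le hg ng n
    refine (FLNorm_conv_sub_le (measurable_convIter hf n) hf (measurable_convIter hg n) hg
      (h1.trans_lt hp) (nf.trans_lt hA) (h2.trans_lt hp) (ng.trans_lt hA)).trans ?_
    calc _ ≤ (n + 1) * A ^ n * FLNorm d (fun ξ => f ξ - g ξ) * A +
          A ^ (n + 1) * FLNorm d (fun ξ => f ξ - g ξ) := by gcongr
      _ = _ := by push_cast; ring

/-! ### The Duhamel operator -/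

lemma Wsym_zero_left (r : ℝ) : Wsym 0 r = 0 := by simp [Wsym, V1sym]

lemma Wsym_zero_right (t : ℝ) : Wsym t 0 = 0 := by simp [Wsym, V1sym]

lemma measurable_Wsym : Measurable (fun p : ℝ × ℝ => Wsym p.1 p.2) := by
  unfold Wsym Psym V1sym
  fun_prop

lemma abs_Wsym_sub_le {t s r : ℝ} (ht : 0 ≤ t) (hs : 0 ≤ s) (hr : 0 ≤ r) :
    |Wsym t r - Wsym s r| ≤ 2 * |t - s| := by
  rcases hr.eq_or_lt with rfl | hr
  · simp [Wsym_zero_right]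
  set c := Real.sqrt 3 / 2 * r with hc
  have h3 : (1 : ℝ) ≤ Real.sqrt 3 := by
    rw [show (1 : ℝ) = Real.sqrt 1 by simp]
    exact Real.sqrt_le_sqrt (by norm_num)
  have hc0 : 0 < c := by positivity
  have hd : ∀ x ∈ Set.Ici (0 : ℝ), HasDerivWithinAt (fun t => Wsym t r)
      (Real.exp (-(r * x) / 2) * (-r / 2) * (Real.sin (c * x) / c) +
        Real.exp (-(r * x) / 2) * Real.cos (c * x)) (Set.Ici 0) x := by
    intro x _
    have h1 : HasDerivAt (fun t : ℝ => Real.exp (-(r * t) / 2))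
        (Real.exp (-(r * x) / 2) * (-r / 2)) x := by
      have : HasDerivAt (fun t : ℝ => -(r * t) / 2) (-r / 2) x := by
        have := ((hasDerivAt_id x).const_mul r).neg.div_const 2
        simpa using this
      exact this.exp
    have h2 : HasDerivAt (fun t : ℝ => Real.sin (c * t) / c) (Real.cos (c * x)) x := by
      have : HasDerivAt (fun t : ℝ => c * t) c x := by
        simpa using (hasDerivAt_id x).const_mul c
      have := this.sin.div_const c
      rwa [mul_div_assoc, div_self hc0.ne', mul_one] at this
    exact (h1.mul h2).hasDerivWithinAt
  have hb : ∀ x ∈ Set.Ici (0 : ℝ), ‖Real.exp (-(r * x) / 2) * (-r / 2) * (Real.sin (c * x) / c) +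
        Real.exp (-(r * x) / 2) * Real.cos (c * x)‖ ≤ 2 := by
    intro x hx
    have hx : 0 ≤ x := hx
    have he : Real.exp (-(r * x) / 2) ≤ 1 := by
      rw [Real.exp_le_one_iff]
      have : 0 ≤ r * x := by positivity
      linarith
    have he0 := Real.exp_pos (-(r * x) / 2)
    have hrc : r / 2 ≤ c := by rw [hc]; nlinarith
    have h1 : |(-r / 2) * (Real.sin (c * x) / c)| ≤ 1 := by
      rw [abs_mul, abs_div, abs_div, abs_neg, abs_of_pos hr, abs_of_pos hc0]
      have := Real.abs_sin_le_one (c * x)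
      rw [← mul_div_assoc, div_le_one hc0]
      simp only [Nat.abs_ofNat]
      calc r / 2 * |Real.sin (c * x)| ≤ r / 2 * 1 := by gcongr
        _ ≤ c := by linarith
    have h2 := Real.abs_cos_le_one (c * x)
    rw [Real.norm_eq_abs, mul_assoc, ← mul_add, abs_mul, abs_of_pos he0]
    calc _ ≤ 1 * (|(-r / 2) * (Real.sin (c * x) / c)| + |Real.cos (c * x)|) := by
          gcongr
          exact abs_add_le _ _
      _ ≤ 2 := by linarith
  have := Convex.norm_image_sub_le_of_norm_hasDerivWithin_le hd hb (convex_Ici 0) hs ht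
  simpa [Real.norm_eq_abs] using this

lemma abs_Wsym_le {t r : ℝ} (ht : 0 ≤ t) (hr : 0 ≤ r) : |Wsym t r| ≤ t := by
  rcases hr.eq_or_lt with rfl | hr
  · simpa [Wsym_zero_right] using ht
  have hc0 : 0 < Real.sqrt 3 / 2 * r := by positivity
  unfold Wsym Psym V1sym
  rw [abs_mul, abs_of_pos (Real.exp_pos _), abs_div, abs_of_pos hc0]
  have he : Real.exp (-(r * t) / 2) ≤ 1 := by
    rw [Real.exp_le_one_iff]
    have : 0 ≤ r * t := by positivity
    linarith
  have h1 : |Real.sin (Real.sqrt 3 / 2 * r * t)| / (Real.sqrt 3 / 2 * r) ≤ t := by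
    rw [div_le_iff₀ hc0]
    refine Real.abs_sin_le_abs.trans ?_
    rw [abs_of_nonneg (by positivity)]
    linarith
  calc _ ≤ 1 * t := by gcongr
    _ = t := one_mul t

lemma le_Wsym {t r : ℝ} (ht : 0 ≤ t) (ht1 : t ≤ 1) (hr : 0 < r) (hr1 : r ≤ 1) :
    t / 4 ≤ Wsym t r := by
  have hc0 : 0 < Real.sqrt 3 / 2 * r := by positivity
  have h3 : Real.sqrt 3 ≤ 2 := by
    rw [Real.sqrt_le_left (by norm_num)]; norm_num
  have hrt : r * t ≤ 1 := by nlinarith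
  unfold Wsym Psym V1sym
  have he : 1 / 2 ≤ Real.exp (-(r * t) / 2) := by
    have := Real.add_one_le_exp (-(r * t) / 2)
    linarith
  have hsin := Real.mul_le_sin (x := Real.sqrt 3 / 2 * r * t) (by positivity) (by
    have := Real.pi_gt_three
    have : Real.sqrt 3 / 2 * r * t ≤ 1 := by
      rw [mul_assoc]
      calc _ ≤ 1 * (1 : ℝ) := by gcongr; linarith
        _ = 1 := by norm_num
    linarith)
  have h2 : t / 2 ≤ Real.sin (Real.sqrt 3 / 2 * r * t) / (Real.sqrt 3 / 2 * r) := by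
    rw [le_div_iff₀ hc0]
    refine le_trans ?_ hsin
    have : 1 / 2 ≤ 2 / π := by
      rw [div_le_div_iff₀ (by norm_num) Real.pi_pos]
      linarith [Real.pi_le_four]
    calc t / 2 * (Real.sqrt 3 / 2 * r) = 1 / 2 * (Real.sqrt 3 / 2 * r * t) := by ring
      _ ≤ _ := by gcongr
  calc t / 4 = 1 / 2 * (t / 2) := by ring
    _ ≤ _ := by gcongr

/-- Duhamel integral over `(0, T]`, the kernel being extended by zero to negative times. -/
def duhamelOp {d : ℕ} (T : ℝ) (f : ℝ → Edim d → ℂ) (t : ℝ) (ξ : Edim d) : ℂ :=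
  ∫ t' in Set.Ioc 0 T, ((Wsym (max (t - t') 0) ‖ξ‖ : ℝ) : ℂ) * f t' ξ

lemma duhamelOp_eq {d : ℕ} {T t : ℝ} (ht : t ∈ Set.Icc 0 T) (f : ℝ → Edim d → ℂ) (ξ : Edim d) :
    duhamelOp T f t ξ = ∫ t' in (0 : ℝ)..t, ((Wsym (t - t') ‖ξ‖ : ℝ) : ℂ) * f t' ξ := by
  rw [intervalIntegral.integral_of_le ht.1, duhamelOp]
  rw [setIntegral_eq_of_subset_of_forall_sdiff_eq_zero measurableSet_Ioc
    (Set.Ioc_subset_Ioc_right ht.2)]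
  · refine setIntegral_congr_fun measurableSet_Ioc fun t' ht' => ?_
    simp only [max_eq_left (sub_nonneg.2 ht'.2)]
  · intro t' ht'
    have : t - t' ≤ 0 := by
      by_contra! h
      exact ht'.2 ⟨ht'.1.1, by linarith⟩
    simp [max_eq_right this, Wsym_zero_left]

lemma measurable_duhamelOp {d : ℕ} {T : ℝ} {f : ℝ → Edim d → ℂ}
    (hf : Measurable (fun p : ℝ × Edim d => f p.1 p.2)) :
    Measurable (fun p : ℝ × Edim d => duhamelOp T f p.1 p.2) := by
  unfold duhamelOp
  have h : Measurable (fun q : (ℝ × Edim d) × ℝ =>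
      ((Wsym (max (q.1.1 - q.2) 0) ‖q.1.2‖ : ℝ) : ℂ) * f q.2 q.1.2) := by
    have h1 : Measurable (fun q : (ℝ × Edim d) × ℝ => (max (q.1.1 - q.2) 0, ‖q.1.2‖)) := by
      fun_prop
    have h2 : Measurable (fun q : (ℝ × Edim d) × ℝ => (q.2, q.1.2)) := by fun_prop
    exact (Complex.measurable_ofReal.comp (measurable_Wsym.comp h1)).mul (hf.comp h2)
  exact h.stronglyMeasurable.integral_prod_right.measurable

lemma measurable_FLNorm {d : ℕ} {f : ℝ → Edim d → ℂ}
    (hf : Measurable (fun p : ℝ × Edim d => f p.1 p.2)) :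
    Measurable (fun t => FLNorm d (f t)) :=
  Measurable.lintegral_prod_right' (f := fun p : ℝ × Edim d => ‖f p.1 p.2‖ₑ) hf.enorm

lemma FLNorm_setIntegral_kernel_le {d : ℕ} {T : ℝ} {K : ℝ≥0∞} {m : ℝ → Edim d → ℂ}
    {f : ℝ → Edim d → ℂ} (hf : Measurable (fun p : ℝ × Edim d => f p.1 p.2))
    (hm : ∀ t ∈ Set.Ioc 0 T, ∀ ξ, ‖m t ξ‖ₑ ≤ K) :
    FLNorm d (fun ξ => ∫ t in Set.Ioc 0 T, m t ξ * f t ξ) ≤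
      K * ∫⁻ t in Set.Ioc 0 T, FLNorm d (f t) := by
  have hfe : Measurable (fun p : ℝ × Edim d => ‖f p.1 p.2‖ₑ) := hf.enorm
  calc _ ≤ ∫⁻ ξ, ∫⁻ t in Set.Ioc 0 T, K * ‖f t ξ‖ₑ := by
        rw [FLNorm_eq]
        refine lintegral_mono fun ξ => (enorm_integral_le_lintegral_enorm _).trans ?_
        refine setLIntegral_mono' measurableSet_Ioc fun t ht => ?_
        rw [enorm_mul]
        gcongr
        exact hm t ht ξ
    _ = ∫⁻ t in Set.Ioc 0 T, ∫⁻ ξ, K * ‖f t ξ‖ₑ := by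
        rw [lintegral_lintegral_swap]
        exact ((hfe.comp measurable_swap).const_mul K).aemeasurable
    _ = ∫⁻ t in Set.Ioc 0 T, K * FLNorm d (f t) := by
        refine lintegral_congr fun t => ?_
        exact lintegral_const_mul _ (hfe.comp measurable_prodMk_left)
    _ = _ := lintegral_const_mul _ (measurable_FLNorm hf)

lemma ae_integrableOn_time {d : ℕ} {T : ℝ} {f : ℝ → Edim d → ℂ}
    (hf : Measurable (fun p : ℝ × Edim d => f p.1 p.2))
    (h : ∫⁻ t in Set.Ioc 0 T, FLNorm d (f t) < ⊤) :
    ∀ᵐ ξ : Edim d, IntegrableOn (fun t => f t ξ) (Set.Ioc 0 T) := by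
  have hfe : Measurable (fun p : ℝ × Edim d => ‖f p.1 p.2‖ₑ) := hf.enorm
  have hm : Measurable (fun ξ : Edim d => ∫⁻ t in Set.Ioc 0 T, ‖f t ξ‖ₑ) :=
    Measurable.lintegral_prod_right' (f := fun p : Edim d × ℝ => ‖f p.2 p.1‖ₑ)
      (hfe.comp measurable_swap)
  have hs : ∫⁻ ξ : Edim d, ∫⁻ t in Set.Ioc 0 T, ‖f t ξ‖ₑ = ∫⁻ t in Set.Ioc 0 T, FLNorm d (f t) := by
    exact lintegral_lintegral_swap (f := fun (ξ : Edim d) (t : ℝ) => ‖f t ξ‖ₑ)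
      (hfe.comp measurable_swap).aemeasurable
  filter_upwards [ae_lt_top hm (by rw [hs]; exact h.ne)] with ξ hξ
  exact ⟨(hf.comp measurable_prodMk_right).aestronglyMeasurable, hξ⟩

lemma integrable_Wsym_mul {T t : ℝ} (htT : t ≤ T) (hT : 0 ≤ T) {r : ℝ} (hr : 0 ≤ r) {g : ℝ → ℂ}
    (hg : IntegrableOn g (Set.Ioc 0 T)) :
    IntegrableOn (fun t' => ((Wsym (max (t - t') 0) r : ℝ) : ℂ) * g t') (Set.Ioc 0 T) := by
  refine Integrable.bdd_mul (c := T) hg ?_ ?_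
  · have h1 : Measurable (fun t' : ℝ => (max (t - t') 0, r)) := by fun_prop
    exact (Complex.measurable_ofReal.comp (measurable_Wsym.comp h1)).aestronglyMeasurable
  · refine (ae_restrict_mem measurableSet_Ioc).mono fun t' ht' => ?_
    rw [Complex.norm_real]
    exact (abs_Wsym_le (le_max_right _ _) hr).trans (max_le (by linarith [ht'.1]) hT)

lemma FLNorm_duhamelOp_le {d : ℕ} {T t : ℝ} (ht : t ∈ Set.Icc 0 T) {f : ℝ → Edim d → ℂ}
    (hf : Measurable (fun p : ℝ × Edim d => f p.1 p.2)) :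
    FLNorm d (duhamelOp T f t) ≤
      ENNReal.ofReal T * ∫⁻ t' in Set.Ioc 0 T, FLNorm d (f t') := by
  refine FLNorm_setIntegral_kernel_le hf fun t' ht' ξ => ?_
  rw [← ofReal_norm, Complex.norm_real]
  refine ENNReal.ofReal_le_ofReal ((abs_Wsym_le (le_max_right _ _) (norm_nonneg ξ)).trans ?_)
  exact max_le (by linarith [ht'.1, ht.2]) (ht.1.trans ht.2)

lemma FLNorm_duhamelOp_sub_le {d : ℕ} {T t : ℝ} (ht : t ∈ Set.Icc 0 T) {f g : ℝ → Edim d → ℂ}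
    (hf : Measurable (fun p : ℝ × Edim d => f p.1 p.2))
    (hg : Measurable (fun p : ℝ × Edim d => g p.1 p.2))
    (nf : ∫⁻ t in Set.Ioc 0 T, FLNorm d (f t) < ⊤) (ng : ∫⁻ t in Set.Ioc 0 T, FLNorm d (g t) < ⊤) :
    FLNorm d (fun ξ => duhamelOp T f t ξ - duhamelOp T g t ξ) ≤
      ENNReal.ofReal T * ∫⁻ t' in Set.Ioc 0 T, FLNorm d (fun ξ => f t' ξ - g t' ξ) := by
  have h : ∀ᵐ ξ : Edim d, duhamelOp T f t ξ - duhamelOp T g t ξ =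
      duhamelOp T (fun t ξ => f t ξ - g t ξ) t ξ := by
    filter_upwards [ae_integrableOn_time hf nf, ae_integrableOn_time hg ng] with ξ h1 h2
    have hT := ht.1.trans ht.2
    unfold duhamelOp
    rw [← integral_sub (integrable_Wsym_mul ht.2 hT (norm_nonneg ξ) h1)
      (integrable_Wsym_mul ht.2 hT (norm_nonneg ξ) h2)]
    simp only [mul_sub]
  rw [FLNorm_congr h]
  exact FLNorm_duhamelOp_le ht (hf.sub hg)

lemma FLNorm_duhamelOp_time_sub_le {d : ℕ} {T t s : ℝ} (ht : t ∈ Set.Icc 0 T)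
    (hs : s ∈ Set.Icc 0 T) {f : ℝ → Edim d → ℂ}
    (hf : Measurable (fun p : ℝ × Edim d => f p.1 p.2))
    (nf : ∫⁻ t in Set.Ioc 0 T, FLNorm d (f t) < ⊤) :
    FLNorm d (fun ξ => duhamelOp T f t ξ - duhamelOp T f s ξ) ≤
      ENNReal.ofReal (2 * |t - s|) * ∫⁻ t' in Set.Ioc 0 T, FLNorm d (f t') := by
  have h : ∀ᵐ ξ : Edim d, duhamelOp T f t ξ - duhamelOp T f s ξ = ∫ t' in Set.Ioc 0 T,
      ((Wsym (max (t - t') 0) ‖ξ‖ - Wsym (max (s - t') 0) ‖ξ‖ : ℝ) : ℂ) * f t' ξ := by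
    filter_upwards [ae_integrableOn_time hf nf] with ξ h1
    have hT := ht.1.trans ht.2
    unfold duhamelOp
    rw [← integral_sub (integrable_Wsym_mul ht.2 hT (norm_nonneg ξ) h1)
      (integrable_Wsym_mul hs.2 hT (norm_nonneg ξ) h1)]
    simp only [← sub_mul, Complex.ofReal_sub]
  rw [FLNorm_congr h]
  refine FLNorm_setIntegral_kernel_le hf fun t' ht' ξ => ?_
  rw [← ofReal_norm, Complex.norm_real]
  refine ENNReal.ofReal_le_ofReal ((abs_Wsym_sub_le (le_max_right _ _) (le_max_right _ _)
    (norm_nonneg ξ)).trans ?_)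
  have := abs_max_sub_max_le_abs (t - t') (s - t') 0
  rw [sub_sub_sub_cancel_right] at this
  linarith

/-! ### Existence of solutions by Picard iteration -/

lemma exists_limit_of_FLNorm_geometric {d : ℕ} {S : Set ℝ} {ρ : ℝ≥0∞} (hρ : ρ < ⊤)
    {w : ℕ → ℝ → Edim d → ℂ} (hw : ∀ n, Measurable (fun p : ℝ × Edim d => w n p.1 p.2))
    (hw0 : ∀ t ξ, w 0 t ξ = 0)
    (hd : ∀ n, ∀ t ∈ S, FLNorm d (fun ξ => w (n + 1) t ξ - w n t ξ) ≤ ρ * 2⁻¹ ^ n) :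
    ∃ v : ℝ → Edim d → ℂ, Measurable (fun p : ℝ × Edim d => v p.1 p.2) ∧
      ∀ n, ∀ t ∈ S, FLNorm d (fun ξ => v t ξ - w n t ξ) ≤ 2 * ρ * 2⁻¹ ^ n := by
  refine ⟨fun t ξ => ∑' n, (w (n + 1) t ξ - w n t ξ), ?_, fun m t ht => ?_⟩
  · exact Measurable.tsum fun n => (hw (n + 1)).sub (hw n)
  have hwt : ∀ n, Measurable (w n t) := fun n => (hw n).comp measurable_prodMk_left
  have hgeom : ∀ m, ∑' n, ρ * 2⁻¹ ^ (n + m) = 2 * ρ * (2⁻¹ : ℝ≥0∞) ^ m := by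
    intro m
    simp only [pow_add, ← mul_assoc]
    rw [ENNReal.tsum_mul_right, ENNReal.tsum_mul_left, ENNReal.tsum_geometric,
      ENNReal.one_sub_inv_two, inv_inv, mul_comm ρ]
  have hsum : ∀ m, ∫⁻ ξ, ∑' n, ‖w (n + m + 1) t ξ - w (n + m) t ξ‖ₑ ≤ 2 * ρ * 2⁻¹ ^ m := by
    intro m
    have hm : ∀ n, Measurable (fun ξ => ‖w (n + m + 1) t ξ - w (n + m) t ξ‖ₑ) :=
      fun n => ((hwt _).sub (hwt _)).enorm
    rw [lintegral_tsum fun n => (hm n).aemeasurable, ← hgeom]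
    exact ENNReal.tsum_le_tsum fun n => hd (n + m) t ht
  have hfin : ∀ᵐ ξ, ∑' n, ‖w (n + 1) t ξ - w n t ξ‖ₑ < ⊤ := by
    refine ae_lt_top (Measurable.tsum fun n => ((hwt _).sub (hwt _)).enorm) ?_
    refine ((hsum 0).trans_lt ?_).ne
    simpa using ENNReal.mul_lt_top (by simp) hρ
  refine le_trans ?_ (hsum m)
  rw [FLNorm_eq]
  refine lintegral_mono_ae (hfin.mono fun ξ hξ => ?_)
  have hs : Summable (fun n => w (n + 1) t ξ - w n t ξ) := by
    refine Summable.of_nnnorm ?_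
    rw [← ENNReal.tsum_coe_ne_top_iff_summable]
    exact hξ.ne
  have h1 := hs.sum_add_tsum_nat_add m
  rw [Finset.sum_range_sub (fun n => w n t ξ), hw0, sub_zero] at h1
  beta_reduce
  rw [← h1, add_sub_cancel_left]
  exact enorm_tsum_le_tsum_enorm

lemma exists_duhamel_fixedPoint {d n : ℕ} {T : ℝ} (hT : 0 < T) {l : ℝ → Edim d → ℂ}
    (hl : Measurable (fun p : ℝ × Edim d => l p.1 p.2)) {b : ℝ → ℝ≥0∞} {ρ : ℝ≥0∞}
    (hb : ∀ t ∈ Set.Icc 0 T, b t < ⊤) (hρ : ρ < ⊤)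
    (hlb : ∀ t ∈ Set.Icc 0 T, FLNorm d (l t) ≤ b t)
    (h1 : ENNReal.ofReal T * ∫⁻ t in Set.Ioc 0 T, (b t + ρ) ^ (n + 1) ≤ ρ)
    (h2 : ENNReal.ofReal T * ∫⁻ t in Set.Ioc 0 T, (n + 1) * (b t + ρ) ^ n ≤ 2⁻¹) :
    ∃ w : ℝ → Edim d → ℂ, Measurable (fun p : ℝ × Edim d => w p.1 p.2) ∧
      (∀ t ∈ Set.Icc 0 T, FLNorm d (w t) ≤ ρ) ∧
      ∀ t ∈ Set.Icc 0 T, ∀ᵐ ξ, w t ξ =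
        -duhamelOp T (fun t' => convIter d (fun ξ => l t' ξ + w t' ξ) n) t ξ := by
  set Φ : (ℝ → Edim d → ℂ) → ℝ → Edim d → ℂ := fun w t ξ =>
    -duhamelOp T (fun t' => convIter d (fun ξ => l t' ξ + w t' ξ) n) t ξ with hΦ
  have hlt : ∀ t, Measurable (l t) := fun t => hl.comp measurable_prodMk_left
  have hI : ∫⁻ t in Set.Ioc 0 T, (b t + ρ) ^ (n + 1) < ⊤ := by
    by_contra! h
    rw [top_le_iff.1 h, ENNReal.mul_top (by simpa using hT)] at h1
    exact absurd hρ (not_lt.2 h1)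
  have hcm : ∀ w : ℝ → Edim d → ℂ, Measurable (fun p : ℝ × Edim d => w p.1 p.2) →
      Measurable (fun p : ℝ × Edim d => convIter d (fun ξ => l p.1 ξ + w p.1 ξ) n p.2) :=
    fun w hw => measurable_convIter_param (F := fun t ξ => l t ξ + w t ξ) (hl.add hw) n
  have hΦm : ∀ w : ℝ → Edim d → ℂ, Measurable (fun p : ℝ × Edim d => w p.1 p.2) →
      Measurable (fun p : ℝ × Edim d => Φ w p.1 p.2) :=
    fun w hw => (measurable_duhamelOp (hcm w hw)).neg
  have hlw : ∀ w : ℝ → Edim d → ℂ, (∀ t ∈ Set.Icc 0 T, FLNorm d (w t) ≤ ρ) →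
      ∀ t ∈ Set.Icc 0 T, FLNorm d (fun ξ => l t ξ + w t ξ) ≤ b t + ρ := fun w hw t ht =>
    (FLNorm_add_le (hlt t)).trans (add_le_add (hlb t ht) (hw t ht))
  have hfinInt : ∀ w : ℝ → Edim d → ℂ, Measurable (fun p : ℝ × Edim d => w p.1 p.2) →
      (∀ t ∈ Set.Icc 0 T, FLNorm d (w t) ≤ ρ) →
      ∫⁻ t in Set.Ioc 0 T, FLNorm d (convIter d (fun ξ => l t ξ + w t ξ) n) ≤
        ∫⁻ t in Set.Ioc 0 T, (b t + ρ) ^ (n + 1) := fun w hw hwb =>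
    setLIntegral_mono' measurableSet_Ioc fun t ht =>
      FLNorm_convIter_le ((hlt t).add (hw.comp measurable_prodMk_left))
        (hlw w hwb t (Set.Ioc_subset_Icc_self ht)) n
  have hneg : ∀ F : Edim d → ℂ, FLNorm d (fun ξ => -F ξ) = FLNorm d F := fun F => by
    simp only [FLNorm_eq, enorm_neg]
  have hΦb : ∀ w : ℝ → Edim d → ℂ, Measurable (fun p : ℝ × Edim d => w p.1 p.2) →
      (∀ t ∈ Set.Icc 0 T, FLNorm d (w t) ≤ ρ) → ∀ t ∈ Set.Icc 0 T, FLNorm d (Φ w t) ≤ ρ := by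
    intro w hw hwb t ht
    refine le_trans ?_ h1
    rw [hΦ, hneg]
    refine (FLNorm_duhamelOp_le ht (hcm w hw)).trans ?_
    refine mul_le_mul_right ?_ _
    exact hfinInt w hw hwb
  have hΦl : ∀ w w' : ℝ → Edim d → ℂ, ∀ δ : ℝ≥0∞, δ < ⊤ →
      Measurable (fun p : ℝ × Edim d => w p.1 p.2) →
      Measurable (fun p : ℝ × Edim d => w' p.1 p.2) →
      (∀ t ∈ Set.Icc 0 T, FLNorm d (w t) ≤ ρ) → (∀ t ∈ Set.Icc 0 T, FLNorm d (w' t) ≤ ρ) →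
      (∀ t ∈ Set.Icc 0 T, FLNorm d (fun ξ => w t ξ - w' t ξ) ≤ δ) →
      ∀ t ∈ Set.Icc 0 T, FLNorm d (fun ξ => Φ w t ξ - Φ w' t ξ) ≤ δ * 2⁻¹ := by
    intro w w' δ hδ hw hw' hwb hwb' hww t ht
    have hwt : ∀ t, Measurable (w t) := fun t => hw.comp measurable_prodMk_left
    have hwt' : ∀ t, Measurable (w' t) := fun t => hw'.comp measurable_prodMk_left
    simp only [hΦ, neg_sub_neg]
    rw [FLNorm_sub_comm]
    refine (FLNorm_duhamelOp_sub_le ht (hcm w hw) (hcm w' hw') ((hfinInt w hw hwb).trans_lt hI)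
      ((hfinInt w' hw' hwb').trans_lt hI)).trans ?_
    calc _ ≤ ENNReal.ofReal T * ∫⁻ t in Set.Ioc 0 T, (n + 1) * (b t + ρ) ^ n * δ := by
          refine mul_le_mul_right ?_ _
          refine setLIntegral_mono' measurableSet_Ioc fun t ht => ?_
          have ht := Set.Ioc_subset_Icc_self ht
          refine (FLNorm_convIter_sub_le (ENNReal.add_lt_top.2 ⟨hb t ht, hρ⟩)
            ((hlt t).add (hwt t)) ((hlt t).add (hwt' t)) (hlw w hwb t ht)
            (hlw w' hwb' t ht) n).trans ?_
          simp only [Pi.add_apply, add_sub_add_left_eq_sub]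
          gcongr
          exact hww t ht
      _ = δ * (ENNReal.ofReal T * ∫⁻ t in Set.Ioc 0 T, (n + 1) * (b t + ρ) ^ n) := by
          rw [lintegral_mul_const' _ _ hδ.ne]
          ring
      _ ≤ _ := by gcongr
  let w : ℕ → ℝ → Edim d → ℂ := fun n => Φ^[n] (fun _ _ => 0)
  have hws : ∀ n, w (n + 1) = Φ (w n) := fun n => Function.iterate_succ_apply' Φ n _
  have hwm : ∀ n, Measurable (fun p : ℝ × Edim d => w n p.1 p.2) := by
    intro n
    induction n with
    | zero => exact measurable_const
    | succ n ih => rw [hws]; exact hΦm _ ih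
  have hwb : ∀ n, ∀ t ∈ Set.Icc 0 T, FLNorm d (w n t) ≤ ρ := by
    intro n
    induction n with
    | zero => intro t _; simp [w, FLNorm_eq]
    | succ n ih => rw [hws]; exact hΦb _ (hwm n) ih
  have hfin : ∀ (c : ℝ≥0∞) (n : ℕ), c < ⊤ → c * 2⁻¹ ^ n < ⊤ := fun c n hc =>
    ENNReal.mul_lt_top hc (ENNReal.pow_lt_top (by simp))
  have hwd : ∀ n, ∀ t ∈ Set.Icc 0 T,
      FLNorm d (fun ξ => w (n + 1) t ξ - w n t ξ) ≤ ρ * 2⁻¹ ^ n := by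
    intro n
    induction n with
    | zero =>
      intro t ht
      simpa [w] using hwb 1 t ht
    | succ n ih =>
      intro t ht
      rw [hws (n + 1), pow_succ, ← mul_assoc]
      nth_rw 2 [hws n]
      exact hΦl _ _ _ (hfin ρ n hρ) (hwm (n + 1)) (hwm n) (hwb (n + 1)) (hwb n) ih t ht
  obtain ⟨v, hvm, hv⟩ := exists_limit_of_FLNorm_geometric hρ hwm (fun _ _ => rfl) hwd
  have hlim : ∀ c : ℝ≥0∞, c < ⊤ → Tendsto (fun n : ℕ => c * 2⁻¹ ^ n) atTop (𝓝 0) := by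
    intro c hc
    simpa using ENNReal.Tendsto.const_mul
      (ENNReal.tendsto_pow_atTop_nhds_zero_of_lt_one (r := 2⁻¹) (by simp)) (Or.inr hc.ne)
  have h2ρ : 2 * ρ < ⊤ := ENNReal.mul_lt_top (by simp) hρ
  have hvb : ∀ t ∈ Set.Icc 0 T, FLNorm d (v t) ≤ ρ := by
    intro t ht
    have h := (hlim _ h2ρ).const_add ρ
    rw [add_zero] at h
    refine ge_of_tendsto' h fun n => ?_
    exact (FLNorm_le_add_sub ((hwm n).comp measurable_prodMk_left)).trans
      (add_le_add (hwb n t ht) (hv n t ht))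
  refine ⟨v, hvm, hvb, fun t ht => ?_⟩
  have hzero : FLNorm d (fun ξ => v t ξ - Φ v t ξ) = 0 := by
    have h := (hlim _ h2ρ).add (hlim _ h2ρ)
    rw [add_zero] at h
    refine le_antisymm (ge_of_tendsto' h fun n => ?_) bot_le
    have h3 := hΦl (w n) v _ (hfin _ n h2ρ) (hwm n) hvm (hwb n) hvb
      (fun t ht => by rw [FLNorm_sub_comm]; exact hv n t ht) t ht
    have h4 := hv (n + 1) t ht
    rw [hws] at h4
    have h5 : FLNorm d (fun ξ => v t ξ - Φ v t ξ) ≤ FLNorm d (fun ξ => v t ξ - Φ (w n) t ξ) +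
        FLNorm d (fun ξ => Φ (w n) t ξ - Φ v t ξ) := by
      simpa using FLNorm_add_le (F := fun ξ => v t ξ - Φ (w n) t ξ)
        (G := fun ξ => Φ (w n) t ξ - Φ v t ξ)
        (((hvm.sub (hΦm _ (hwm n))).comp (measurable_prodMk_left (x := t))))
    refine h5.trans (add_le_add (h4.trans ?_) (h3.trans ?_))
    · rw [pow_succ, ← mul_assoc]
      exact mul_le_of_le_one_right bot_le (by simp)
    · exact mul_le_of_le_one_right bot_le (by simp)
  rw [FLNorm_eq, lintegral_eq_zero_iff' (by
    exact ((hvm.sub (hΦm _ hvm)).comp (measurable_prodMk_left (x := t))).enorm.aemeasurable)]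
    at hzero
  filter_upwards [hzero] with ξ hξ
  simpa [sub_eq_zero] using hξ

/-! ### The linear flow -/

/-- The root `ω = 1/2 - i√3/2` of the characteristic polynomial `X² - X + 1` of the equation. -/
def waveRoot : ℂ := 1 / 2 - (Real.sqrt 3 / 2 : ℝ) * Complex.I

lemma waveRoot_re : waveRoot.re = 1 / 2 := by
  simp only [waveRoot, Complex.sub_re, Complex.re_ofReal_mul, Complex.I_re]
  norm_num

lemma waveRoot_im : waveRoot.im = -(Real.sqrt 3 / 2) := by
  simp only [waveRoot, Complex.sub_im, Complex.im_ofReal_mul, Complex.I_im]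
  norm_num

lemma norm_waveRoot : ‖waveRoot‖ = 1 := by
  have h3 : Real.sqrt 3 * Real.sqrt 3 = 3 := Real.mul_self_sqrt (by norm_num)
  rw [Complex.norm_def, Complex.normSq_apply, waveRoot_re, waveRoot_im, Real.sqrt_eq_one]
  nlinarith

lemma norm_exp_waveRoot_mul (x : ℝ) : ‖Complex.exp (-waveRoot * x)‖ = Real.exp (-x / 2) := by
  rw [Complex.norm_exp]
  congr 1
  simp [waveRoot_re]
  ring

lemma norm_exp_waveRoot_sub_le {a b m t : ℝ} (ha : m ≤ a) (hb : m ≤ b) (ht : 0 ≤ t) :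
    ‖Complex.exp (-waveRoot * (a * t : ℝ)) - Complex.exp (-waveRoot * (b * t : ℝ))‖ ≤
      t * Real.exp (-(m * t) / 2) * |a - b| := by
  have hd : ∀ x ∈ Set.Ici m, HasDerivWithinAt
      (fun x : ℝ => Complex.exp (-waveRoot * (x * t : ℝ)))
      (Complex.exp (-waveRoot * (x * t : ℝ)) * (-waveRoot * t)) (Set.Ici m) x := by
    intro x _
    have h1 : HasDerivAt (fun x : ℝ => ((x * t : ℝ) : ℂ)) t x := by
      have := ((hasDerivAt_id x).mul_const t).ofReal_comp
      simpa using this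
    exact (h1.const_mul (-waveRoot)).cexp.hasDerivWithinAt
  refine Convex.norm_image_sub_le_of_norm_hasDerivWithin_le hd (fun x hx => ?_) (convex_Ici m)
    hb ha
  rw [norm_mul, norm_exp_waveRoot_mul, norm_mul, norm_neg, norm_waveRoot, one_mul,
    Complex.norm_real, Real.norm_of_nonneg ht, mul_comm]
  have hx : m ≤ x := hx
  have : m * t ≤ x * t := by gcongr
  gcongr

lemma Vflow_waveRoot {d : ℕ} (F : Edim d → ℂ) (t : ℝ) (ξ : Edim d) :
    Vflow d F (fun ξ => -waveRoot * ‖ξ‖ * F ξ) t ξ =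
      Complex.exp (-waveRoot * (‖ξ‖ * t : ℝ)) * F ξ := by
  rcases (norm_nonneg ξ).eq_or_lt with h0 | h0
  · simp [Vflow, ← h0, Psym, V0sym]
  simp only [Vflow, Psym, V0sym, V1sym]
  generalize ‖ξ‖ = r at h0 ⊢
  generalize F ξ = z
  have h3 : (Real.sqrt 3 : ℂ) * Real.sqrt 3 = 3 := by
    rw [← Complex.ofReal_mul, Real.mul_self_sqrt (by norm_num)]; norm_num
  have h30 : (Real.sqrt 3 : ℂ) ≠ 0 := by
    intro h
    rw [h] at h3
    norm_num at h3
  have hr : (r : ℂ) ≠ 0 := by exact_mod_cast h0.ne'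
  have hexp : Complex.exp (-waveRoot * (r * t : ℝ)) = (Real.exp (-(r * t) / 2) : ℝ) *
      ((Real.cos (Real.sqrt 3 / 2 * r * t) : ℝ) +
        (Real.sin (Real.sqrt 3 / 2 * r * t) : ℝ) * Complex.I) := by
    rw [Complex.ofReal_exp, Complex.ofReal_cos, Complex.ofReal_sin, ← Complex.exp_mul_I,
      ← Complex.exp_add]
    congr 1
    simp only [waveRoot]
    push_cast
    ring
  rw [hexp]
  generalize Real.exp (-(r * t) / 2) = X
  generalize Real.cos (Real.sqrt 3 / 2 * r * t) = C
  generalize Real.sin (Real.sqrt 3 / 2 * r * t) = S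
  simp only [waveRoot]
  push_cast
  field_simp
  linear_combination (0 : ℂ) * h3

lemma Vflow_add {d : ℕ} (F₀ F₁ G₀ G₁ : Edim d → ℂ) (t : ℝ) (ξ : Edim d) :
    Vflow d (fun ξ => F₀ ξ + G₀ ξ) (fun ξ => F₁ ξ + G₁ ξ) t ξ =
      Vflow d F₀ F₁ t ξ + Vflow d G₀ G₁ t ξ := by
  simp only [Vflow]
  ring

lemma measurable_Vflow {d : ℕ} {F₀ F₁ : Edim d → ℂ} (h₀ : Measurable F₀) (h₁ : Measurable F₁) :
    Measurable (fun p : ℝ × Edim d => Vflow d F₀ F₁ p.1 p.2) := by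
  unfold Vflow Psym V0sym V1sym
  fun_prop

lemma measurable_Vflow_apply {d : ℕ} {F₀ F₁ : Edim d → ℂ} (h₀ : Measurable F₀)
    (h₁ : Measurable F₁) (t : ℝ) : Measurable (Vflow d F₀ F₁ t) := by
  have h : Measurable (fun ξ => Vflow d F₀ F₁ t ξ) := by
    unfold Vflow Psym V0sym V1sym
    fun_prop
  exact h

lemma norm_Vflow_le {d : ℕ} (F₀ F₁ : Edim d → ℂ) {t : ℝ} (ht : t ∈ Set.Icc (0 : ℝ) 1)
    (ξ : Edim d) : ‖Vflow d F₀ F₁ t ξ‖ ≤ 2 * ‖F₀ ξ‖ + ‖F₁ ξ‖ := by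
  have hP : |Psym t ‖ξ‖| ≤ 1 := by
    unfold Psym
    rw [abs_of_pos (Real.exp_pos _), Real.exp_le_one_iff]
    have := mul_nonneg (norm_nonneg ξ) ht.1
    linarith
  have hV : |V0sym t ‖ξ‖| ≤ 2 := by
    unfold V0sym
    have h1 := Real.abs_cos_le_one (Real.sqrt 3 / 2 * ‖ξ‖ * t)
    have h2 := Real.abs_sin_le_one (Real.sqrt 3 / 2 * ‖ξ‖ * t)
    have h3 : 1 / Real.sqrt 3 ≤ 1 := by
      rw [div_le_one (by positivity), show (1 : ℝ) = Real.sqrt 1 by simp]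
      exact Real.sqrt_le_sqrt (by norm_num)
    refine (abs_add_le _ _).trans ?_
    rw [abs_mul, abs_of_pos (show 0 < 1 / Real.sqrt 3 by positivity)]
    have : 1 / Real.sqrt 3 * |Real.sin (Real.sqrt 3 / 2 * ‖ξ‖ * t)| ≤ 1 * 1 := by gcongr
    linarith
  have hW : |Wsym t ‖ξ‖| ≤ 1 := (abs_Wsym_le ht.1 (norm_nonneg ξ)).trans ht.2
  unfold Vflow
  refine (norm_add_le _ _).trans ?_
  rw [norm_mul, norm_mul, Complex.norm_real, Complex.norm_real, Real.norm_eq_abs,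
    Real.norm_eq_abs, abs_mul]
  have h1 : |Psym t ‖ξ‖| * |V0sym t ‖ξ‖| ≤ 1 * 2 := by gcongr
  have h2 : |Psym t ‖ξ‖ * V1sym t ‖ξ‖| ≤ 1 := hW
  have h3 : |Psym t ‖ξ‖| * |V0sym t ‖ξ‖| * ‖F₀ ξ‖ ≤ 1 * 2 * ‖F₀ ξ‖ := by gcongr
  have h4 : |Psym t ‖ξ‖ * V1sym t ‖ξ‖| * ‖F₁ ξ‖ ≤ 1 * ‖F₁ ξ‖ := by gcongr
  linarith

lemma enorm_Vflow_le {d : ℕ} (F₀ F₁ : Edim d → ℂ) {t : ℝ} (ht : t ∈ Set.Icc (0 : ℝ) 1)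
    (ξ : Edim d) : ‖Vflow d F₀ F₁ t ξ‖ₑ ≤ 2 * ‖F₀ ξ‖ₑ + ‖F₁ ξ‖ₑ := by
  have h := ENNReal.ofReal_le_ofReal (norm_Vflow_le F₀ F₁ ht ξ)
  rwa [ENNReal.ofReal_add (by positivity) (by positivity), ENNReal.ofReal_mul (by norm_num),
    ENNReal.ofReal_ofNat, ofReal_norm, ofReal_norm, ofReal_norm] at h

lemma FLNorm_Vflow_le {d : ℕ} {F₀ F₁ : Edim d → ℂ} (h₀ : Measurable F₀) {t : ℝ}
    (ht : t ∈ Set.Icc (0 : ℝ) 1) :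
    FLNorm d (Vflow d F₀ F₁ t) ≤ 2 * FLNorm d F₀ + FLNorm d F₁ := by
  simp only [FLNorm_eq]
  rw [← lintegral_const_mul _ h₀.enorm, ← lintegral_add_left (h₀.enorm.const_mul 2)]
  exact lintegral_mono fun ξ => enorm_Vflow_le F₀ F₁ ht ξ

lemma tendsto_FLNorm_Vflow_sub {d : ℕ} {F₀ F₁ : Edim d → ℂ} (h₀ : Measurable F₀)
    (h₁ : Measurable F₁) (n₀ : FLNorm d F₀ < ⊤) (n₁ : FLNorm d F₁ < ⊤) {t₀ : ℝ}
    (ht₀ : t₀ ∈ Set.Icc (0 : ℝ) 1) :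
    Tendsto (fun t => FLNorm d (fun ξ => Vflow d F₀ F₁ t ξ - Vflow d F₀ F₁ t₀ ξ))
      (𝓝[Set.Icc 0 1] t₀) (𝓝 0) := by
  have hm : ∀ t, Measurable (Vflow d F₀ F₁ t) := measurable_Vflow_apply h₀ h₁
  have hb : Measurable (fun ξ => 2 * ‖F₀ ξ‖ₑ + ‖F₁ ξ‖ₑ) := by fun_prop
  have key : ∀ t ∈ Set.Icc (0 : ℝ) 1, ∀ ξ, ‖Vflow d F₀ F₁ t ξ‖ₑ ≤ 2 * ‖F₀ ξ‖ₑ + ‖F₁ ξ‖ₑ :=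
    fun t ht ξ => enorm_Vflow_le F₀ F₁ ht ξ
  have := tendsto_lintegral_filter_of_dominated_convergence (μ := (volume : Measure (Edim d)))
    (l := 𝓝[Set.Icc 0 1] t₀) (F := fun t ξ => ‖Vflow d F₀ F₁ t ξ - Vflow d F₀ F₁ t₀ ξ‖ₑ)
    (f := fun _ => 0) (fun ξ => 2 * (2 * ‖F₀ ξ‖ₑ + ‖F₁ ξ‖ₑ))
    (Eventually.of_forall fun t => ((hm t).sub (hm t₀)).enorm) ?_ ?_ ?_
  · rw [lintegral_zero] at this
    exact this
  · filter_upwards [self_mem_nhdsWithin] with t ht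
    refine Eventually.of_forall fun ξ => enorm_sub_le.trans ?_
    rw [two_mul]
    exact add_le_add (key t ht ξ) (key t₀ ht₀ ξ)
  · rw [lintegral_const_mul _ hb, lintegral_add_left (by fun_prop),
      lintegral_const_mul _ h₀.enorm]
    exact (ENNReal.mul_lt_top (by simp) (ENNReal.add_lt_top.2
      ⟨ENNReal.mul_lt_top (by simp) n₀, n₁⟩)).ne
  · refine Eventually.of_forall fun ξ => ?_
    have hc : Continuous (fun t => ‖Vflow d F₀ F₁ t ξ - Vflow d F₀ F₁ t₀ ξ‖ₑ) := by
      unfold Vflow Psym V0sym V1sym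
      fun_prop
    have := (hc.tendsto t₀).mono_left (nhdsWithin_le_nhds (s := Set.Icc 0 1))
    simpa using this

/-! ### The oscillatory time integral -/

lemma setIntegral_mul_exp_neg_le {a T : ℝ} (ha : 0 < a) (hT : 0 ≤ T) :
    ∫ t in (0 : ℝ)..T, t * Real.exp (-(a * t)) ≤ 4 / a ^ 2 := by
  have hle : ∀ t ∈ Set.Icc 0 T, t * Real.exp (-(a * t)) ≤ 2 / a * Real.exp (-(a / 2) * t) := by
    intro t ht
    have h1 : a / 2 * t ≤ Real.exp (a / 2 * t) := by
      linarith [Real.add_one_le_exp (a / 2 * t)]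
    have h2 : Real.exp (-(a / 2) * t) = Real.exp (a / 2 * t) * Real.exp (-(a * t)) := by
      rw [← Real.exp_add]; congr 1; ring
    rw [h2, ← mul_assoc]
    gcongr
    calc t = 2 / a * (a / 2 * t) := by field_simp
      _ ≤ _ := by gcongr
  calc _ ≤ ∫ t in (0 : ℝ)..T, 2 / a * Real.exp (-(a / 2) * t) :=
        intervalIntegral.integral_mono_on hT (Continuous.intervalIntegrable (by fun_prop) _ _)
          (Continuous.intervalIntegrable (by fun_prop) _ _) hle
    _ = 2 / a * ((1 - Real.exp (-(a / 2) * T)) * (2 / a)) := by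
        rw [intervalIntegral.integral_const_mul, intervalIntegral.integral_comp_mul_left _
          (by linarith : -(a / 2) ≠ 0), integral_exp]
        simp only [mul_zero, Real.exp_zero, smul_eq_mul]
        field_simp
        ring
    _ ≤ 2 / a * (1 * (2 / a)) := by
        gcongr
        linarith [Real.exp_pos (-(a / 2) * T)]
    _ = 4 / a ^ 2 := by field_simp; norm_num

lemma norm_setIntegral_Wsym_exp_ge {a T r : ℝ} (hr : 0 < r) (hr1 : r ≤ 1) (hT : 0 < T)
    (hT1 : T ≤ 1) (ha : 0 < a) (haT : 512 ≤ a * T) :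
    T / (32 * a) ≤ ‖∫ t in Set.Ioc 0 T,
      ((Wsym (max (T - t) 0) r : ℝ) : ℂ) * Complex.exp (-waveRoot * (2 * a * t : ℝ))‖ := by
  rw [← intervalIntegral.integral_of_le hT.le]
  set E : ℝ → ℂ := fun t => Complex.exp (-waveRoot * (2 * a * t : ℝ)) with hE
  have hEc : Continuous E := by fun_prop
  have hEn : ∀ t, ‖E t‖ = Real.exp (-(a * t)) := by
    intro t
    rw [hE, norm_exp_waveRoot_mul]
    congr 1; ring
  have hWc : ContinuousOn (fun t : ℝ => ((Wsym (max (T - t) 0) r : ℝ) : ℂ)) Set.univ := by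
    unfold Wsym Psym V1sym
    fun_prop
  have hWc : Continuous (fun t : ℝ => ((Wsym (max (T - t) 0) r : ℝ) : ℂ)) := by
    simpa using hWc
  have hsplit : ∫ t in (0 : ℝ)..T, ((Wsym (max (T - t) 0) r : ℝ) : ℂ) * E t =
      (Wsym T r : ℂ) * (∫ t in (0 : ℝ)..T, E t) +
        ∫ t in (0 : ℝ)..T, (((Wsym (max (T - t) 0) r : ℝ) : ℂ) - Wsym T r) * E t := by
    rw [← intervalIntegral.integral_const_mul, ← intervalIntegral.integral_add
      (Continuous.intervalIntegrable (by fun_prop) _ _)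
      (Continuous.intervalIntegrable (by fun_prop) _ _)]
    congr 1
    ext t
    ring
  have hw0 : waveRoot ≠ 0 := by
    rw [← norm_ne_zero_iff, norm_waveRoot]; exact one_ne_zero
  have hfinInt : ∫ t in (0 : ℝ)..T, E t = (1 - E T) / (waveRoot * (2 * a : ℝ)) := by
    have h := integral_exp_mul_complex (a := 0) (b := T) (c := -waveRoot * (2 * a : ℝ)) (by
      simp [hw0, ha.ne'])
    have hfun : E = fun x : ℝ => Complex.exp (-waveRoot * (2 * a : ℝ) * x) := by
      ext t
      simp only [hE]
      congr 1
      push_cast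
      ring
    rw [hfun, h]
    simp only [Complex.ofReal_zero, mul_zero, Complex.exp_zero]
    rw [neg_mul, div_neg, ← neg_div, neg_sub]
  have hmain : T / (16 * a) ≤ ‖(Wsym T r : ℂ) * (∫ t in (0 : ℝ)..T, E t)‖ := by
    rw [hfinInt, norm_mul, norm_div, norm_mul, norm_waveRoot, one_mul, Complex.norm_real,
      Complex.norm_real, Real.norm_of_nonneg (by positivity : 0 ≤ 2 * a)]
    have h1 := le_Wsym hT.le hT1 hr hr1
    have h2 : T / 4 ≤ ‖Wsym T r‖ := h1.trans (le_abs_self _)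
    have h3 : (1 : ℝ) / 2 ≤ ‖1 - E T‖ := by
      have h4 := norm_sub_norm_le (1 : ℂ) (E T)
      rw [norm_one, hEn] at h4
      have h5 : Real.exp (-(a * T)) ≤ 1 / 2 := by
        rw [Real.exp_neg, inv_le_comm₀ (Real.exp_pos _) (by norm_num)]
        linarith [Real.add_one_le_exp (a * T)]
      linarith
    calc T / (16 * a) = T / 4 * (1 / 2 / (2 * a)) := by field_simp; norm_num
      _ ≤ _ := by gcongr
  have herr : ‖∫ t in (0 : ℝ)..T, (((Wsym (max (T - t) 0) r : ℝ) : ℂ) - Wsym T r) * E t‖ ≤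
      8 / a ^ 2 := by
    calc _ ≤ ∫ t in (0 : ℝ)..T, 2 * (t * Real.exp (-(a * t))) := by
          refine intervalIntegral.norm_integral_le_of_norm_le hT.le
            (Eventually.of_forall fun t ht => ?_) (Continuous.intervalIntegrable (by fun_prop) _ _)
          rw [norm_mul, hEn, ← Complex.ofReal_sub, Complex.norm_real, Real.norm_eq_abs,
            ← mul_assoc]
          gcongr
          refine (abs_Wsym_sub_le (le_max_right _ _) hT.le hr.le).trans ?_
          rw [max_eq_left (by linarith [ht.2])]
          rw [sub_sub_cancel_left, abs_neg, abs_of_pos ht.1]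
      _ ≤ 2 * (4 / a ^ 2) := by
          rw [intervalIntegral.integral_const_mul]
          gcongr
          exact setIntegral_mul_exp_neg_le ha hT.le
      _ = _ := by ring
  have hsmall : 8 / a ^ 2 ≤ T / (64 * a) := by
    rw [div_le_div_iff₀ (by positivity) (by positivity)]
    nlinarith
  rw [hsplit]
  have h6 := norm_sub_le_norm_add ((Wsym T r : ℂ) * (∫ t in (0 : ℝ)..T, E t))
    (∫ t in (0 : ℝ)..T, (((Wsym (max (T - t) 0) r : ℝ) : ℂ) - Wsym T r) * E t)
  have h7 : T / (16 * a) - T / (64 * a) ≥ T / (32 * a) := by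
    have : 0 < T / a := by positivity
    have e1 : T / (16 * a) = 1 / 16 * (T / a) := by field_simp
    have e2 : T / (64 * a) = 1 / 64 * (T / a) := by field_simp
    have e3 : T / (32 * a) = 1 / 32 * (T / a) := by field_simp
    rw [e1, e2, e3]
    linarith
  linarith

/-! ### Sobolev norms on the Fourier side -/

lemma HsNormSq_add_le {d : ℕ} {s : ℝ} {F G : Edim d → ℂ} (hF : Measurable F) :
    HsNormSq d s (fun ξ => F ξ + G ξ) ≤ 2 * HsNormSq d s F + 2 * HsNormSq d s G := by
  unfold HsNormSq
  rw [← lintegral_const_mul' _ _ (by simp), ← lintegral_const_mul' _ _ (by simp),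
    ← lintegral_add_left (by fun_prop)]
  refine lintegral_mono fun ξ => ?_
  have key : ∀ {a b c : ℝ}, 0 ≤ a → 0 ≤ b → c ≤ 2 * a + 2 * b →
      ENNReal.ofReal c ≤ 2 * ENNReal.ofReal a + 2 * ENNReal.ofReal b := by
    intro a b c ha hb h
    rw [show (2 : ℝ≥0∞) = ENNReal.ofReal 2 by simp, ← ENNReal.ofReal_mul (by norm_num),
      ← ENNReal.ofReal_mul (by norm_num), ← ENNReal.ofReal_add (by positivity) (by positivity)]
    exact ENNReal.ofReal_le_ofReal h
  refine key (by positivity) (by positivity) ?_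
  have h1 : ‖F ξ + G ξ‖ ^ 2 ≤ 2 * ‖F ξ‖ ^ 2 + 2 * ‖G ξ‖ ^ 2 := by
    have := norm_add_le (F ξ) (G ξ)
    have h0 := norm_nonneg (F ξ + G ξ)
    nlinarith [sq_nonneg (‖F ξ‖ - ‖G ξ‖)]
  have hw : 0 ≤ (1 + ‖ξ‖ ^ 2) ^ s := by positivity
  nlinarith [mul_le_mul_of_nonneg_left h1 hw]

lemma FLm1Norm_le {d : ℕ} (F : Edim d → ℂ) : FLm1Norm d F ≤ FLNorm d F := by
  rw [FLNorm_eq]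
  refine lintegral_mono fun ξ => ?_
  rw [← ofReal_norm]
  refine ENNReal.ofReal_le_ofReal (mul_le_of_le_one_left (norm_nonneg _) ?_)
  exact Real.rpow_le_one_of_one_le_of_nonpos (by nlinarith [sq_nonneg ‖ξ‖]) (by norm_num)

/-- Functions which are bounded and of bounded frequency support are dense in `H^s`. -/
lemma exists_FLNorm_lt_top_HsNormSq_sub_lt {d : ℕ} {s : ℝ} {F : Edim d → ℂ} (hF : MemHs d s F)
    {δ : ℝ≥0∞} (hδ : 0 < δ) : ∃ ψ : Edim d → ℂ, Measurable ψ ∧ FLNorm d ψ < ⊤ ∧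
      HsNormSq d s ψ < ⊤ ∧ HsNormSq d s (fun ξ => ψ ξ - F ξ) < δ := by
  obtain ⟨hFm, hFn⟩ := hF
  let S : ℕ → Set (Edim d) := fun m => {ξ | ‖ξ‖ ≤ m ∧ ‖F ξ‖ ≤ m}
  have hS : ∀ m, MeasurableSet (S m) := fun m =>
    (measurableSet_le measurable_norm measurable_const).inter
      (measurableSet_le hFm.norm measurable_const)
  have hlim : Tendsto (fun m => HsNormSq d s (fun ξ => (S m).indicator F ξ - F ξ)) atTop
      (𝓝 0) := by
    have := tendsto_lintegral_of_dominated_convergence (μ := (volume : Measure (Edim d)))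
      (F := fun m ξ => ENNReal.ofReal ((1 + ‖ξ‖ ^ 2) ^ s * ‖(S m).indicator F ξ - F ξ‖ ^ 2))
      (f := fun _ => 0) (fun ξ => ENNReal.ofReal ((1 + ‖ξ‖ ^ 2) ^ s * ‖F ξ‖ ^ 2))
      (fun m => by
        have : Measurable ((S m).indicator F) := hFm.indicator (hS m)
        fun_prop)
      (fun m => Eventually.of_forall fun ξ => ?_) hFn.ne (Eventually.of_forall fun ξ => ?_)
    · rw [lintegral_zero] at this
      exact this
    · refine ENNReal.ofReal_le_ofReal ?_
      gcongr
      by_cases h : ξ ∈ S m <;> simp [h]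
    · refine tendsto_const_nhds.congr' ?_
      obtain ⟨m₀, hm₀⟩ := exists_nat_ge (max ‖ξ‖ ‖F ξ‖)
      filter_upwards [eventually_ge_atTop m₀] with m hm
      have hmm : (m₀ : ℝ) ≤ m := by exact_mod_cast hm
      have : ξ ∈ S m := ⟨(le_max_left _ _).trans (hm₀.trans hmm),
        (le_max_right _ _).trans (hm₀.trans hmm)⟩
      simp [this]
  obtain ⟨m, hm⟩ := (hlim.eventually (gt_mem_nhds hδ)).exists
  refine ⟨(S m).indicator F, hFm.indicator (hS m), ?_, ?_, hm⟩
  · rw [FLNorm_eq]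
    calc ∫⁻ ξ, ‖(S m).indicator F ξ‖ₑ
        ≤ ∫⁻ ξ, (Metric.closedBall (0 : Edim d) m).indicator (fun _ => ENNReal.ofReal m) ξ := by
          refine lintegral_mono fun ξ => ?_
          by_cases h : ξ ∈ S m
          · have h' : ξ ∈ Metric.closedBall (0 : Edim d) m := by simpa using h.1
            rw [indicator_of_mem h, indicator_of_mem h', ← ofReal_norm]
            exact ENNReal.ofReal_le_ofReal h.2
          · simp [h]
      _ < ⊤ := by
          rw [lintegral_indicator measurableSet_closedBall, setLIntegral_const]
          exact ENNReal.mul_lt_top (by simp) measure_closedBall_lt_top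
  · refine lt_of_le_of_lt (lintegral_mono fun ξ => ENNReal.ofReal_le_ofReal ?_) hFn
    gcongr
    by_cases h : ξ ∈ S m <;> simp [h]

/-- The `L¹` norm at low frequencies is controlled by any Sobolev norm. -/
lemma exists_setLIntegral_closedBall_le_HsNorm (d : ℕ) (σ : ℝ) : ∃ c : ℝ, 0 < c ∧
    ∀ F : Edim d → ℂ, Measurable F →
      ∫⁻ ξ in Metric.closedBall 0 1, ‖F ξ‖ₑ ≤ ENNReal.ofReal c * HsNorm d σ F := by
  let B : Set (Edim d) := Metric.closedBall 0 1
  let w : Edim d → ℝ := fun ξ => (1 + ‖ξ‖ ^ 2) ^ (σ / 2)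
  have hw : ∀ ξ, 0 < w ξ := fun ξ => by positivity
  have hwc : Continuous w := by
    refine Continuous.rpow_const (by fun_prop) fun ξ => Or.inl ?_
    positivity
  have hwi : Continuous fun ξ => (w ξ)⁻¹ := hwc.inv₀ fun ξ => (hw ξ).ne'
  obtain ⟨C, hC⟩ := (isCompact_closedBall (0 : Edim d) 1).exists_bound_of_continuousOn
    hwi.continuousOn
  have hC0 : 0 ≤ C := (norm_nonneg _).trans (hC 0 (by simp))
  have hvol : volume B < ⊤ := measure_closedBall_lt_top
  refine ⟨C * (volume B).toReal ^ (1 / 2 : ℝ) + 1, by positivity, fun F hF => ?_⟩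
  have hCS := ENNReal.lintegral_mul_le_Lp_mul_Lq (volume.restrict B) Real.HolderConjugate.two_two
    (f := fun ξ => ENNReal.ofReal (w ξ)⁻¹) (g := fun ξ => ENNReal.ofReal (w ξ * ‖F ξ‖))
    (by fun_prop) (by have := hwc.measurable; fun_prop)
  have h1 : ∫⁻ ξ in B, ‖F ξ‖ₑ =
      ∫⁻ ξ in B, ((fun ξ => ENNReal.ofReal (w ξ)⁻¹) *
        (fun ξ => ENNReal.ofReal (w ξ * ‖F ξ‖))) ξ := by
    congr 1
    ext ξ
    rw [Pi.mul_apply, ← ENNReal.ofReal_mul (by have := hw ξ; positivity), ← mul_assoc,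
      inv_mul_cancel₀ (hw ξ).ne', one_mul, ofReal_norm]
  rw [h1]
  refine hCS.trans ?_
  refine mul_le_mul' ?_ ?_
  · calc (∫⁻ ξ in B, ENNReal.ofReal (w ξ)⁻¹ ^ (2 : ℝ)) ^ (1 / 2 : ℝ)
        ≤ (∫⁻ ξ in B, ENNReal.ofReal C ^ (2 : ℝ)) ^ (1 / 2 : ℝ) := by
          gcongr ?_ ^ _
          refine setLIntegral_mono (by fun_prop) fun ξ hξ => ?_
          gcongr
          exact (le_abs_self _).trans (hC ξ hξ)
      _ = ENNReal.ofReal C * volume B ^ (1 / 2 : ℝ) := by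
          rw [setLIntegral_const, ENNReal.mul_rpow_of_nonneg _ _ (by norm_num),
            ← ENNReal.rpow_mul]
          norm_num
      _ ≤ _ := by
          rw [← ENNReal.ofReal_toReal hvol.ne, ENNReal.ofReal_rpow_of_nonneg (by positivity)
            (by norm_num), ← ENNReal.ofReal_mul hC0]
          refine ENNReal.ofReal_le_ofReal ?_
          rw [ENNReal.toReal_ofReal (by positivity)]
          linarith
  · unfold HsNorm HsNormSq
    gcongr ?_ ^ _
    refine (setLIntegral_le_lintegral _ _).trans (le_of_eq ?_)
    congr 1
    ext ξ
    rw [ENNReal.ofReal_rpow_of_nonneg (by have := hw ξ; positivity) (by norm_num),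
      Real.mul_rpow (hw ξ).le (norm_nonneg _), ← Real.rpow_mul (by positivity)]
    norm_num

/-! ### Iterated convolutions of two bumps -/

lemma integrable_of_FLNorm_lt_top {d : ℕ} {f : Edim d → ℂ} (hf : Measurable f)
    (nf : FLNorm d f < ⊤) : Integrable f :=
  ⟨hf.aestronglyMeasurable, nf⟩

lemma FLNorm_convIter_lt_top {d : ℕ} {f : Edim d → ℂ} (hf : Measurable f)
    (nf : FLNorm d f < ⊤) (n : ℕ) : FLNorm d (convIter d f n) < ⊤ :=
  (FLNorm_convIter_le hf le_rfl n).trans_lt (ENNReal.pow_lt_top nf)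

lemma integral_conv {d : ℕ} {f g : Edim d → ℂ} (hf : Integrable f) (hg : Integrable g) :
    ∫ ξ, conv d f g ξ = (∫ ξ, f ξ) * ∫ ξ, g ξ := by
  have h := integral_convolution (ContinuousLinearMap.mul ℝ ℂ) hg hf
  rw [ContinuousLinearMap.mul_apply', mul_comm] at h
  rw [← h]
  congr 1
  ext ξ
  simp only [conv, convolution, ContinuousLinearMap.mul_apply', mul_comm]

lemma integral_convIter {d : ℕ} {f : Edim d → ℂ} (hf : Measurable f) (nf : FLNorm d f < ⊤)
    (n : ℕ) : ∫ ξ, convIter d f n ξ = (∫ ξ, f ξ) ^ (n + 1) := by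
  induction n with
  | zero => simp [convIter]
  | succ n ih =>
    rw [convIter, integral_conv (integrable_of_FLNorm_lt_top (measurable_convIter hf n)
      (FLNorm_convIter_lt_top hf nf n)) (integrable_of_FLNorm_lt_top hf nf), ih, pow_succ _ (n + 1)]

lemma convIter_eq_zero {d : ℕ} {f : Edim d → ℂ} {δ : ℝ} (hf : ∀ ξ, δ < ‖ξ‖ → f ξ = 0) (n : ℕ)
    {ξ : Edim d} (hξ : (n + 1) * δ < ‖ξ‖) : convIter d f n ξ = 0 := by
  induction n generalizing ξ with
  | zero => exact hf ξ (by simpa using hξ)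
  | succ n ih =>
    rw [convIter, conv]
    refine integral_eq_zero_of_ae (Eventually.of_forall fun η => ?_)
    rw [Pi.zero_apply, mul_eq_zero]
    by_contra! h
    have h1 : ‖η‖ ≤ δ := not_lt.1 fun h' => h.2 (hf η h')
    have h2 : ‖ξ - η‖ ≤ (n + 1) * δ := not_lt.1 fun h' => h.1 (ih h')
    have h3 : ‖ξ‖ ≤ ‖ξ - η‖ + ‖η‖ := by simpa using norm_add_le (ξ - η) η
    push_cast at hξ
    linarith

lemma integrable_translate_mul {d : ℕ} {f χ : Edim d → ℂ} (hf : Measurable f)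
    (nf : FLNorm d f < ⊤) (hχ : Measurable χ) (bχ : ∀ ξ, ‖χ ξ‖ ≤ 1) (x p : Edim d) :
    Integrable (fun η => f (x - η) * χ (η - p)) := by
  refine ((integrable_of_FLNorm_lt_top hf nf).comp_sub_left x).mul_bdd (c := 1) ?_
    (Eventually.of_forall fun η => bχ _)
  exact (hχ.comp (measurable_sub_const p)).aestronglyMeasurable

lemma integral_translate_mul {d : ℕ} (f χ : Edim d → ℂ) (x p : Edim d) :
    ∫ η, f (x - η) * χ (η - p) = conv d f χ (x - p) := by
  rw [conv, ← integral_sub_right_eq_self (fun η => f (x - p - η) * χ η) p]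
  simp

/-- Binomial formula for the iterated convolution of a sum of two translates. -/
lemma convIter_two_translates {d : ℕ} {χ : Edim d → ℂ} (hχ : Measurable χ)
    (nχ : FLNorm d χ < ⊤) (bχ : ∀ ξ, ‖χ ξ‖ ≤ 1) (p p' : Edim d) (α β : ℂ) (m : ℕ) (ξ : Edim d) :
    convIter d (fun ξ => α * χ (ξ - p) + β * χ (ξ - p')) m ξ =
      ∑ ij ∈ Finset.HasAntidiagonal.antidiagonal (m + 1), ((m + 1).choose ij.1 : ℂ) *
        (α ^ ij.1 * β ^ ij.2 * convIter d χ m (ξ - (ij.1 : ℝ) • p - (ij.2 : ℝ) • p')) := by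
  induction m generalizing ξ with
  | zero =>
    simp [convIter, Finset.Nat.antidiagonal_succ, add_comm]
  | succ m ih =>
    have hm := measurable_convIter hχ m
    have nm := FLNorm_convIter_lt_top hχ nχ m
    rw [convIter, conv]
    simp only [ih, Finset.sum_mul]
    rw [Finset.sum_antidiagonal_choose_succ_mul (fun i j => α ^ i * β ^ j *
      convIter d χ (m + 1) (ξ - (i : ℝ) • p - (j : ℝ) • p')), ← Finset.sum_add_distrib]
    have hre : ∀ (i j : ℕ) (η : Edim d), ξ - η - (i : ℝ) • p - (j : ℝ) • p' =
        (ξ - (i : ℝ) • p - (j : ℝ) • p') - η := by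
      intro i j η; abel
    have hterm : ∀ ij : ℕ × ℕ, (fun η => ((m + 1).choose ij.1 : ℂ) * (α ^ ij.1 * β ^ ij.2 *
          convIter d χ m (ξ - η - (ij.1 : ℝ) • p - (ij.2 : ℝ) • p')) *
            (α * χ (η - p) + β * χ (η - p'))) =
        fun η => ((m + 1).choose ij.1 * α ^ (ij.1 + 1) * β ^ ij.2 : ℂ) *
          (convIter d χ m ((ξ - (ij.1 : ℝ) • p - (ij.2 : ℝ) • p') - η) * χ (η - p)) +
          ((m + 1).choose ij.1 * α ^ ij.1 * β ^ (ij.2 + 1) : ℂ) *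
          (convIter d χ m ((ξ - (ij.1 : ℝ) • p - (ij.2 : ℝ) • p') - η) * χ (η - p')) := by
      intro ij
      ext η
      rw [hre]
      ring
    have hi : ∀ (x q : Edim d) (c : ℂ),
        Integrable (fun η => c * (convIter d χ m (x - η) * χ (η - q))) := fun x q c =>
      (integrable_translate_mul hm nm hχ bχ x q).const_mul c
    rw [integral_finsetSum]
    · refine Finset.sum_congr rfl fun ij hij => ?_
      rw [hterm, integral_add (hi _ _ _) (hi _ _ _), integral_const_mul, integral_const_mul,
        integral_translate_mul, integral_translate_mul, add_comm]
      have h1 : ξ - (ij.1 : ℝ) • p - (ij.2 : ℝ) • p' - p =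
          ξ - ((ij.1 + 1 : ℕ) : ℝ) • p - (ij.2 : ℝ) • p' := by
        push_cast; module
      have h2 : ξ - (ij.1 : ℝ) • p - (ij.2 : ℝ) • p' - p' =
          ξ - (ij.1 : ℝ) • p - ((ij.2 + 1 : ℕ) : ℝ) • p' := by
        push_cast; module
      rw [h1, h2, ← Nat.choose_symm_of_eq_add (Finset.HasAntidiagonal.mem_antidiagonal.1 hij).symm, convIter]
      ring
    · intro ij _
      rw [hterm]
      exact (hi _ _ _).add (hi _ _ _)

/-- The indicator function of the closed ball of radius `δ` centred at the origin. -/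
def ballBump (d : ℕ) (δ : ℝ) : Edim d → ℂ :=
  (Metric.closedBall (0 : Edim d) δ).indicator fun _ => 1

lemma measurable_ballBump (d : ℕ) (δ : ℝ) : Measurable (ballBump d δ) :=
  measurable_const.indicator measurableSet_closedBall

lemma ballBump_of_le {d : ℕ} {δ : ℝ} {ξ : Edim d} (h : ‖ξ‖ ≤ δ) : ballBump d δ ξ = 1 :=
  indicator_of_mem (by simpa using h) _

lemma ballBump_of_lt {d : ℕ} {δ : ℝ} {ξ : Edim d} (h : δ < ‖ξ‖) : ballBump d δ ξ = 0 :=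
  indicator_of_notMem (by simpa using h) _

lemma norm_ballBump_le {d : ℕ} (δ : ℝ) (ξ : Edim d) : ‖ballBump d δ ξ‖ ≤ 1 := by
  rcases le_or_gt ‖ξ‖ δ with h | h
  · simp [ballBump_of_le h]
  · simp [ballBump_of_lt h]

lemma FLNorm_ballBump (d : ℕ) (δ : ℝ) :
    FLNorm d (ballBump d δ) = volume (Metric.closedBall (0 : Edim d) δ) := by
  rw [FLNorm_eq]
  simp [ballBump, enorm_indicator_eq_indicator_enorm,
    lintegral_indicator measurableSet_closedBall]

lemma FLNorm_ballBump_lt_top (d : ℕ) (δ : ℝ) : FLNorm d (ballBump d δ) < ⊤ := by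
  rw [FLNorm_ballBump]
  exact measure_closedBall_lt_top

/-- The mass of the iterated convolution of a bump is the corresponding power of its mass. -/
lemma le_setLIntegral_convIter_ballBump {d : ℕ} {δ : ℝ} (n : ℕ) (hδ : (n + 1) * δ ≤ 1) :
    volume (Metric.closedBall (0 : Edim d) δ) ^ (n + 1) ≤
      ∫⁻ ξ in Metric.closedBall 0 1, ‖convIter d (ballBump d δ) n ξ‖ₑ := by
  have h1 : ∫ ξ, ballBump d δ ξ = ((volume (Metric.closedBall (0 : Edim d) δ)).toReal : ℂ) := by
    rw [ballBump, integral_indicator measurableSet_closedBall, setIntegral_const]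
    simp [Measure.real]
  have h2 : ∫⁻ ξ in Metric.closedBall 0 1, ‖convIter d (ballBump d δ) n ξ‖ₑ =
      ∫⁻ ξ, ‖convIter d (ballBump d δ) n ξ‖ₑ := by
    rw [← lintegral_indicator measurableSet_closedBall]
    congr 1
    ext ξ
    by_cases h : ξ ∈ Metric.closedBall (0 : Edim d) 1
    · rw [indicator_of_mem h]
    · rw [indicator_of_notMem h, convIter_eq_zero (fun ξ h => ballBump_of_lt h) n, enorm_zero]
      exact hδ.trans_lt (by simpa using h)
  rw [h2]
  refine le_trans (le_of_eq ?_) (enorm_integral_le_lintegral_enorm _)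
  rw [integral_convIter (measurable_ballBump d δ) (FLNorm_ballBump_lt_top d δ), h1, enorm_pow,
    ← ofReal_norm, Complex.norm_real, Real.norm_of_nonneg ENNReal.toReal_nonneg,
    ENNReal.ofReal_toReal measure_closedBall_lt_top.ne]

/-- Near the origin, only the resonant interaction of the two bumps survives. -/
lemma convIter_ballBump_resonant {d : ℕ} {δ N : ℝ} {e : Edim d} (he : ‖e‖ = 1) (n : ℕ)
    (hδ : (n + 1) * δ ≤ 1) (hN : 2 < N) (α β : ℂ) {ξ : Edim d} (hξ : ‖ξ‖ ≤ 1) :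
    convIter d (fun ξ => α * ballBump d δ (ξ - (n * N) • e) +
        β * ballBump d δ (ξ - (-N) • e)) n ξ =
      (n + 1) * (α * β ^ n) * convIter d (ballBump d δ) n ξ := by
  rw [convIter_two_translates (measurable_ballBump d δ) (FLNorm_ballBump_lt_top d δ)
    (norm_ballBump_le δ), Finset.sum_eq_single (1, n)]
  · have : ξ - ((1 : ℕ) : ℝ) • (n * N) • e - (n : ℝ) • (-N) • e = ξ := by
      push_cast; module
    rw [this]
    simp
    ring
  · rintro ⟨i, j⟩ hij hne
    have hij : i + j = n + 1 := Finset.HasAntidiagonal.mem_antidiagonal.1 hij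
    have hi : i ≠ 1 := by
      rintro rfl
      exact hne (by simp; omega)
    have hj : (j : ℝ) = n + 1 - i := by
      have : (i : ℝ) + j = n + 1 := by exact_mod_cast hij
      linarith
    have hi' : (1 : ℝ) ≤ |(i : ℝ) - 1| := by
      have : (1 : ℤ) ≤ |(i : ℤ) - 1| := Int.one_le_abs (by omega)
      exact_mod_cast this
    rw [convIter_eq_zero (fun ξ h => ballBump_of_lt h) n, mul_zero, mul_zero]
    refine hδ.trans_lt ?_
    have hx : ξ - (i : ℝ) • (n * N) • e - (j : ℝ) • (-N) • e =
        ξ - (((i : ℝ) - 1) * ((n + 1) * N)) • e := by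
      rw [hj]; module
    have h1 := norm_sub_norm_le ((((i : ℝ) - 1) * ((n + 1) * N)) • e) ξ
    rw [norm_smul, he, mul_one, norm_mul, Real.norm_eq_abs,
      Real.norm_of_nonneg (by positivity : 0 ≤ (n + 1) * N)] at h1
    have h2 : 2 < |(i : ℝ) - 1| * ((n + 1) * N) := by
      have h3 : N ≤ (n + 1) * N := by
        have : (0 : ℝ) ≤ n * N := by positivity
        linarith
      nlinarith
    rw [hx, norm_sub_rev]
    linarith
  · intro h
    exact absurd (Finset.HasAntidiagonal.mem_antidiagonal.2 (Nat.add_comm 1 n)) h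

/-! ### Local well-posedness in the Wiener algebra -/

lemma exists_isDuhamelSolution {d n : ℕ} {T : ℝ} (hT : 0 < T) (hT1 : T ≤ 1)
    {G₀ G₁ : Edim d → ℂ} (h₀ : Measurable G₀) (h₁ : Measurable G₁) (n₀ : FLNorm d G₀ < ⊤)
    (n₁ : FLNorm d G₁ < ⊤) {b : ℝ → ℝ≥0∞} {ρ : ℝ≥0∞} (hb : ∀ t ∈ Set.Icc 0 T, b t < ⊤)
    (hρ : ρ < ⊤) (hlb : ∀ t ∈ Set.Icc 0 T, FLNorm d (Vflow d G₀ G₁ t) ≤ b t)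
    (h1 : ENNReal.ofReal T * ∫⁻ t in Set.Ioc 0 T, (b t + ρ) ^ (n + 1) ≤ ρ)
    (h2 : ENNReal.ofReal T * ∫⁻ t in Set.Ioc 0 T, (n + 1) * (b t + ρ) ^ n ≤ 2⁻¹) :
    ∃ u : ℝ → Edim d → ℂ, Measurable (fun p : ℝ × Edim d => u p.1 p.2) ∧
      IsDuhamelSolution d (n + 1) T G₀ G₁ u ∧
      (∀ t ∈ Set.Icc 0 T, FLNorm d (fun ξ => u t ξ - Vflow d G₀ G₁ t ξ) ≤ ρ) ∧
      ∀ t ∈ Set.Icc 0 T, ∀ᵐ ξ, u t ξ =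
        Vflow d G₀ G₁ t ξ - duhamelOp T (fun t' => convIter d (u t') n) t ξ := by
  have hV := measurable_Vflow h₀ h₁
  have hVt := fun t => measurable_Vflow_apply h₀ h₁ t
  obtain ⟨w, hw, hwρ, hweq⟩ := exists_duhamel_fixedPoint hT hV hb hρ hlb h1 h2
  have hwt : ∀ t, Measurable (w t) := fun t => hw.comp measurable_prodMk_left
  let u : ℝ → Edim d → ℂ := fun t ξ => Vflow d G₀ G₁ t ξ + w t ξ
  have hu : Measurable (fun p : ℝ × Edim d => u p.1 p.2) := hV.add hw
  have hut : ∀ t, Measurable (u t) := fun t => (hVt t).add (hwt t)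
  have hub : ∀ t ∈ Set.Icc 0 T, FLNorm d (u t) ≤ b t + ρ := fun t ht =>
    (FLNorm_add_le (hVt t)).trans (add_le_add (hlb t ht) (hwρ t ht))
  have huc : Measurable (fun p : ℝ × Edim d => convIter d (u p.1) n p.2) :=
    measurable_convIter_param hu n
  have hX : ∫⁻ t in Set.Ioc 0 T, FLNorm d (convIter d (u t) n) < ⊤ := by
    refine lt_of_le_of_lt (setLIntegral_mono' measurableSet_Ioc fun t ht =>
      FLNorm_convIter_le (hut t) (hub t ⟨ht.1.le, ht.2⟩) n) ?_
    by_contra! h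
    rw [top_le_iff.1 h, ENNReal.mul_top (by simpa using hT)] at h1
    exact (h1.trans_lt hρ).ne rfl
  have hueq : ∀ t ∈ Set.Icc 0 T, ∀ᵐ ξ, u t ξ =
      Vflow d G₀ G₁ t ξ - duhamelOp T (fun t' => convIter d (u t') n) t ξ := by
    intro t ht
    filter_upwards [hweq t ht] with ξ hξ
    rw [sub_eq_add_neg, ← hξ]
  refine ⟨u, hu, ⟨fun t _ => hut t, fun t ht => (hub t ht).trans_lt
    (ENNReal.add_lt_top.2 ⟨hb t ht, hρ⟩), ?_, ?_⟩, ?_, hueq⟩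
  · intro t₀ ht₀ ε hε
    have hsub : Set.Icc 0 T ⊆ Set.Icc (0 : ℝ) 1 := Set.Icc_subset_Icc_right hT1
    have hlim1 := (tendsto_FLNorm_Vflow_sub h₀ h₁ n₀ n₁ (hsub ht₀)).mono_left
      (nhdsWithin_mono t₀ hsub)
    have hlim2 : Tendsto (fun t => ENNReal.ofReal (2 * |t - t₀|) *
        ∫⁻ t in Set.Ioc 0 T, FLNorm d (convIter d (u t) n)) (𝓝[Set.Icc 0 T] t₀) (𝓝 0) := by
      have hc : Tendsto (fun t => ENNReal.ofReal (2 * |t - t₀|)) (𝓝[Set.Icc 0 T] t₀) (𝓝 0) := by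
        have : Continuous fun t => ENNReal.ofReal (2 * |t - t₀|) :=
          ENNReal.continuous_ofReal.comp (by fun_prop)
        simpa using (this.tendsto t₀).mono_left (nhdsWithin_le_nhds (s := Set.Icc 0 T))
      simpa using ENNReal.Tendsto.mul_const hc (Or.inr hX.ne)
    have hev := (hlim1.add hlim2).eventually (gt_mem_nhds (by simpa using hε :
      (0 : ℝ≥0∞) + 0 < ENNReal.ofReal ε))
    rw [eventually_nhdsWithin_iff, Metric.eventually_nhds_iff] at hev
    obtain ⟨δ, hδ, hev⟩ := hev
    refine ⟨δ, hδ, fun t ht htδ => lt_of_le_of_lt ?_ (hev (by rwa [Real.dist_eq]) ht)⟩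
    calc FLNorm d (fun ξ => u t ξ - u t₀ ξ)
        = FLNorm d (fun ξ => (Vflow d G₀ G₁ t ξ - Vflow d G₀ G₁ t₀ ξ) -
            (duhamelOp T (fun t' => convIter d (u t') n) t ξ -
              duhamelOp T (fun t' => convIter d (u t') n) t₀ ξ)) := by
          refine FLNorm_congr ?_
          filter_upwards [hueq t ht, hueq t₀ ht₀] with ξ e1 e2
          rw [e1, e2]
          ring
      _ ≤ _ := by
          refine (FLNorm_sub_le ((hVt t).sub (hVt t₀))).trans ?_
          exact add_le_add le_rfl (FLNorm_duhamelOp_time_sub_le ht ht₀ huc hX)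
  · intro t ht
    filter_upwards [hueq t ht] with ξ hξ
    rw [hξ, duhamelOp_eq ht]
    rfl
  · intro t ht
    simpa [u] using hwρ t ht

/-! ### The two-bump data -/

/-- Two bumps of radius `δ`, at the frequencies `n N e` and `-N e`. -/
def twoBump {d : ℕ} (δ : ℝ) (n : ℕ) (N : ℝ) (e : Edim d) (α β : ℂ) (ξ : Edim d) : ℂ :=
  α * ballBump d δ (ξ - (n * N) • e) + β * ballBump d δ (ξ - (-N) • e)

lemma ofReal_mul_two {c : ℝ} (hc : 0 ≤ c) : ENNReal.ofReal c * 2 = ENNReal.ofReal (c * 2) := by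
  rw [ENNReal.ofReal_mul hc, ENNReal.ofReal_ofNat]

section TwoBump

variable {d n : ℕ} {δ N : ℝ} {e : Edim d}

lemma measurable_twoBump_param {α β : ℝ → ℂ} (hα : Measurable α) (hβ : Measurable β) :
    Measurable (fun p : ℝ × Edim d => twoBump δ n N e (α p.1) (β p.1) p.2) := by
  have h := measurable_ballBump d δ
  unfold twoBump
  fun_prop

lemma measurable_twoBump (α β : ℂ) : Measurable (twoBump δ n N e α β) := by
  have h := measurable_ballBump d δ
  unfold twoBump
  fun_prop

lemma lintegral_enorm_ballBump_sub (d : ℕ) (δ : ℝ) (p : Edim d) :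
    ∫⁻ ξ, ‖ballBump d δ (ξ - p)‖ₑ = volume (Metric.closedBall (0 : Edim d) δ) := by
  rw [lintegral_sub_right_eq_self (fun ξ => ‖ballBump d δ ξ‖ₑ) p, ← FLNorm_eq, FLNorm_ballBump]

lemma FLNorm_twoBump_le (α β : ℂ) : FLNorm d (twoBump δ n N e α β) ≤
    (‖α‖ₑ + ‖β‖ₑ) * volume (Metric.closedBall (0 : Edim d) δ) := by
  have hm := measurable_ballBump d δ
  refine (FLNorm_add_le (by fun_prop)).trans (le_of_eq ?_)
  simp only [FLNorm_eq, enorm_mul]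
  rw [lintegral_const_mul _ (by fun_prop), lintegral_const_mul _ (by fun_prop),
    lintegral_enorm_ballBump_sub, lintegral_enorm_ballBump_sub, add_mul]

lemma abs_norm_sub_le_of_ballBump_ne_zero (he : ‖e‖ = 1) {c : ℝ} {ξ : Edim d}
    (h : ballBump d δ (ξ - c • e) ≠ 0) : abs (‖ξ‖ - |c|) ≤ δ := by
  have h1 : ‖ξ - c • e‖ ≤ δ := not_lt.1 fun h' => h (ballBump_of_lt h')
  have h2 := abs_norm_sub_norm_le ξ (c • e)
  rw [norm_smul, he, mul_one, Real.norm_eq_abs] at h2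
  exact h2.trans h1

lemma norm_bounds_of_ballBump_ne_zero (he : ‖e‖ = 1) (hn : 1 ≤ n) (hδ : δ ≤ 1) (hN : 2 ≤ N)
    {ξ : Edim d} (h : ballBump d δ (ξ - (n * N) • e) ≠ 0 ∨ ballBump d δ (ξ - (-N) • e) ≠ 0) :
    N / 2 ≤ ‖ξ‖ ∧ ‖ξ‖ ≤ n * N + 1 := by
  have hn' : (1 : ℝ) ≤ n := by exact_mod_cast hn
  have hnN : N ≤ n * N := by nlinarith
  rcases h with h | h
  · have h1 := abs_le.1 (abs_norm_sub_le_of_ballBump_ne_zero he h)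
    rw [abs_of_nonneg (by linarith : 0 ≤ n * N)] at h1
    constructor <;> linarith
  · have h1 := abs_le.1 (abs_norm_sub_le_of_ballBump_ne_zero he h)
    rw [abs_neg, abs_of_nonneg (by linarith : 0 ≤ N)] at h1
    constructor <;> linarith

lemma norm_bounds_of_twoBump_ne_zero (he : ‖e‖ = 1) (hn : 1 ≤ n) (hδ : δ ≤ 1) (hN : 2 ≤ N)
    {α β : ℂ} {ξ : Edim d} (h : twoBump δ n N e α β ξ ≠ 0) :
    N / 2 ≤ ‖ξ‖ ∧ ‖ξ‖ ≤ n * N + 1 := by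
  refine norm_bounds_of_ballBump_ne_zero he hn hδ hN ?_
  by_contra! h'
  rw [twoBump, h'.1, h'.2] at h
  simp at h

lemma HsNormSq_twoBump_le {s R : ℝ} (he : ‖e‖ = 1) (hn : 1 ≤ n) (hδ : δ ≤ 1) (hN : 2 ≤ N)
    (hs : s ≤ 0) : HsNormSq d s (twoBump δ n N e R R) ≤
      ENNReal.ofReal (4 * R ^ 2 * (N / 2) ^ (2 * s)) *
        volume (Metric.closedBall (0 : Edim d) δ) := by
  have hm := measurable_ballBump d δ
  set c : ℝ := 2 * R ^ 2 * (N / 2) ^ (2 * s) with hc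
  have hc0 : 0 ≤ c := by positivity
  have key : ∀ ξ : Edim d, ENNReal.ofReal ((1 + ‖ξ‖ ^ 2) ^ s * ‖twoBump δ n N e R R ξ‖ ^ 2) ≤
      ENNReal.ofReal c * (‖ballBump d δ (ξ - (n * N) • e)‖ₑ + ‖ballBump d δ (ξ - (-N) • e)‖ₑ) := by
    intro ξ
    by_cases h : twoBump δ n N e R R ξ = 0
    · simp [h]
    have hb := (norm_bounds_of_twoBump_ne_zero he hn hδ hN h).1
    have hw : (1 + ‖ξ‖ ^ 2) ^ s ≤ (N / 2) ^ (2 * s) := by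
      rw [Real.rpow_mul (by linarith), Real.rpow_two]
      refine Real.rpow_le_rpow_of_nonpos (by positivity) ?_ hs
      nlinarith
    rw [← ofReal_norm, ← ofReal_norm, ← ENNReal.ofReal_add (by positivity) (by positivity),
      ← ENNReal.ofReal_mul hc0]
    refine ENNReal.ofReal_le_ofReal ?_
    set x := ‖ballBump d δ (ξ - (n * N) • e)‖ with hx
    set y := ‖ballBump d δ (ξ - (-N) • e)‖ with hy
    have hx1 : x ≤ 1 := norm_ballBump_le _ _
    have hy1 : y ≤ 1 := norm_ballBump_le _ _
    have hx0 : 0 ≤ x := norm_nonneg _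
    have hy0 : 0 ≤ y := norm_nonneg _
    have h1 : ‖twoBump δ n N e R R ξ‖ ≤ |R| * (x + y) := by
      refine (norm_add_le _ _).trans (le_of_eq ?_)
      rw [norm_mul, norm_mul, Complex.norm_real, Real.norm_eq_abs, mul_add]
    have h2 : ‖twoBump δ n N e R R ξ‖ ^ 2 ≤ 2 * R ^ 2 * (x + y) := by
      calc _ ≤ (|R| * (x + y)) ^ 2 := by gcongr
        _ = R ^ 2 * (x + y) ^ 2 := by rw [mul_pow, sq_abs]
        _ ≤ R ^ 2 * (2 * (x + y)) := by
          gcongr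
          nlinarith
        _ = _ := by ring
    calc _ ≤ (N / 2) ^ (2 * s) * (2 * R ^ 2 * (x + y)) := by gcongr
      _ = _ := by rw [hc]; ring
  refine (lintegral_mono key).trans (le_of_eq ?_)
  rw [lintegral_const_mul _ (by fun_prop), lintegral_add_left (by fun_prop),
    lintegral_enorm_ballBump_sub, lintegral_enorm_ballBump_sub, ← two_mul, ← mul_assoc,
    ofReal_mul_two hc0, hc]
  congr 2
  ring

lemma FLNorm_norm_mul_twoBump_le (he : ‖e‖ = 1) (hn : 1 ≤ n) (hδ : δ ≤ 1) (hN : 2 ≤ N)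
    (α β : ℂ) : FLNorm d (fun ξ => -waveRoot * ‖ξ‖ * twoBump δ n N e α β ξ) ≤
      ENNReal.ofReal (n * N + 1) * FLNorm d (twoBump δ n N e α β) := by
  simp only [FLNorm_eq]
  rw [← lintegral_const_mul _ (measurable_twoBump α β).enorm]
  refine lintegral_mono fun ξ => ?_
  by_cases h : twoBump δ n N e α β ξ = 0
  · simp [h]
  rw [enorm_mul]
  gcongr
  rw [← ofReal_norm, norm_mul, norm_neg, norm_waveRoot, one_mul, Complex.norm_real, norm_norm]
  exact ENNReal.ofReal_le_ofReal (norm_bounds_of_twoBump_ne_zero he hn hδ hN h).2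

lemma FLNorm_exp_mul_twoBump_le (he : ‖e‖ = 1) (hn : 1 ≤ n) (hδ : δ ≤ 1) (hN : 2 ≤ N)
    (α β : ℂ) {t : ℝ} (ht : 0 ≤ t) :
    FLNorm d (fun ξ => Complex.exp (-waveRoot * (‖ξ‖ * t : ℝ)) * twoBump δ n N e α β ξ) ≤
      ENNReal.ofReal (Real.exp (-(N * t) / 4)) * FLNorm d (twoBump δ n N e α β) := by
  simp only [FLNorm_eq]
  rw [← lintegral_const_mul _ (measurable_twoBump α β).enorm]
  refine lintegral_mono fun ξ => ?_
  by_cases h : twoBump δ n N e α β ξ = 0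
  · simp [h]
  rw [enorm_mul]
  gcongr
  rw [← ofReal_norm, norm_exp_waveRoot_mul]
  refine ENNReal.ofReal_le_ofReal (Real.exp_le_exp.2 ?_)
  nlinarith [(norm_bounds_of_twoBump_ne_zero he hn hδ hN h).1]

/-- On each bump the linear flow is close to multiplication by a constant. -/
lemma FLNorm_exp_mul_twoBump_sub_le {R : ℝ} (he : ‖e‖ = 1) (hn : 1 ≤ n) (hδ : δ ≤ 1)
    (hN : 2 ≤ N) (hR : 0 ≤ R) {t : ℝ} (ht : 0 ≤ t) :
    FLNorm d (fun ξ => Complex.exp (-waveRoot * (‖ξ‖ * t : ℝ)) * twoBump δ n N e R R ξ -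
        twoBump δ n N e (R * Complex.exp (-waveRoot * (n * N * t : ℝ)))
          (R * Complex.exp (-waveRoot * (N * t : ℝ))) ξ) ≤
      ENNReal.ofReal (8 * R / N) * volume (Metric.closedBall (0 : Edim d) δ) := by
  have hm := measurable_ballBump d δ
  have hn' : (1 : ℝ) ≤ n := by exact_mod_cast hn
  have hnN : N ≤ n * N := by nlinarith
  have hexp : t * Real.exp (-(N / 2 * t) / 2) ≤ 4 / N := by
    have h1 : N * t / 4 ≤ Real.exp (N * t / 4) := by linarith [Real.add_one_le_exp (N * t / 4)]
    have h2 : -(N / 2 * t) / 2 = -(N * t / 4) := by ring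
    rw [h2, Real.exp_neg, ← div_eq_mul_inv, div_le_div_iff₀ (Real.exp_pos _) (by linarith)]
    linarith
  have hbump : ∀ (c : ℝ) (ξ : Edim d), N ≤ |c| →
      (ballBump d δ (ξ - c • e) ≠ 0 → N / 2 ≤ ‖ξ‖) →
      ‖(R : ℂ) * (Complex.exp (-waveRoot * (‖ξ‖ * t : ℝ)) -
        Complex.exp (-waveRoot * (|c| * t : ℝ))) * ballBump d δ (ξ - c • e)‖ₑ ≤
      ENNReal.ofReal (4 * R / N) * ‖ballBump d δ (ξ - c • e)‖ₑ := by
    intro c ξ hc hξ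
    by_cases h : ballBump d δ (ξ - c • e) = 0
    · simp [h]
    rw [enorm_mul]
    gcongr
    rw [← ofReal_norm, norm_mul, Complex.norm_real, Real.norm_of_nonneg hR]
    refine ENNReal.ofReal_le_ofReal ?_
    have h1 := norm_exp_waveRoot_sub_le (hξ h) (by linarith : N / 2 ≤ |c|) ht
    have h2 := (abs_norm_sub_le_of_ballBump_ne_zero he h).trans hδ
    calc _ ≤ R * (t * Real.exp (-(N / 2 * t) / 2) * abs (‖ξ‖ - |c|)) := by gcongr
      _ ≤ R * (4 / N * 1) := by gcongr
      _ = _ := by ring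
  have key : ∀ ξ : Edim d,
      ‖Complex.exp (-waveRoot * (‖ξ‖ * t : ℝ)) * twoBump δ n N e R R ξ -
        twoBump δ n N e (R * Complex.exp (-waveRoot * (n * N * t : ℝ)))
          (R * Complex.exp (-waveRoot * (N * t : ℝ))) ξ‖ₑ ≤
      ENNReal.ofReal (4 * R / N) *
        (‖ballBump d δ (ξ - (n * N) • e)‖ₑ + ‖ballBump d δ (ξ - (-N) • e)‖ₑ) := by
    intro ξ
    have a1 : |n * N| = n * N := abs_of_nonneg (by linarith)
    have a2 : |-N| = N := by rw [abs_neg, abs_of_nonneg (by linarith)]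
    have b1 := hbump (n * N) ξ (by rwa [a1]) fun h =>
      (norm_bounds_of_ballBump_ne_zero he hn hδ hN (Or.inl h)).1
    have b2 := hbump (-N) ξ a2.ge fun h =>
      (norm_bounds_of_ballBump_ne_zero he hn hδ hN (Or.inr h)).1
    rw [a1] at b1
    rw [a2] at b2
    rw [mul_add]
    refine le_trans (le_of_eq ?_) ((enorm_add_le _ _).trans (add_le_add b1 b2))
    congr 1
    simp only [twoBump]
    ring
  rw [FLNorm_eq]
  refine (lintegral_mono key).trans (le_of_eq ?_)
  rw [lintegral_const_mul _ (by fun_prop), lintegral_add_left (by fun_prop),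
    lintegral_enorm_ballBump_sub, lintegral_enorm_ballBump_sub, ← two_mul, ← mul_assoc,
    ofReal_mul_two (by
      have : 0 ≤ N := by linarith
      positivity)]
  congr 2
  ring

end TwoBump

lemma HsNormSq_norm_mul_le {d : ℕ} (s : ℝ) (F : Edim d → ℂ) :
    HsNormSq d (s - 1) (fun ξ => -waveRoot * ‖ξ‖ * F ξ) ≤ HsNormSq d s F := by
  refine lintegral_mono fun ξ => ENNReal.ofReal_le_ofReal ?_
  rw [norm_mul, norm_mul, norm_neg, norm_waveRoot, one_mul, Complex.norm_real, norm_norm, mul_pow,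
    ← mul_assoc]
  gcongr
  have h : 0 < 1 + ‖ξ‖ ^ 2 := by positivity
  rw [Real.rpow_sub_one h.ne', div_mul_eq_mul_div, div_le_iff₀ h]
  gcongr
  linarith

/-! ### Lower bound for the first Picard iterate at low frequencies -/

lemma le_enorm_duhamelOp_twoBump {d n : ℕ} {δ N R T : ℝ} {e : Edim d} (he : ‖e‖ = 1)
    (hn : 1 ≤ n) (hδ : (n + 1) * δ ≤ 1) (hN : 2 < N) (hR : 0 ≤ R) (hT : 0 < T) (hT1 : T ≤ 1)
    (hNT : 512 ≤ N * T) {ξ : Edim d} (hξ0 : ξ ≠ 0) (hξ : ‖ξ‖ ≤ 1) :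
    ENNReal.ofReal ((n + 1) * R ^ (n + 1) * (T / (32 * (n * N)))) *
        ‖convIter d (ballBump d δ) n ξ‖ₑ ≤
      ‖duhamelOp T (fun t => convIter d (twoBump δ n N e
          (R * Complex.exp (-waveRoot * (n * N * t : ℝ)))
          (R * Complex.exp (-waveRoot * (N * t : ℝ)))) n) T ξ‖ₑ := by
  have hn' : (1 : ℝ) ≤ n := by exact_mod_cast hn
  have hnN : N ≤ n * N := by nlinarith
  have hpow : ∀ t : ℝ, (R * Complex.exp (-waveRoot * (n * N * t : ℝ))) *
      (R * Complex.exp (-waveRoot * (N * t : ℝ))) ^ n =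
        (R : ℂ) ^ (n + 1) * Complex.exp (-waveRoot * (2 * (n * N) * t : ℝ)) := by
    intro t
    have : Complex.exp (-waveRoot * (2 * (n * N) * t : ℝ)) =
        Complex.exp (-waveRoot * (n * N * t : ℝ)) *
          Complex.exp (-waveRoot * (N * t : ℝ)) ^ n := by
      rw [← Complex.exp_nat_mul, ← Complex.exp_add]
      congr 1
      push_cast
      ring
    rw [this]
    ring
  have heq : duhamelOp T (fun t => convIter d (twoBump δ n N e
          (R * Complex.exp (-waveRoot * (n * N * t : ℝ)))
          (R * Complex.exp (-waveRoot * (N * t : ℝ)))) n) T ξ =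
      ((n + 1) * (R : ℂ) ^ (n + 1) * convIter d (ballBump d δ) n ξ) *
        ∫ t in Set.Ioc 0 T, ((Wsym (max (T - t) 0) ‖ξ‖ : ℝ) : ℂ) *
          Complex.exp (-waveRoot * (2 * (n * N) * t : ℝ)) := by
    rw [duhamelOp, ← integral_const_mul]
    congr 1
    ext t
    have := convIter_ballBump_resonant he n hδ hN
      (R * Complex.exp (-waveRoot * (n * N * t : ℝ)))
      (R * Complex.exp (-waveRoot * (N * t : ℝ))) hξ
    rw [hpow] at this
    change _ * convIter d (fun ξ => _) n ξ = _
    simp only [twoBump]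
    rw [this]
    ring
  have hW := norm_setIntegral_Wsym_exp_ge (norm_pos_iff.2 hξ0) hξ hT hT1
    (by linarith : 0 < n * N) (by nlinarith)
  have hcoef : ‖((n : ℂ) + 1) * (R : ℂ) ^ (n + 1)‖ₑ =
      ENNReal.ofReal ((n + 1) * R ^ (n + 1)) := by
    rw [← ofReal_norm, norm_mul, norm_pow, Complex.norm_real, Real.norm_of_nonneg hR]
    congr 2
    norm_cast
  rw [heq, enorm_mul, enorm_mul, hcoef, ENNReal.ofReal_mul (by positivity), mul_right_comm]
  refine mul_le_mul' le_rfl ?_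
  rw [← ofReal_norm]
  exact ENNReal.ofReal_le_ofReal hW

lemma measurable_apply_left {d : ℕ} {f : ℝ → Edim d → ℂ}
    (hf : Measurable (fun p : ℝ × Edim d => f p.1 p.2)) (t : ℝ) : Measurable (f t) :=
  hf.comp measurable_prodMk_left

lemma le_setLIntegral_of_duhamel {d n : ℕ} {δ N R T : ℝ} {e : Edim d} (he : ‖e‖ = 1)
    (hn : 1 ≤ n) (hδ : (n + 1) * δ ≤ 1) (hN : 2 < N) (hR : 0 ≤ R) (hT : 0 < T) (hT1 : T ≤ 1)
    (hNT : 512 ≤ N * T) {u : ℝ → Edim d → ℂ} {v : Edim d → ℂ} {A : ℝ → ℝ≥0∞} {C D : ℝ≥0∞}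
    (hu : Measurable (fun p : ℝ × Edim d => u p.1 p.2)) (hv : Measurable v)
    (hduh : ∀ᵐ ξ, u T ξ = v ξ - duhamelOp T (fun t => convIter d (u t) n) T ξ)
    (hA : ∀ t ∈ Set.Icc 0 T, A t < ⊤)
    (hAint : ∫⁻ t in Set.Ioc 0 T, A t ^ (n + 1) < ⊤)
    (huA : ∀ t ∈ Set.Icc 0 T, FLNorm d (u t) ≤ A t)
    (hgA : ∀ t ∈ Set.Icc 0 T, FLNorm d (twoBump δ n N e
          (R * Complex.exp (-waveRoot * (n * N * t : ℝ)))
          (R * Complex.exp (-waveRoot * (N * t : ℝ)))) ≤ A t)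
    (hug : ∀ t ∈ Set.Icc 0 T, FLNorm d (fun ξ => u t ξ - twoBump δ n N e
          (R * Complex.exp (-waveRoot * (n * N * t : ℝ)))
          (R * Complex.exp (-waveRoot * (N * t : ℝ))) ξ) ≤ C)
    (hC : ENNReal.ofReal T * ∫⁻ t in Set.Ioc 0 T, (n + 1) * A t ^ n * C ≤ 1)
    (hvD : ∫⁻ ξ in Metric.closedBall 0 1, ‖v ξ‖ₑ ≤ D) :
    ENNReal.ofReal ((n + 1) * R ^ (n + 1) * (T / (32 * (n * N)))) *
        volume (Metric.closedBall (0 : Edim d) δ) ^ (n + 1) ≤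
      (∫⁻ ξ in Metric.closedBall 0 1, ‖u T ξ‖ₑ) + D + 1 := by
  have : Nontrivial (Edim d) := ⟨e, 0, norm_ne_zero_iff.1 (by rw [he]; exact one_ne_zero)⟩
  set g : ℝ → Edim d → ℂ := fun t => twoBump δ n N e
    (R * Complex.exp (-waveRoot * (n * N * t : ℝ)))
    (R * Complex.exp (-waveRoot * (N * t : ℝ))) with hg
  have hgm : Measurable (fun p : ℝ × Edim d => g p.1 p.2) :=
    measurable_twoBump_param (α := fun t => R * Complex.exp (-waveRoot * (n * N * t : ℝ)))
      (β := fun t => R * Complex.exp (-waveRoot * (N * t : ℝ))) (by fun_prop) (by fun_prop)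
  have hut : ∀ t, Measurable (u t) := fun t => measurable_apply_left hu t
  have hgt : ∀ t, Measurable (g t) := fun t => measurable_twoBump _ _
  have hTT : T ∈ Set.Icc 0 T := ⟨hT.le, le_rfl⟩
  have huc := measurable_convIter_param hu n
  have hgc := measurable_convIter_param hgm n
  have hfinInt : ∀ f : ℝ → Edim d → ℂ, (∀ t, Measurable (f t)) →
      (∀ t ∈ Set.Icc 0 T, FLNorm d (f t) ≤ A t) →
      ∫⁻ t in Set.Ioc 0 T, FLNorm d (convIter d (f t) n) < ⊤ := fun f hf hfA =>
    lt_of_le_of_lt (setLIntegral_mono' measurableSet_Ioc fun t ht =>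
      FLNorm_convIter_le (hf t) (hfA t ⟨ht.1.le, ht.2⟩) n) hAint
  set Du := duhamelOp T (fun t => convIter d (u t) n) T with hDu
  set Dg := duhamelOp T (fun t => convIter d (g t) n) T with hDg
  have hdiff : FLNorm d (fun ξ => Du ξ - Dg ξ) ≤ 1 := by
    refine (FLNorm_duhamelOp_sub_le hTT huc hgc (hfinInt u hut huA) (hfinInt g hgt hgA)).trans
      (le_trans ?_ hC)
    refine mul_le_mul' le_rfl (setLIntegral_mono' measurableSet_Ioc fun t ht => ?_)
    have ht' : t ∈ Set.Icc 0 T := ⟨ht.1.le, ht.2⟩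
    exact (FLNorm_convIter_sub_le (hA t ht') (hut t) (hgt t) (huA t ht') (hgA t ht') n).trans
      (mul_le_mul' le_rfl (hug t ht'))
  have hne : ∀ᵐ ξ : Edim d, ξ ≠ 0 := by
    simp [ae_iff]
  calc _ ≤ ENNReal.ofReal ((n + 1) * R ^ (n + 1) * (T / (32 * (n * N)))) *
        ∫⁻ ξ in Metric.closedBall 0 1, ‖convIter d (ballBump d δ) n ξ‖ₑ :=
        mul_le_mul' le_rfl (le_setLIntegral_convIter_ballBump n hδ)
    _ = ∫⁻ ξ in Metric.closedBall 0 1, ENNReal.ofReal ((n + 1) * R ^ (n + 1) *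
        (T / (32 * (n * N)))) * ‖convIter d (ballBump d δ) n ξ‖ₑ :=
        (lintegral_const_mul _ (measurable_convIter (measurable_ballBump d δ) n).enorm).symm
    _ ≤ ∫⁻ ξ in Metric.closedBall 0 1, (‖u T ξ‖ₑ + ‖v ξ‖ₑ + ‖Du ξ - Dg ξ‖ₑ) := by
        refine setLIntegral_mono_ae' measurableSet_closedBall ?_
        filter_upwards [hne, hduh] with ξ hξ0 hξ hξB
        refine (le_enorm_duhamelOp_twoBump he hn hδ hN hR hT hT1 hNT hξ0
          (by simpa using hξB)).trans ?_
        have hD : Dg ξ = (v ξ - u T ξ) - (Du ξ - Dg ξ) := by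
          rw [hξ]; ring
        calc ‖Dg ξ‖ₑ = ‖(v ξ - u T ξ) - (Du ξ - Dg ξ)‖ₑ := by rw [← hD]
          _ ≤ ‖v ξ‖ₑ + ‖u T ξ‖ₑ + ‖Du ξ - Dg ξ‖ₑ :=
            enorm_sub_le.trans (add_le_add enorm_sub_le le_rfl)
          _ = _ := by rw [add_comm ‖v ξ‖ₑ]
    _ ≤ _ := by
        rw [lintegral_add_left (by fun_prop), lintegral_add_left (hut T).enorm]
        exact add_le_add (add_le_add le_rfl hvD) ((setLIntegral_le_lintegral _ _).trans hdiff)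

/-! ### Choice of parameters -/

lemma setLIntegral_ofReal_exp_add_pow_le {M C N T : ℝ} {j : ℕ} (hj : 1 ≤ j) (hM : 0 ≤ M)
    (hC : 0 ≤ C) (hN : 0 < N) (hT : 0 < T) :
    ∫⁻ t in Set.Ioc 0 T, ENNReal.ofReal (M * Real.exp (-(N * t) / 4) + C) ^ j ≤
      ENNReal.ofReal (2 ^ j * (4 * M ^ j / N + T * C ^ j)) := by
  have hE : ∫⁻ t in Set.Ioc 0 T, ENNReal.ofReal (Real.exp (-(N / 4) * t)) ≤
      ENNReal.ofReal (4 / N) := by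
    refine (lintegral_mono_set Set.Ioc_subset_Ioi_self).trans (le_of_eq ?_)
    have hN4 : -(N / 4) < 0 := by linarith
    rw [← ofReal_integral_eq_lintegral_ofReal (integrableOn_exp_mul_Ioi hN4 0)
      (ae_of_all _ fun _ => (Real.exp_pos _).le), integral_exp_mul_Ioi hN4]
    congr 1
    simp
  have hpt : ∀ t ∈ Set.Ioc 0 T, ENNReal.ofReal (M * Real.exp (-(N * t) / 4) + C) ^ j ≤
      ENNReal.ofReal (2 ^ j * M ^ j) * ENNReal.ofReal (Real.exp (-(N / 4) * t)) +
        ENNReal.ofReal (2 ^ j * C ^ j) := by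
    intro t ht
    rw [← ENNReal.ofReal_pow (by positivity), ← ENNReal.ofReal_mul (by positivity),
      ← ENNReal.ofReal_add (by positivity) (by positivity)]
    refine ENNReal.ofReal_le_ofReal ?_
    have hexp : Real.exp (-(N * t) / 4) = Real.exp (-(N / 4) * t) := by
      congr 1
      ring
    have hE1 : Real.exp (-(N / 4) * t) ≤ 1 := by
      rw [Real.exp_le_one_iff]
      nlinarith [ht.1]
    have hEj : Real.exp (-(N / 4) * t) ^ j ≤ Real.exp (-(N / 4) * t) :=
      pow_le_of_le_one (Real.exp_pos _).le hE1 (by omega)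
    rw [hexp]
    set E := Real.exp (-(N / 4) * t) with hEdef
    have hE0 : 0 ≤ E := (Real.exp_pos _).le
    calc (M * E + C) ^ j ≤ 2 ^ (j - 1) * ((M * E) ^ j + C ^ j) :=
          add_pow_le (by positivity) hC j
      _ ≤ 2 ^ j * ((M * E) ^ j + C ^ j) := by
          gcongr
          · norm_num
          · omega
      _ ≤ 2 ^ j * (M ^ j * E + C ^ j) := by
          rw [mul_pow]
          gcongr
      _ = _ := by ring
  calc _ ≤ ∫⁻ t in Set.Ioc 0 T,
        (ENNReal.ofReal (2 ^ j * M ^ j) * ENNReal.ofReal (Real.exp (-(N / 4) * t)) +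
          ENNReal.ofReal (2 ^ j * C ^ j)) := setLIntegral_mono' measurableSet_Ioc hpt
    _ = ENNReal.ofReal (2 ^ j * M ^ j) *
          (∫⁻ t in Set.Ioc 0 T, ENNReal.ofReal (Real.exp (-(N / 4) * t))) +
        ENNReal.ofReal (2 ^ j * C ^ j) * ENNReal.ofReal T := by
        rw [lintegral_add_right _ measurable_const, lintegral_const_mul _ (by fun_prop)]
        simp
    _ ≤ ENNReal.ofReal (2 ^ j * M ^ j) * ENNReal.ofReal (4 / N) +
        ENNReal.ofReal (2 ^ j * C ^ j) * ENNReal.ofReal T := by gcongr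
    _ = _ := by
        rw [← ENNReal.ofReal_mul (by positivity), ← ENNReal.ofReal_mul (by positivity),
          ← ENNReal.ofReal_add (by positivity) (by positivity)]
        congr 1
        ring

lemma exists_inflation_time {n : ℕ} {C τ : ℝ} (hτ : 0 < τ) (hC : 0 < C) :
    ∃ T : ℝ, 0 < T ∧ T < τ ∧ T ≤ 1 ∧ T * (2 ^ (n + 1) * (T * C ^ (n + 1))) ≤ 1 ∧
      T * ((n + 1) * (2 ^ n * (T * C ^ n))) < 1 / (2 * C) := by
  have l0 : Tendsto (fun T : ℝ => T) (𝓝[>] 0) (𝓝 0) := tendsto_nhdsWithin_of_tendsto_nhds tendsto_id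
  have l1 : Tendsto (fun T : ℝ => T * (2 ^ (n + 1) * (T * C ^ (n + 1)))) (𝓝[>] 0) (𝓝 0) := by
    have h : Continuous (fun T : ℝ => T * (2 ^ (n + 1) * (T * C ^ (n + 1)))) := by fun_prop
    simpa using tendsto_nhdsWithin_of_tendsto_nhds (h.tendsto 0)
  have l2 : Tendsto (fun T : ℝ => T * ((n + 1) * (2 ^ n * (T * C ^ n)))) (𝓝[>] 0) (𝓝 0) := by
    have h : Continuous (fun T : ℝ => T * ((n + 1) * (2 ^ n * (T * C ^ n)))) := by fun_prop
    simpa using tendsto_nhdsWithin_of_tendsto_nhds (h.tendsto 0)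
  obtain ⟨T, h0, h1, h2, h3, h4⟩ := ((eventually_mem_nhdsWithin (a := (0 : ℝ)) (s := Set.Ioi 0)).and
    ((l0.eventually (gt_mem_nhds hτ)).and ((l0.eventually (ge_mem_nhds one_pos)).and
      ((l1.eventually (ge_mem_nhds one_pos)).and
        (l2.eventually (gt_mem_nhds (by positivity : 0 < 1 / (2 * C)))))))).exists
  exact ⟨T, h0, h1, h2, h3, h4⟩

lemma exists_inflation_parameters {n : ℕ} (hn : 1 ≤ n) {s q μ C τ η : ℝ}
    (hs : s < -1 / (n + 1)) (hμ : 0 < μ) (hC : 0 < C) (hτ : 0 < τ) (hη : 0 < η) :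
    ∃ T N R : ℝ, 0 < T ∧ T < τ ∧ T ≤ 1 ∧ 2 < N ∧ 0 ≤ R ∧ 512 ≤ N * T ∧
      R ^ (n + 1) * T = μ * N ∧ 8 * R / N * q ≤ 1 ∧
      4 * R ^ 2 * (N / 2) ^ (2 * s) * q < η ∧
      T * (2 ^ (n + 1) * (4 * (2 * R * q) ^ (n + 1) / N + T * C ^ (n + 1))) ≤
        2 ^ (n + 3) * (2 * q) ^ (n + 1) * μ + 1 ∧
      T * ((n + 1) * (2 ^ n * (4 * (2 * R * q) ^ n / N + T * C ^ n))) ≤ 1 / (2 * C) := by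
  obtain ⟨T, hT, hTτ, hT1, hTa, hTb⟩ := exists_inflation_time (n := n) hτ hC
  have hn' : (1 : ℝ) ≤ n := by exact_mod_cast hn
  set a : ℝ := 1 / (n + 1) with ha
  have ha0 : 0 < a := by positivity
  have han : a * (n + 1 : ℕ) = 1 := by
    push_cast
    rw [ha]
    field_simp
  have ha1 : a < 1 := by
    rw [ha, div_lt_one (by positivity)]
    linarith
  have has : 0 < -(2 * a + 2 * s) := by
    have : s < -a := by rw [ha, ← neg_div]; exact hs
    linarith
  set c : ℝ := (μ / T) ^ a with hc
  have lim : ∀ y : ℝ, 0 < y → ∀ C' : ℝ, Tendsto (fun N : ℝ => C' * N ^ (-y)) atTop (𝓝 0) :=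
    fun y hy C' => by simpa using (tendsto_rpow_neg_atTop hy).const_mul C'
  have l1 := lim (1 - a) (by linarith) (8 * c * q)
  have l2 := lim _ has (4 * c ^ 2 * (2⁻¹ : ℝ) ^ (2 * s) * q)
  have l3 : Tendsto (fun N : ℝ => T * ((n + 1) * (2 ^ n * (4 * (2 * c * q) ^ n * N ^ (-a) +
      T * C ^ n)))) atTop (𝓝 (T * ((n + 1) * (2 ^ n * (T * C ^ n))))) := by
    have := ((((lim a ha0 (4 * (2 * c * q) ^ n)).add_const (T * C ^ n)).const_mul
      (2 ^ n : ℝ)).const_mul (n + 1 : ℝ)).const_mul T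
    simpa using this
  obtain ⟨N, hN2, hNT, h1, h2, h3⟩ := ((eventually_gt_atTop (2 : ℝ)).and
    ((eventually_ge_atTop (512 / T)).and ((l1.eventually (ge_mem_nhds one_pos)).and
      ((l2.eventually (gt_mem_nhds hη)).and (l3.eventually (ge_mem_nhds hTb)))))).exists
  have hN0 : 0 < N := by linarith
  have hRN : ∀ j : ℕ, (c * N ^ a) ^ j = c ^ j * N ^ (a * j) := fun j => by
    rw [mul_pow, Real.rpow_mul_natCast hN0.le]
  have hRn1 : (c * N ^ a) ^ (n + 1) * T = μ * N := by
    rw [hRN, han, Real.rpow_one, hc, ← Real.rpow_mul_natCast (by positivity), han, Real.rpow_one]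
    field_simp
  have hRn : (c * N ^ a) ^ n / N = c ^ n * N ^ (-a) := by
    rw [hRN, mul_div_assoc, ← Real.rpow_sub_one hN0.ne']
    congr 2
    push_cast at han
    linarith
  refine ⟨T, N, c * N ^ a, hT, hTτ, hT1, hN2, by positivity, (div_le_iff₀ hT).1 hNT, hRn1,
    ?_, ?_, ?_, ?_⟩
  · refine le_trans (le_of_eq ?_) h1
    have : N ^ a / N = N ^ (-(1 - a)) := by
      rw [← Real.rpow_sub_one hN0.ne']
      congr 1
      ring
    rw [← this]
    ring
  · refine lt_of_eq_of_lt ?_ h2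
    have : (N / 2) ^ (2 * s) = N ^ (2 * s) * (2⁻¹ : ℝ) ^ (2 * s) := by
      rw [div_eq_mul_inv, Real.mul_rpow hN0.le (by norm_num)]
    rw [hRN, this, neg_neg, Real.rpow_add hN0]
    push_cast
    rw [mul_comm a 2]
    ring
  · have : T * (4 * (2 * (c * N ^ a) * q) ^ (n + 1) / N) = 4 * (2 * q) ^ (n + 1) * μ := by
      have h : 4 * (2 * (c * N ^ a) * q) ^ (n + 1) =
          4 * (2 * q) ^ (n + 1) * (c * N ^ a) ^ (n + 1) := by ring
      rw [h, mul_div_assoc', div_eq_iff hN0.ne']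
      linear_combination 4 * (2 * q) ^ (n + 1) * hRn1
    calc _ = 2 ^ (n + 1) * (T * (4 * (2 * (c * N ^ a) * q) ^ (n + 1) / N)) +
          T * (2 ^ (n + 1) * (T * C ^ (n + 1))) := by ring
      _ ≤ 2 ^ (n + 1) * (4 * (2 * q) ^ (n + 1) * μ) + 1 := by rw [this]; linarith
      _ = _ := by ring
  · refine le_trans (le_of_eq ?_) h3
    have : 4 * (2 * (c * N ^ a) * q) ^ n / N = 4 * (2 * c * q) ^ n * N ^ (-a) := by
      calc _ = 4 * (2 * q) ^ n * ((c * N ^ a) ^ n / N) := by ring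
        _ = _ := by rw [hRn]; ring
    rw [this]

/-! ### Norm inflation -/

lemma pairHsNorm_add_sub_lt {d : ℕ} {s ε : ℝ} {φ₀ φ₁ ψ₀ ψ₁ F₀ F₁ : Edim d → ℂ} (hε : 0 < ε)
    (hφ₀ : Measurable φ₀) (hφ₁ : Measurable φ₁)
    (h₁ : HsNormSq d s φ₀ ≤ ENNReal.ofReal (ε ^ 2 / 16))
    (h₂ : HsNormSq d (s - 1) φ₁ ≤ ENNReal.ofReal (ε ^ 2 / 16))
    (h₃ : HsNormSq d s (fun ξ => ψ₀ ξ - F₀ ξ) ≤ ENNReal.ofReal (ε ^ 2 / 16))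
    (h₄ : HsNormSq d (s - 1) (fun ξ => ψ₁ ξ - F₁ ξ) ≤ ENNReal.ofReal (ε ^ 2 / 16)) :
    pairHsNorm d s (fun ξ => φ₀ ξ + ψ₀ ξ - F₀ ξ) (fun ξ => φ₁ ξ + ψ₁ ξ - F₁ ξ) <
      ENNReal.ofReal ε := by
  have key : HsNormSq d s (fun ξ => φ₀ ξ + ψ₀ ξ - F₀ ξ) +
      HsNormSq d (s - 1) (fun ξ => φ₁ ξ + ψ₁ ξ - F₁ ξ) < ENNReal.ofReal (ε ^ 2) := by
    simp only [add_sub_assoc]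
    calc _ ≤ (2 * ENNReal.ofReal (ε ^ 2 / 16) + 2 * ENNReal.ofReal (ε ^ 2 / 16)) +
          (2 * ENNReal.ofReal (ε ^ 2 / 16) + 2 * ENNReal.ofReal (ε ^ 2 / 16)) := by
          refine add_le_add ((HsNormSq_add_le hφ₀).trans ?_) ((HsNormSq_add_le hφ₁).trans ?_) <;>
          gcongr
      _ = ENNReal.ofReal (ε ^ 2 / 2) := by
          rw [mul_comm, ofReal_mul_two (by positivity), ← ENNReal.ofReal_add (by positivity)
            (by positivity), ← ENNReal.ofReal_add (by positivity) (by positivity)]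
          congr 1
          ring
      _ < _ := (ENNReal.ofReal_lt_ofReal_iff (by positivity)).2 (half_lt_self (by positivity))
  calc pairHsNorm d s _ _ < ENNReal.ofReal (ε ^ 2) ^ (1 / 2 : ℝ) :=
        ENNReal.rpow_lt_rpow key (by norm_num)
    _ = ENNReal.ofReal ε := by
        rw [ENNReal.ofReal_rpow_of_pos (by positivity), ← Real.sqrt_eq_rpow, Real.sqrt_sq hε.le]

lemma exists_isDuhamelSolution_twoBump_add {d n : ℕ} {δ N R T q Cψ ρ : ℝ} {e : Edim d}
    (he : ‖e‖ = 1) (hn : 1 ≤ n) (hδ0 : 0 < δ) (hδ : (n + 1) * δ ≤ 1) (hN : 2 < N) (hR : 0 ≤ R)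
    (hT : 0 < T) (hT1 : T ≤ 1) (hNT : 512 ≤ N * T) {ψ₀ ψ₁ : Edim d → ℂ} (hψ₀ : Measurable ψ₀)
    (hψ₁ : Measurable ψ₁) (nψ₀ : FLNorm d ψ₀ < ⊤) (nψ₁ : FLNorm d ψ₁ < ⊤)
    (hCψ : 2 * FLNorm d ψ₀ + FLNorm d ψ₁ ≤ ENNReal.ofReal Cψ) (hCψ0 : 0 ≤ Cψ) (hρ : 0 ≤ ρ)
    (hq0 : 0 ≤ q) (hq : volume (Metric.closedBall (0 : Edim d) δ) = ENNReal.ofReal q)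
    (h8 : 8 * R / N * q ≤ 1)
    (h1 : T * (2 ^ (n + 1) * (4 * (2 * R * q) ^ (n + 1) / N + T * (Cψ + ρ + 1) ^ (n + 1))) ≤ ρ)
    (h2 : T * ((n + 1) * (2 ^ n * (4 * (2 * R * q) ^ n / N + T * (Cψ + ρ + 1) ^ n))) ≤
      1 / (2 * (Cψ + ρ + 1))) :
    ∃ u : ℝ → Edim d → ℂ, Measurable (fun p : ℝ × Edim d => u p.1 p.2) ∧
      IsDuhamelSolution d (n + 1) T (fun ξ => twoBump δ n N e R R ξ + ψ₀ ξ)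
        (fun ξ => -waveRoot * ‖ξ‖ * twoBump δ n N e R R ξ + ψ₁ ξ) u ∧
      ENNReal.ofReal ((n + 1) * R ^ (n + 1) * (T / (32 * (n * N)))) *
          volume (Metric.closedBall (0 : Edim d) δ) ^ (n + 1) ≤
        (∫⁻ ξ in Metric.closedBall 0 1, ‖u T ξ‖ₑ) + ENNReal.ofReal Cψ + 1 := by
  have hn' : (1 : ℝ) ≤ n := by exact_mod_cast hn
  have hδ1 : δ ≤ 1 := by nlinarith
  have hN0 : 0 < N := by linarith
  set C : ℝ := Cψ + ρ + 1 with hC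
  have hC1 : 1 ≤ C := by linarith
  set φ : Edim d → ℂ := twoBump δ n N e R R with hφ
  have hφm : Measurable φ := measurable_twoBump _ _
  have hφ₁m : Measurable (fun ξ => -waveRoot * ‖ξ‖ * φ ξ) := by fun_prop
  have hφn : FLNorm d φ ≤ ENNReal.ofReal (2 * R * q) := by
    refine (FLNorm_twoBump_le _ _).trans (le_of_eq ?_)
    have hRe : ‖(R : ℂ)‖ₑ = ENNReal.ofReal R := by
      rw [← ofReal_norm, Complex.norm_real, Real.norm_of_nonneg hR]
    rw [hRe, hq, ← ENNReal.ofReal_add hR hR, ← ENNReal.ofReal_mul (by positivity)]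
    congr 1
    ring
  have hφtop : FLNorm d φ < ⊤ := hφn.trans_lt ENNReal.ofReal_lt_top
  have hφ₁top : FLNorm d (fun ξ => -waveRoot * ‖ξ‖ * φ ξ) < ⊤ :=
    (FLNorm_norm_mul_twoBump_le he hn hδ1 hN.le _ _).trans_lt
      (ENNReal.mul_lt_top ENNReal.ofReal_lt_top hφtop)
  set G₀ : Edim d → ℂ := fun ξ => φ ξ + ψ₀ ξ with hG₀
  set G₁ : Edim d → ℂ := fun ξ => -waveRoot * ‖ξ‖ * φ ξ + ψ₁ ξ with hG₁
  have hG₀m : Measurable G₀ := hφm.add hψ₀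
  have hG₁m : Measurable G₁ := hφ₁m.add hψ₁
  have hG₀n : FLNorm d G₀ < ⊤ := (FLNorm_add_le hφm).trans_lt (ENNReal.add_lt_top.2 ⟨hφtop, nψ₀⟩)
  have hG₁n : FLNorm d G₁ < ⊤ :=
    (FLNorm_add_le hφ₁m).trans_lt (ENNReal.add_lt_top.2 ⟨hφ₁top, nψ₁⟩)
  have hV : ∀ t ξ, Vflow d G₀ G₁ t ξ =
      Complex.exp (-waveRoot * (‖ξ‖ * t : ℝ)) * φ ξ + Vflow d ψ₀ ψ₁ t ξ := fun t ξ => by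
    rw [hG₀, hG₁, Vflow_add, Vflow_waveRoot]
  have hVm : ∀ t, Measurable (Vflow d G₀ G₁ t) := measurable_Vflow_apply hG₀m hG₁m
  have hφt : ∀ t : ℝ, Measurable
      (fun ξ : Edim d => Complex.exp (-waveRoot * (‖ξ‖ * t : ℝ)) * φ ξ) := by
    intro t
    fun_prop
  have hφtn : ∀ t, 0 ≤ t →
      FLNorm d (fun ξ : Edim d => Complex.exp (-waveRoot * (‖ξ‖ * t : ℝ)) * φ ξ) ≤
        ENNReal.ofReal (2 * R * q * Real.exp (-(N * t) / 4)) := by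
    intro t ht
    refine (FLNorm_exp_mul_twoBump_le he hn hδ1 hN.le _ _ ht).trans ?_
    rw [mul_comm, ENNReal.ofReal_mul (by positivity)]
    exact mul_le_mul' hφn le_rfl
  have hψt : ∀ t ∈ Set.Icc 0 T, FLNorm d (Vflow d ψ₀ ψ₁ t) ≤ ENNReal.ofReal Cψ := fun t ht =>
    (FLNorm_Vflow_le hψ₀ ⟨ht.1, ht.2.trans hT1⟩).trans hCψ
  set b : ℝ → ℝ≥0∞ := fun t => ENNReal.ofReal (2 * R * q * Real.exp (-(N * t) / 4) + Cψ) with hb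
  set A : ℝ → ℝ≥0∞ := fun t => ENNReal.ofReal (2 * R * q * Real.exp (-(N * t) / 4) + C) with hA
  have hbA : ∀ t, b t + ENNReal.ofReal ρ ≤ A t := fun t => by
    simp only [hb, hA]
    rw [← ENNReal.ofReal_add (by positivity) hρ]
    exact ENNReal.ofReal_le_ofReal (by linarith)
  have hlb : ∀ t ∈ Set.Icc 0 T, FLNorm d (Vflow d G₀ G₁ t) ≤ b t := fun t ht => by
    have : Vflow d G₀ G₁ t = fun ξ => Complex.exp (-waveRoot * (‖ξ‖ * t : ℝ)) * φ ξ +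
        Vflow d ψ₀ ψ₁ t ξ := funext (hV t)
    rw [this]
    simp only [hb]
    rw [ENNReal.ofReal_add (by positivity) hCψ0]
    exact (FLNorm_add_le (hφt t)).trans (add_le_add (hφtn t ht.1) (hψt t ht))
  have hApow : ∫⁻ t in Set.Ioc 0 T, A t ^ (n + 1) ≤
      ENNReal.ofReal (2 ^ (n + 1) * (4 * (2 * R * q) ^ (n + 1) / N + T * C ^ (n + 1))) :=
    setLIntegral_ofReal_exp_add_pow_le (by omega) (by positivity) (by linarith) hN0 hT
  have hApow' : ENNReal.ofReal T * ∫⁻ t in Set.Ioc 0 T, (n + 1) * A t ^ n ≤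
      ENNReal.ofReal (1 / (2 * C)) := by
    rw [lintegral_const_mul _ (by fun_prop)]
    have hcast : ((n : ℝ≥0∞) + 1) = ENNReal.ofReal (n + 1) := by
      rw [ENNReal.ofReal_add (by positivity) zero_le_one, ENNReal.ofReal_natCast,
        ENNReal.ofReal_one]
    refine le_trans ?_ (ENNReal.ofReal_le_ofReal h2)
    rw [ENNReal.ofReal_mul hT.le, ENNReal.ofReal_mul (by positivity), ← hcast]
    gcongr
    exact setLIntegral_ofReal_exp_add_pow_le hn (by positivity) (by linarith) hN0 hT
  obtain ⟨u, hum, hu, hρu, hduh⟩ := exists_isDuhamelSolution (n := n) hT hT1 hG₀m hG₁m hG₀n hG₁n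
    (b := b) (ρ := ENNReal.ofReal ρ) (fun _ _ => ENNReal.ofReal_lt_top) ENNReal.ofReal_lt_top hlb
    (by
      refine le_trans ?_ (ENNReal.ofReal_le_ofReal h1)
      rw [ENNReal.ofReal_mul hT.le]
      exact mul_le_mul' le_rfl ((lintegral_mono fun t => pow_le_pow_left' (hbA t) _).trans hApow))
    (by
      have h2' : ENNReal.ofReal (1 / (2 * C)) ≤ 2⁻¹ := by
        rw [← ENNReal.ofReal_ofNat 2, ← ENNReal.ofReal_inv_of_pos two_pos]
        refine ENNReal.ofReal_le_ofReal ?_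
        rw [one_div]
        exact inv_anti₀ two_pos (by linarith)
      refine le_trans ?_ (hApow'.trans h2')
      exact mul_le_mul' le_rfl (lintegral_mono fun t =>
        mul_le_mul' le_rfl (pow_le_pow_left' (hbA t) _)))
  refine ⟨u, hum, hu, ?_⟩
  have hut := fun t => measurable_apply_left hum t
  have h8' : ∀ t, 0 ≤ t → FLNorm d (fun ξ => Complex.exp (-waveRoot * (‖ξ‖ * t : ℝ)) * φ ξ -
      twoBump δ n N e (R * Complex.exp (-waveRoot * (n * N * t : ℝ)))
        (R * Complex.exp (-waveRoot * (N * t : ℝ))) ξ) ≤ 1 := by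
    intro t ht
    refine (FLNorm_exp_mul_twoBump_sub_le he hn hδ1 hN.le hR ht).trans ?_
    rw [hq, ← ENNReal.ofReal_mul (by positivity)]
    exact ENNReal.ofReal_le_one.2 h8
  refine le_setLIntegral_of_duhamel (A := A) (C := ENNReal.ofReal C) he hn hδ hN hR hT hT1 hNT hum
    (hVm T) (hduh T ⟨hT.le, le_rfl⟩) (fun _ _ => ENNReal.ofReal_lt_top)
    (hApow.trans_lt ENNReal.ofReal_lt_top) ?_ ?_ ?_ ?_ ?_
  · intro t ht
    exact (FLNorm_le_add_sub (hVm t)).trans ((add_le_add (hlb t ht) (hρu t ht)).trans (hbA t))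
  · intro t ht
    refine (FLNorm_le_add_sub (hφt t)).trans ?_
    rw [FLNorm_sub_comm]
    refine (add_le_add (hφtn t ht.1) (h8' t ht.1)).trans ?_
    simp only [hA]
    rw [ENNReal.ofReal_add (by positivity) (by linarith)]
    exact add_le_add le_rfl (ENNReal.one_le_ofReal.2 hC1)
  · intro t ht
    set g := twoBump δ n N e (R * Complex.exp (-waveRoot * (n * N * t : ℝ)))
        (R * Complex.exp (-waveRoot * (N * t : ℝ))) with hg
    have hgm : Measurable g := measurable_twoBump _ _
    have hut' := hut t
    have hVt := hVm t
    have hφt' := hφt t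
    have hsplit : (fun ξ => u t ξ - g ξ) = fun ξ => ((u t ξ - Vflow d G₀ G₁ t ξ) +
        (Complex.exp (-waveRoot * (‖ξ‖ * t : ℝ)) * φ ξ - g ξ)) + Vflow d ψ₀ ψ₁ t ξ := by
      funext ξ
      rw [hV]
      ring
    rw [hsplit]
    have hm₁ : Measurable (fun ξ => u t ξ - Vflow d G₀ G₁ t ξ) := hut'.sub hVt
    have hm₂ : Measurable (fun ξ => Complex.exp (-waveRoot * (‖ξ‖ * t : ℝ)) * φ ξ - g ξ) :=
      hφt'.sub hgm
    refine (FLNorm_add_le (hm₁.add hm₂)).trans ((add_le_add ((FLNorm_add_le hm₁).trans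
      (add_le_add (hρu t ht) (h8' t ht.1))) (hψt t ht)).trans (le_of_eq ?_))
    rw [← ENNReal.ofReal_one, ← ENNReal.ofReal_add hρ zero_le_one,
      ← ENNReal.ofReal_add (by positivity) hCψ0]
    congr 1
    rw [hC]
    ring
  · rw [lintegral_mul_const _ (by fun_prop), ← mul_assoc]
    refine (mul_le_mul' hApow' le_rfl).trans ?_
    rw [← ENNReal.ofReal_mul (by positivity)]
    refine ENNReal.ofReal_le_one.2 ?_
    rw [div_mul_eq_mul_div, div_le_one (by positivity)]
    linarith
  · refine le_trans ?_ (hψt T ⟨hT.le, le_rfl⟩)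
    rw [FLNorm_eq]
    refine le_trans (le_of_eq (setLIntegral_congr_fun measurableSet_closedBall fun ξ hξ => ?_))
      (setLIntegral_le_lintegral (Metric.closedBall 0 1) _)
    have h0 : φ ξ = 0 := by
      by_contra h
      have h3 := (norm_bounds_of_twoBump_ne_zero he hn hδ1 hN.le h).1
      have h4 : ‖ξ‖ ≤ 1 := by simpa using hξ
      linarith
    simp only [hV, h0, mul_zero, zero_add]

/-- (Theorem 1.1 (2), norm inflation with infinite loss of regularity,
`2 ≤ k ≤ 5`, `s < -1/k`, measured in `H^σ`), on `ℝ^d`, formulated on the Fourier side. -/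
theorem vNLW_norm_inflation_loss_of_regularity
    (d k : ℕ) (hd : 1 ≤ d) (hk2 : 2 ≤ k) (hk5 : k ≤ 5) (σ s : ℝ)
    (hs : s < -1 / (k : ℝ))
    (F₀ F₁ : Edim d → ℂ) (hF : MemHsPair d s F₀ F₁)
    (ε : ℝ) (hε : 0 < ε) :
    ∃ (G₀ G₁ : Edim d → ℂ) (T : ℝ) (u : ℝ → Edim d → ℂ) (tε : ℝ),
      MemFLPair d G₀ G₁ ∧ MemHsPair d s G₀ G₁ ∧ 0 < T ∧
      IsDuhamelSolution d k T G₀ G₁ u ∧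
      tε ∈ Set.Ioo 0 ε ∧ tε ≤ T ∧
      pairHsNorm d s (fun ξ => G₀ ξ - F₀ ξ) (fun ξ => G₁ ξ - F₁ ξ) < ENNReal.ofReal ε ∧
      ENNReal.ofReal (1 / ε) < HsNorm d σ (u tε) := by
  obtain ⟨n, rfl⟩ : ∃ n, k = n + 1 := ⟨k - 1, by omega⟩
  have hn : 1 ≤ n := by omega
  have hn0 : (0 : ℝ) < n := by exact_mod_cast hn
  push_cast at hs
  have hs0 : s ≤ 0 := hs.le.trans (div_nonpos_of_nonpos_of_nonneg (by norm_num) (by positivity))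
  set e : Edim d := EuclideanSpace.single ⟨0, hd⟩ 1 with he_def
  have he : ‖e‖ = 1 := by simp [he_def]
  set δ : ℝ := 1 / (n + 1) with hδ_def
  have hδ0 : 0 < δ := by positivity
  have hδ : (n + 1) * δ ≤ 1 := by
    rw [hδ_def, mul_one_div_cancel (by positivity)]
  have hδ1 : δ ≤ 1 := by
    rw [hδ_def, div_le_one (by positivity)]
    linarith
  have hvol : volume (Metric.closedBall (0 : Edim d) δ) < ⊤ := measure_closedBall_lt_top
  set q : ℝ := (volume (Metric.closedBall (0 : Edim d) δ)).toReal with hq_def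
  have hq : volume (Metric.closedBall (0 : Edim d) δ) = ENNReal.ofReal q :=
    (ENNReal.ofReal_toReal hvol.ne).symm
  have hq0 : 0 < q := ENNReal.toReal_pos (Metric.measure_closedBall_pos _ _ hδ0).ne' hvol.ne
  have hη : 0 < ε ^ 2 / 16 := by positivity
  obtain ⟨ψ₀, hψ₀, nψ₀, sψ₀, hψF₀⟩ :=
    exists_FLNorm_lt_top_HsNormSq_sub_lt hF.1 (ENNReal.ofReal_pos.2 hη)
  obtain ⟨ψ₁, hψ₁, nψ₁, sψ₁, hψF₁⟩ :=
    exists_FLNorm_lt_top_HsNormSq_sub_lt hF.2 (ENNReal.ofReal_pos.2 hη)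
  obtain ⟨c, hc, hσ⟩ := exists_setLIntegral_closedBall_le_HsNorm d σ
  set Cψ : ℝ := (2 * FLNorm d ψ₀ + FLNorm d ψ₁).toReal with hCψ_def
  have hCψ0 : 0 ≤ Cψ := ENNReal.toReal_nonneg
  have hCψ : 2 * FLNorm d ψ₀ + FLNorm d ψ₁ ≤ ENNReal.ofReal Cψ := by
    refine (ENNReal.ofReal_toReal (ENNReal.add_lt_top.2
      ⟨ENNReal.mul_lt_top (by simp) nψ₀, nψ₁⟩).ne).ge
  set K : ℝ := c / ε + Cψ + 2 with hK
  have hK0 : 0 < K := by positivity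
  set μ : ℝ := K * (32 * n) / ((n + 1) * q ^ (n + 1)) with hμ_def
  have hμ : 0 < μ := by positivity
  set ρ : ℝ := 2 ^ (n + 3) * (2 * q) ^ (n + 1) * μ + 1 with hρ_def
  have hρ : 0 < ρ := by positivity
  obtain ⟨T, N, R, hT, hTε, hT1, hN, hR, hNT, hRT, h8, hH, h1, h2⟩ :=
    exists_inflation_parameters hn (q := q) (C := Cψ + ρ + 1) hs hμ (by positivity) hε hη
  have hN0 : 0 < N := by linarith
  obtain ⟨u, hum, hu, hlow⟩ := exists_isDuhamelSolution_twoBump_add he hn hδ0 hδ hN hR hT hT1 hNT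
    hψ₀ hψ₁ nψ₀ nψ₁ hCψ hCψ0 hρ.le hq0.le hq h8 h1 h2
  have hφm : Measurable (twoBump δ n N e R R) := measurable_twoBump _ _
  have hφ₁m : Measurable (fun ξ => -waveRoot * ‖ξ‖ * twoBump δ n N e R R ξ) := by fun_prop
  have hφs : HsNormSq d s (twoBump δ n N e R R) ≤ ENNReal.ofReal (ε ^ 2 / 16) := by
    refine (HsNormSq_twoBump_le he hn hδ1 hN.le hs0).trans ?_
    rw [hq, ← ENNReal.ofReal_mul (by positivity)]
    exact ENNReal.ofReal_le_ofReal hH.le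
  have hφ₁s := (HsNormSq_norm_mul_le s (twoBump δ n N e R R)).trans hφs
  have hφn : FLNorm d (twoBump δ n N e R R) < ⊤ :=
    (FLNorm_twoBump_le _ _).trans_lt (ENNReal.mul_lt_top (by simp) hvol)
  have hφ₁n : FLNorm d (fun ξ => -waveRoot * ‖ξ‖ * twoBump δ n N e R R ξ) < ⊤ :=
    (FLNorm_norm_mul_twoBump_le he hn hδ1 hN.le _ _).trans_lt
      (ENNReal.mul_lt_top ENNReal.ofReal_lt_top hφn)
  have hHs : ∀ {s' : ℝ} {φ ψ : Edim d → ℂ}, Measurable φ → Measurable ψ →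
      HsNormSq d s' φ ≤ ENNReal.ofReal (ε ^ 2 / 16) → HsNormSq d s' ψ < ⊤ →
      MemHs d s' (fun ξ => φ ξ + ψ ξ) := fun hφ hψ nφ nψ =>
    ⟨hφ.add hψ, (HsNormSq_add_le hφ).trans_lt (ENNReal.add_lt_top.2
      ⟨ENNReal.mul_lt_top (by simp) (nφ.trans_lt ENNReal.ofReal_lt_top),
        ENNReal.mul_lt_top (by simp) nψ⟩)⟩
  refine ⟨_, _, T, u, T, ⟨hφm.add hψ₀, hφ₁m.add hψ₁, ENNReal.add_lt_top.2 ⟨?_, ?_⟩⟩,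
    ⟨hHs hφm hψ₀ hφs sψ₀, hHs hφ₁m hψ₁ hφ₁s sψ₁⟩, hT, hu, ⟨hT, hTε⟩, le_rfl,
    pairHsNorm_add_sub_lt hε hφm hφ₁m hφs hφ₁s hψF₀.le hψF₁.le, ?_⟩
  · exact (FLNorm_add_le hφm).trans_lt (ENNReal.add_lt_top.2 ⟨hφn, nψ₀⟩)
  · exact (FLm1Norm_le _).trans_lt
      ((FLNorm_add_le hφ₁m).trans_lt (ENNReal.add_lt_top.2 ⟨hφ₁n, nψ₁⟩))
  by_contra! hle
  have hcoef : (n + 1) * R ^ (n + 1) * (T / (32 * (n * N))) * q ^ (n + 1) = K := by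
    have : (n + 1) * R ^ (n + 1) * (T / (32 * (n * N))) =
        (n + 1) * (R ^ (n + 1) * T) / (32 * (n * N)) := by ring
    rw [this, hRT, hμ_def]
    field_simp
  rw [hq, ← ENNReal.ofReal_pow hq0.le, ← ENNReal.ofReal_mul (by positivity), hcoef] at hlow
  have hup : ENNReal.ofReal K ≤ ENNReal.ofReal (c * (1 / ε) + Cψ + 1) := by
    refine hlow.trans ?_
    rw [ENNReal.ofReal_add (by positivity) zero_le_one, ENNReal.ofReal_add (by positivity) hCψ0,
      ENNReal.ofReal_mul hc.le, ENNReal.ofReal_one]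
    gcongr
    exact (hσ _ (measurable_apply_left hum T)).trans (mul_le_mul' le_rfl hle)
  rw [ENNReal.ofReal_le_ofReal_iff (by positivity), mul_one_div] at hup
  linarith

end
end

section
/- Let d ≥ 1, let k be an integer with 2 ≤ k ≤ 5, and let s < d(1/2 − 1/k) − 1/k. Then sup{ ‖Ξ₁(u⃗₀)(t)‖_{H^s} : u⃗₀ ∈ F⃗L¹ ∩ 𝓗^s with ‖u⃗₀‖_{𝓗^s} ≤ 1, and t ∈ (0,1) } = ∞, where Ξ₁ is the first Picard iterate of vNLW. (Since for a C^k solution map the k-th derivative at the origin is given by k!·Ξ₁, this shows that the solution map of vNLW fails to be C^k in 𝓗^s(ℝ^d).) -/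
open MeasureTheory Real Set Filter Topology
open scoped ENNReal NNReal BigOperators

noncomputable section

/-- Iterated convolution of a nonnegative function, as a lower Lebesgue integral. -/
def lconvIter (d : ℕ) (F : Edim d → ℝ≥0∞) : ℕ → Edim d → ℝ≥0∞
  | 0 => F
  | n + 1 => fun ξ => ∫⁻ η, lconvIter d F n (ξ - η) * F η

theorem lconvIter_le {d : ℕ} {F : Edim d → ℝ≥0∞} {B : ℝ≥0∞} (hFm : Measurable F)
    (hB : ∀ η, F η ≤ B) (n : ℕ) (ξ : Edim d) :
    lconvIter d F n ξ ≤ B * (∫⁻ η, F η) ^ n := by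
  induction n generalizing ξ with
  | zero => simpa [lconvIter] using hB ξ
  | succ n ih =>
    calc lconvIter d F (n + 1) ξ ≤ ∫⁻ η, B * (∫⁻ η, F η) ^ n * F η :=
          lintegral_mono fun η => mul_le_mul_left (ih _) _
      _ = B * (∫⁻ η, F η) ^ (n + 1) := by
          rw [lintegral_const_mul _ hFm, pow_succ, mul_assoc]

/-- If `F ≥ R` near `q` and the iterated convolution is `≥ c` near `Q`, then the next iterated
convolution is bounded below near `Q + q`. -/
theorem le_lconvIter_succ {d : ℕ} {F : Edim d → ℝ≥0∞} {n : ℕ} {R c : ℝ≥0∞} {Q q : Edim d}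
    {r ρ : ℝ} (hF : ∀ η ∈ Metric.ball q r, R ≤ F η)
    (h : ∀ ξ ∈ Metric.ball Q (ρ + r), c ≤ lconvIter d F n ξ) :
    ∀ ξ ∈ Metric.ball (Q + q) ρ,
      c * R * volume (Metric.ball (0 : Edim d) r) ≤ lconvIter d F (n + 1) ξ := by
  intro ξ hξ
  have hvol : volume (Metric.ball (0 : Edim d) r) = volume (Metric.ball q r) :=
    (Measure.addHaar_ball_center volume q r).symm
  rw [hvol, ← setLIntegral_const]
  refine le_trans (setLIntegral_mono' Metric.isOpen_ball.measurableSet fun η hη => ?_)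
    (setLIntegral_le_lintegral (Metric.ball q r) _)
  refine mul_le_mul' (h _ ?_) (hF η hη)
  rw [mem_ball_iff_norm] at *
  calc ‖ξ - η - Q‖ = ‖(ξ - (Q + q)) - (η - q)‖ := by congr 1; abel
    _ ≤ ‖ξ - (Q + q)‖ + ‖η - q‖ := norm_sub_le _ _
    _ < ρ + r := add_lt_add hξ hη

/-- Iterated convolutions of `F(η) e^{-z|η|}` are Laplace transforms, in `z`, of nonnegative
weights. -/
theorem exists_laplace_repr {d : ℕ} {F : Edim d → ℝ} (hFm : Measurable F) (hF0 : ∀ η, 0 ≤ F η)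
    {a b B : ℝ} (hsupp : ∀ η, F η ≠ 0 → a ≤ ‖η‖ ∧ ‖η‖ ≤ b) (hB : ∀ η, F η ≤ B)
    (hint : ∫⁻ η, ENNReal.ofReal (F η) ≠ ⊤) (n : ℕ) :
    ∃ (X : Type) (_ : MeasurableSpace X) (μ : Measure X) (_ : SFinite μ) (w ρ : Edim d → X → ℝ),
      Measurable (Function.uncurry w) ∧ Measurable (Function.uncurry ρ) ∧
      (∀ ξ x, 0 ≤ w ξ x) ∧ (∀ ξ x, 0 ≤ ρ ξ x) ∧
      (∀ ξ x, w ξ x ≠ 0 → (n + 1) * a ≤ ρ ξ x ∧ ρ ξ x ≤ (n + 1) * b) ∧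
      (∀ ξ, ∫⁻ x, ENNReal.ofReal (w ξ x) ∂μ
        = lconvIter d (fun η => ENNReal.ofReal (F η)) n ξ) ∧
      (∀ (z : ℂ), 0 ≤ z.re → ∀ ξ, convIter d (fun η => (F η : ℂ) * Complex.exp (-z * ‖η‖)) n ξ
        = ∫ x, (w ξ x : ℂ) * Complex.exp (-z * ρ ξ x) ∂μ) := by
  induction n with
  | zero =>
    refine ⟨Unit, inferInstance, Measure.dirac (), inferInstance, fun ξ _ => F ξ,
      fun ξ _ => ‖ξ‖, hFm.comp measurable_fst, measurable_norm.comp measurable_fst,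
      fun ξ _ => hF0 ξ, fun ξ _ => norm_nonneg ξ, fun ξ _ h => by simpa using hsupp ξ h,
      fun ξ => by simp [lconvIter], fun z _ ξ => by simp [convIter]⟩
  | succ n ih =>
    obtain ⟨X, _, μ, _, w, ρ, hw, hρ, hw0, hρ0, hwρ, hlw, hconv⟩ := ih
    have hmap : ∀ ξ : Edim d, Measurable fun p : Edim d × X => (ξ - p.1, p.2) := fun ξ =>
      (measurable_const.sub measurable_fst).prodMk measurable_snd
    have hw' : Measurable (Function.uncurry fun (ξ : Edim d) (p : Edim d × X) =>
        w (ξ - p.1) p.2 * F p.1) := by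
      refine Measurable.mul (hw.comp (g := Function.uncurry w)
        (f := fun q : Edim d × (Edim d × X) => (q.1 - q.2.1, q.2.2)) ?_) ?_
      · fun_prop
      · exact hFm.comp (measurable_fst.comp measurable_snd)
    have hρ' : Measurable (Function.uncurry fun (ξ : Edim d) (p : Edim d × X) =>
        ρ (ξ - p.1) p.2 + ‖p.1‖) := by
      refine Measurable.add (hρ.comp (g := Function.uncurry ρ)
        (f := fun q : Edim d × (Edim d × X) => (q.1 - q.2.1, q.2.2)) ?_) ?_
      · fun_prop
      · fun_prop
    have hl : ∀ ξ, ∫⁻ p : Edim d × X, ENNReal.ofReal (w (ξ - p.1) p.2 * F p.1)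
        ∂(volume.prod μ) = lconvIter d (fun η => ENNReal.ofReal (F η)) (n + 1) ξ := by
      intro ξ
      have hm : Measurable fun p : Edim d × X => w (ξ - p.1) p.2 * F p.1 :=
        hw'.comp measurable_prodMk_left
      rw [lintegral_prod _ hm.ennreal_ofReal.aemeasurable]
      simp only [lconvIter]
      refine lintegral_congr fun η => ?_
      rw [← hlw, ← lintegral_mul_const']
      · simp_rw [ENNReal.ofReal_mul (hw0 _ _)]
      · exact ENNReal.ofReal_ne_top
    refine ⟨Edim d × X, inferInstance, volume.prod μ, inferInstance,
      fun ξ p => w (ξ - p.1) p.2 * F p.1, fun ξ p => ρ (ξ - p.1) p.2 + ‖p.1‖, hw', hρ',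
      fun ξ p => mul_nonneg (hw0 _ _) (hF0 _), fun ξ p => add_nonneg (hρ0 _ _) (norm_nonneg _),
      fun ξ p h => ?_, hl, fun z hz ξ => ?_⟩
    · have h1 := hwρ _ _ (left_ne_zero_of_mul h)
      have h2 := hsupp _ (right_ne_zero_of_mul h)
      push_cast
      constructor <;> linarith [h1.1, h1.2, h2.1, h2.2]
    · have hm : Measurable fun p : Edim d × X => w (ξ - p.1) p.2 * F p.1 :=
        hw'.comp measurable_prodMk_left
      have hm2 : Measurable fun p : Edim d × X => ρ (ξ - p.1) p.2 + ‖p.1‖ :=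
        hρ'.comp measurable_prodMk_left
      have hI : Integrable (fun p : Edim d × X => ((w (ξ - p.1) p.2 * F p.1 : ℝ) : ℂ) *
          Complex.exp (-z * ((ρ (ξ - p.1) p.2 + ‖p.1‖ : ℝ) : ℂ))) (volume.prod μ) := by
        refine ⟨by fun_prop, ?_⟩
        refine lt_of_le_of_lt (lintegral_mono (g := fun p : Edim d × X =>
          ENNReal.ofReal (w (ξ - p.1) p.2 * F p.1)) fun p => ?_) ?_
        · have h0 : 0 ≤ w (ξ - p.1) p.2 * F p.1 := mul_nonneg (hw0 _ _) (hF0 _)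
          rw [← ofReal_norm]
          refine ENNReal.ofReal_le_ofReal ?_
          rw [norm_mul, Complex.norm_real, Real.norm_of_nonneg h0, Complex.norm_exp]
          refine mul_le_of_le_one_right h0 (Real.exp_le_one_iff.mpr ?_)
          rw [Complex.re_mul_ofReal, Complex.neg_re]
          nlinarith [hρ0 (ξ - p.1) p.2, norm_nonneg p.1]
        · rw [hl]
          refine lt_of_le_of_lt (lconvIter_le hFm.ennreal_ofReal
            (fun η => ENNReal.ofReal_le_ofReal (hB η)) _ _) ?_
          exact ENNReal.mul_lt_top ENNReal.ofReal_lt_top (ENNReal.pow_lt_top hint.lt_top)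
      rw [integral_prod _ hI]
      simp only [convIter, conv]
      refine integral_congr_ae (ae_of_all _ fun η => ?_)
      simp only
      rw [hconv z hz, ← integral_mul_const]
      refine integral_congr_ae (ae_of_all _ fun x => ?_)
      simp only
      push_cast
      rw [mul_add, Complex.exp_add]
      ring

theorem listConv_ofFn_const (d n : ℕ) (f : Edim d → ℂ) :
    listConv d (List.ofFn fun _ : Fin (n + 1) => f) = convIter d f n := by
  have h : ∀ m (g : Edim d → ℂ), (List.replicate m f).foldl (conv d) g
      = (fun u => conv d u f)^[m] g := by
    intro m
    induction m with
    | zero => simp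
    | succ m ih => intro g; rw [List.replicate_succ, List.foldl_cons, ih, Function.iterate_succ_apply]
  rw [List.ofFn_const, List.replicate_succ, listConv, h]
  induction n with
  | zero => rfl
  | succ n ih => rw [Function.iterate_succ_apply', ih, convIter]

theorem Xi_one (d k : ℕ) (F₀ F₁ : Edim d → ℂ) (t : ℝ) (ξ : Edim d) :
    Xi d k F₀ F₁ 1 t ξ = Ik d k (fun _ => Vflow d F₀ F₁) t ξ := by
  rw [Xi]
  beta_reduce
  rw [Finset.sum_attach (Finset.Nat.antidiagonalTuple k 0)
    (fun l => Ik d k (fun i => Xi d k F₀ F₁ (l i)) t ξ)]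
  rw [Finset.Nat.antidiagonalTuple_zero_right, Finset.sum_singleton]
  congr 1
  funext i
  simp [Xi]

/-- The characteristic root `1/2 - (√3/2) i`: `e^{-λ|ξ|t}` solves the linear equation. -/
def charRoot : ℂ := ((1 / 2 : ℝ) : ℂ) - ((Real.sqrt 3 / 2 : ℝ) : ℂ) * Complex.I

theorem charRoot_re : charRoot.re = 1 / 2 := by simp [charRoot]

theorem charRoot_im : charRoot.im = -(Real.sqrt 3 / 2) := by simp [charRoot]

theorem norm_charRoot : ‖charRoot‖ = 1 := by
  have h : ‖charRoot‖ ^ 2 = 1 := by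
    rw [← Complex.normSq_eq_norm_sq, Complex.normSq_apply, charRoot_re, charRoot_im]
    nlinarith [Real.sq_sqrt (show (0 : ℝ) ≤ 3 by norm_num)]
  nlinarith [norm_nonneg charRoot]

theorem charRoot_ne_zero : charRoot ≠ 0 := by
  rw [← norm_ne_zero_iff, norm_charRoot]; exact one_ne_zero

theorem norm_exp_neg_charRoot_mul (x : ℝ) :
    ‖Complex.exp (-charRoot * x)‖ = Real.exp (-x / 2) := by
  rw [Complex.norm_exp, Complex.re_mul_ofReal, Complex.neg_re, charRoot_re]
  congr 1; ring

theorem exp_neg_charRoot_mul (x : ℝ) : Complex.exp (-charRoot * x)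
    = ((Real.exp (-x / 2) * Real.cos (Real.sqrt 3 / 2 * x) : ℝ) : ℂ)
      + ((Real.exp (-x / 2) * Real.sin (Real.sqrt 3 / 2 * x) : ℝ) : ℂ) * Complex.I := by
  have h : -charRoot * x = ((-x / 2 : ℝ) : ℂ) + ((Real.sqrt 3 / 2 * x : ℝ) : ℂ) * Complex.I := by
    simp only [charRoot]; push_cast; ring
  rw [h, Complex.exp_add, Complex.exp_mul_I]
  push_cast
  ring

theorem Vflow_charRoot {d : ℕ} {F : Edim d → ℝ} (hF : F 0 = 0) (t : ℝ) :
    Vflow d (fun η => (F η : ℂ)) (fun η => -charRoot * ‖η‖ * F η) t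
      = fun η => (F η : ℂ) * Complex.exp (-(charRoot * t) * ‖η‖) := by
  funext η
  rcases eq_or_ne η 0 with rfl | hη
  · simp [Vflow, hF]
  have hr : ‖η‖ ≠ 0 := norm_ne_zero_iff.mpr hη
  have h3 : Real.sqrt 3 ≠ 0 := by positivity
  have hx : -(charRoot * t) * (‖η‖ : ℂ) = -charRoot * ((‖η‖ * t : ℝ) : ℂ) := by push_cast; ring
  have ha : Real.sqrt 3 / 2 * (‖η‖ * t) = Real.sqrt 3 / 2 * ‖η‖ * t := by ring
  rw [hx, exp_neg_charRoot_mul, ha]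
  simp only [Vflow, Psym, V0sym, V1sym, charRoot]
  have hrc : (‖η‖ : ℂ) ≠ 0 := by exact_mod_cast hr
  have h3c : ((Real.sqrt 3 : ℝ) : ℂ) ≠ 0 := by exact_mod_cast h3
  push_cast
  field_simp
  ring

theorem hasDerivAt_Wsym {r : ℝ} (hr : 0 < r) (τ : ℝ) : HasDerivAt (fun τ => Wsym τ r)
    (Real.exp (-(r * τ) / 2) * (Real.cos (Real.sqrt 3 / 2 * r * τ)
      - Real.sin (Real.sqrt 3 / 2 * r * τ) / Real.sqrt 3)) τ := by
  have h3 : Real.sqrt 3 ≠ 0 := by positivity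
  have h1 : HasDerivAt (fun τ => Real.exp (-(r * τ) / 2))
      (Real.exp (-(r * τ) / 2) * (-(r * 1) / 2)) τ :=
    ((((hasDerivAt_id τ).const_mul r).neg).div_const 2).exp
  have h2 : HasDerivAt (fun τ => Real.sin (Real.sqrt 3 / 2 * r * τ) / (Real.sqrt 3 / 2 * r))
      (Real.cos (Real.sqrt 3 / 2 * r * τ) * (Real.sqrt 3 / 2 * r * 1) / (Real.sqrt 3 / 2 * r)) τ :=
    (((hasDerivAt_id τ).const_mul (Real.sqrt 3 / 2 * r)).sin).div_const _
  refine (h1.mul h2).congr_deriv ?_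
  field_simp
  ring

theorem continuous_Wsym {r : ℝ} (hr : 0 < r) : Continuous fun τ => Wsym τ r :=
  continuous_iff_continuousAt.mpr fun τ => (hasDerivAt_Wsym hr τ).continuousAt

theorem abs_Wsym_sub_le_s2 {r : ℝ} (hr : 0 < r) {x y : ℝ} (hx : 0 ≤ x) (hy : 0 ≤ y) :
    |Wsym y r - Wsym x r| ≤ 2 * |y - x| := by
  refine (convex_Ici (0 : ℝ)).norm_image_sub_le_of_norm_hasDerivWithin_le
    (fun τ _ => (hasDerivAt_Wsym hr τ).hasDerivWithinAt) (fun τ hτ => ?_) hx hy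
  have h1 : Real.exp (-(r * τ) / 2) ≤ 1 :=
    Real.exp_le_one_iff.mpr (by nlinarith [mul_nonneg hr.le (Set.mem_Ici.mp hτ)])
  have h3 : 1 ≤ Real.sqrt 3 := Real.one_le_sqrt.mpr (by norm_num)
  have hs : |Real.sin (Real.sqrt 3 / 2 * r * τ) / Real.sqrt 3| ≤ 1 := by
    rw [abs_div, abs_of_pos (by positivity : 0 < Real.sqrt 3), div_le_one (by positivity)]
    exact (Real.abs_sin_le_one _).trans h3
  rw [Real.norm_eq_abs, abs_mul, abs_of_pos (Real.exp_pos _)]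
  refine (mul_le_of_le_one_left (abs_nonneg _) h1).trans ?_
  refine (abs_sub _ _).trans ?_
  linarith [Real.abs_cos_le_one (Real.sqrt 3 / 2 * r * τ)]

theorem abs_Wsym_le_s2 {r : ℝ} (hr : 0 < r) {x : ℝ} (hx : 0 ≤ x) : |Wsym x r| ≤ 2 * x := by
  simpa [Wsym, V1sym, abs_of_nonneg hx] using abs_Wsym_sub_le_s2 hr le_rfl hx

theorem le_Wsym_half {r : ℝ} (hr : 0 < r) (hr1 : r ≤ 1) : 1 / 5 ≤ Wsym (1 / 2) r := by
  have h3 : Real.sqrt 3 ≤ 2 := Real.sqrt_le_iff.mpr (by norm_num)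
  have h30 : 0 < Real.sqrt 3 := by positivity
  have h1 : 3 / 4 ≤ Psym (1 / 2) r := by
    have := Real.add_one_le_exp (-(r * (1 / 2)) / 2)
    rw [Psym]; linarith
  have hx : Real.sqrt 3 / 2 * r * (1 / 2) ≤ 1 / 2 := by nlinarith
  have h2 : 3 / 10 ≤ V1sym (1 / 2) r := by
    have hs := Real.mul_le_sin (x := Real.sqrt 3 / 2 * r * (1 / 2)) (by positivity)
      (by linarith [Real.pi_gt_three])
    rw [V1sym, le_div_iff₀ (by positivity)]
    refine le_trans ?_ hs
    have hpi : 3 / 5 ≤ 2 / π := by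
      rw [le_div_iff₀ Real.pi_pos]; linarith [Real.pi_lt_d2]
    have := mul_le_mul_of_nonneg_right hpi
      (show 0 ≤ Real.sqrt 3 / 2 * r * (1 / 2) by positivity)
    linarith
  rw [Wsym]
  nlinarith

theorem integral_mul_exp_le {ρ T : ℝ} (hρ : 0 < ρ) (hT : 0 ≤ T) :
    ∫ s in (0 : ℝ)..T, 2 * s * Real.exp (-(s * ρ) / 2) ≤ 32 / ρ ^ 2 := by
  have h1 : ∫ s in (0 : ℝ)..T, 2 * s * Real.exp (-(s * ρ) / 2)
      ≤ ∫ s in (0 : ℝ)..T, 8 / ρ * Real.exp (-(ρ / 4) * s) := by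
    refine intervalIntegral.integral_mono_on hT (Continuous.intervalIntegrable (by fun_prop) _ _)
      (Continuous.intervalIntegrable (by fun_prop) _ _) fun s hs => ?_
    have he : Real.exp (-(ρ / 4) * s) = Real.exp (s * ρ / 4) * Real.exp (-(s * ρ) / 2) := by
      rw [← Real.exp_add]; congr 1; ring
    rw [he, ← mul_assoc]
    refine mul_le_mul_of_nonneg_right ?_ (Real.exp_pos _).le
    have := Real.add_one_le_exp (s * ρ / 4)
    rw [div_mul_eq_mul_div, le_div_iff₀ hρ]
    linarith
  refine h1.trans ?_
  rw [intervalIntegral.integral_const_mul]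
  have h2 : ∫ s in (0 : ℝ)..T, Real.exp (-(ρ / 4) * s) ≤ 4 / ρ := by
    have ha : -(ρ / 4) < 0 := by linarith
    rw [intervalIntegral.integral_of_le hT]
    refine (setIntegral_mono_set (integrableOn_exp_mul_Ioi ha 0)
      (ae_of_all _ fun s => (Real.exp_pos _).le) Ioc_subset_Ioi_self.eventuallyLE).trans ?_
    rw [integral_exp_mul_Ioi ha, mul_zero, Real.exp_zero, neg_div_neg_eq, one_div_div]
  calc 8 / ρ * _ ≤ 8 / ρ * (4 / ρ) := mul_le_mul_of_nonneg_left h2 (by positivity)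
    _ = 32 / ρ ^ 2 := by ring

/-- For large `ρ`, the Duhamel integral of `e^{-λρt}` is close to `W(1/2) / (λρ)`. -/
theorem le_re_duhamel {r ρ : ℝ} (hr : 0 < r) (hr1 : r ≤ 1) (hρ : 400 ≤ ρ) :
    1 / (10 * ρ) ≤ (charRoot * ∫ s in (0 : ℝ)..(1 / 2),
      ((Wsym (1 / 2 - s) r : ℝ) : ℂ) * Complex.exp (-(charRoot * s) * ρ)).re := by
  have hρ0 : 0 < ρ := by linarith
  have hρc : (ρ : ℂ) ≠ 0 := by exact_mod_cast hρ0.ne'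
  have hW := continuous_Wsym hr
  have hexp : ∀ s : ℝ, Complex.exp (-(charRoot * s) * ρ)
      = Complex.exp (-charRoot * ((s * ρ : ℝ) : ℂ)) := fun s => by
    congr 1; push_cast; ring
  have hWc : Continuous fun s : ℝ => ((Wsym (1 / 2 - s) r : ℝ) : ℂ) :=
    Complex.continuous_ofReal.comp (hW.comp (by fun_prop))
  set W₀ : ℝ := Wsym (1 / 2) r
  have hsplit : ∫ s in (0 : ℝ)..(1 / 2),
      ((Wsym (1 / 2 - s) r : ℝ) : ℂ) * Complex.exp (-(charRoot * s) * ρ)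
      = (∫ s in (0 : ℝ)..(1 / 2),
          ((Wsym (1 / 2 - s) r - W₀ : ℝ) : ℂ) * Complex.exp (-(charRoot * s) * ρ))
        + W₀ * ∫ s in (0 : ℝ)..(1 / 2), Complex.exp (-(charRoot * s) * ρ) := by
    rw [← intervalIntegral.integral_const_mul, ← intervalIntegral.integral_add]
    · congr 1; funext s; push_cast; ring
    · refine Continuous.intervalIntegrable ?_ _ _
      push_cast
      fun_prop
    · exact Continuous.intervalIntegrable (by fun_prop) _ _
  have hE : ‖∫ s in (0 : ℝ)..(1 / 2),
      ((Wsym (1 / 2 - s) r - W₀ : ℝ) : ℂ) * Complex.exp (-(charRoot * s) * ρ)‖ ≤ 32 / ρ ^ 2 := by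
    refine le_trans (intervalIntegral.norm_integral_le_of_norm_le (by norm_num)
      (ae_of_all _ fun s hs => ?_) (Continuous.intervalIntegrable (by fun_prop) _ _))
      (integral_mul_exp_le hρ0 (by norm_num : (0 : ℝ) ≤ 1 / 2))
    rw [norm_mul, hexp, norm_exp_neg_charRoot_mul, Complex.norm_real, Real.norm_eq_abs]
    refine mul_le_mul_of_nonneg_right ?_ (Real.exp_pos _).le
    have := abs_Wsym_sub_le_s2 hr (x := 1 / 2) (y := 1 / 2 - s) (by norm_num) (by linarith [hs.2])
    rwa [show (1 / 2 - s - 1 / 2 : ℝ) = -s by ring, abs_neg, abs_of_pos hs.1] at this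
  have hI : ∫ s in (0 : ℝ)..(1 / 2), Complex.exp (-(charRoot * s) * ρ)
      = (1 - Complex.exp (-charRoot * ((1 / 2 * ρ : ℝ) : ℂ))) / (charRoot * ρ) := by
    have hne : -charRoot * ρ ≠ 0 := mul_ne_zero (neg_ne_zero.mpr charRoot_ne_zero) hρc
    have := integral_exp_mul_complex (a := 0) (b := 1 / 2) hne
    have h2 : ∀ s : ℝ, -(charRoot * s) * (ρ : ℂ) = -charRoot * ρ * s := fun s => by ring
    simp_rw [h2]
    rw [this]
    push_cast
    rw [mul_zero, Complex.exp_zero, show -charRoot * (ρ : ℂ) = -(charRoot * ρ) by ring, div_neg,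
      ← neg_div, neg_sub]
    congr 3; ring
  rw [hsplit, hI, mul_add, Complex.add_re]
  have h1 : charRoot * (W₀ * ((1 - Complex.exp (-charRoot * ((1 / 2 * ρ : ℝ) : ℂ)))
      / (charRoot * ρ))) = ((W₀ / ρ : ℝ) : ℂ) * (1 - Complex.exp (-charRoot * ((1 / 2 * ρ : ℝ) : ℂ))) := by
    have := charRoot_ne_zero
    push_cast
    field_simp
  rw [h1, Complex.re_ofReal_mul, Complex.sub_re, Complex.one_re]
  have h2 : (Complex.exp (-charRoot * ((1 / 2 * ρ : ℝ) : ℂ))).re ≤ 4 / ρ := by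
    refine (Complex.re_le_norm _).trans ?_
    rw [norm_exp_neg_charRoot_mul, show -(1 / 2 * ρ) / 2 = -(ρ / 4) by ring, Real.exp_neg]
    rw [inv_le_comm₀ (Real.exp_pos _) (by positivity), inv_div]
    linarith [Real.add_one_le_exp (ρ / 4)]
  have h3 : -(32 / ρ ^ 2) ≤ (charRoot * ∫ s in (0 : ℝ)..(1 / 2),
      ((Wsym (1 / 2 - s) r - W₀ : ℝ) : ℂ) * Complex.exp (-(charRoot * s) * ρ)).re := by
    refine (neg_le_neg ?_).trans (neg_le_of_abs_le (Complex.abs_re_le_norm _))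
    rwa [norm_mul, norm_charRoot, one_mul]
  have h4 : 1 / 5 ≤ W₀ := le_Wsym_half hr hr1
  have h5 : 4 / ρ ≤ 1 / 100 := by rw [div_le_div_iff₀ hρ0 (by norm_num)]; linarith
  have h6 : 32 / ρ ^ 2 ≤ 2 / 25 * (1 / ρ) := by
    rw [div_mul_div_comm, div_le_div_iff₀ (by positivity) (by positivity)]
    nlinarith
  have h7 : 1 / 5 * (1 / ρ) * (99 / 100) ≤ W₀ / ρ *
      (1 - (Complex.exp (-charRoot * ((1 / 2 * ρ : ℝ) : ℂ))).re) := by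
    rw [div_eq_mul_one_div W₀ ρ]
    have : 0 < 1 / ρ := by positivity
    gcongr
    linarith
  have h8 : 1 / (10 * ρ) = 1 / 10 * (1 / ρ) := by rw [div_mul_div_comm, one_mul]
  have : 0 < 1 / ρ := by positivity
  rw [h8]
  linarith

/-- Lower bound for the first Picard iterate at low frequencies. -/
theorem lconvIter_mul_le_Xi_one {d : ℕ} {F : Edim d → ℝ} (hFm : Measurable F)
    (hF0 : ∀ η, 0 ≤ F η) {a b B : ℝ} (ha : 400 ≤ a)
    (hsupp : ∀ η, F η ≠ 0 → a ≤ ‖η‖ ∧ ‖η‖ ≤ b) (hab : a ≤ b) (hB : ∀ η, F η ≤ B)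
    (hint : ∫⁻ η, ENNReal.ofReal (F η) ≠ ⊤) (n : ℕ) {ξ : Edim d} (hξ : 0 < ‖ξ‖)
    (hξ1 : ‖ξ‖ ≤ 1) :
    lconvIter d (fun η => ENNReal.ofReal (F η)) n ξ * ENNReal.ofReal (1 / (10 * ((n + 1) * b)))
      ≤ ENNReal.ofReal ‖Xi d (n + 1) (fun η => (F η : ℂ)) (fun η => -charRoot * ‖η‖ * F η) 1
          (1 / 2) ξ‖ := by
  obtain ⟨X, _, μ, _, w, ρ, hw, hρ, hw0, hρ0, hwρ, hlw, hconv⟩ :=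
    exists_laplace_repr hFm hF0 hsupp hB hint n
  have hFz : F 0 = 0 := by
    by_contra h
    have := (hsupp 0 h).1
    rw [norm_zero] at this
    linarith
  have hwm : Measurable (w ξ) := hw.comp measurable_prodMk_left
  have hρm : Measurable (ρ ξ) := hρ.comp measurable_prodMk_left
  have hwfin : ∫⁻ x, ENNReal.ofReal (w ξ x) ∂μ < ⊤ := by
    rw [hlw]
    refine lt_of_le_of_lt (lconvIter_le hFm.ennreal_ofReal
      (fun η => ENNReal.ofReal_le_ofReal (hB η)) _ _) ?_
    exact ENNReal.mul_lt_top ENNReal.ofReal_lt_top (ENNReal.pow_lt_top hint.lt_top)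
  have hwi : Integrable (w ξ) μ := by
    refine ⟨hwm.aestronglyMeasurable, ?_⟩
    rwa [hasFiniteIntegral_iff_ofReal (ae_of_all _ (hw0 ξ))]
  have hWc : Continuous fun s : ℝ => ((Wsym (1 / 2 - s) ‖ξ‖ : ℝ) : ℂ) :=
    Complex.continuous_ofReal.comp ((continuous_Wsym hξ).comp (by fun_prop))
  set J : ℝ → ℂ := fun y => ∫ s in (0 : ℝ)..(1 / 2),
    ((Wsym (1 / 2 - s) ‖ξ‖ : ℝ) : ℂ) * Complex.exp (-(charRoot * s) * y) with hJ
  have hprod : Integrable (Function.uncurry fun (s : ℝ) (x : X) =>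
      (w ξ x : ℂ) * (((Wsym (1 / 2 - s) ‖ξ‖ : ℝ) : ℂ) *
        Complex.exp (-(charRoot * s) * ρ ξ x))) ((volume.restrict (Ioc (0 : ℝ) (1 / 2))).prod μ) := by
    refine Integrable.mono' (g := fun p : ℝ × X => w ξ p.2) (hwi.comp_snd _) ?_ ?_
    · have := hWc.measurable
      refine Measurable.aestronglyMeasurable ?_
      simp only [Function.uncurry_def]
      refine Measurable.mul (by fun_prop) (Measurable.mul (this.comp measurable_fst) ?_)
      fun_prop
    · have hmem : ∀ᵐ p ∂((volume.restrict (Ioc (0 : ℝ) (1 / 2))).prod μ),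
          p.1 ∈ Ioc (0 : ℝ) (1 / 2) :=
        Measure.quasiMeasurePreserving_fst.ae (ae_restrict_mem measurableSet_Ioc)
      filter_upwards [hmem] with p hp
      simp only [Function.uncurry_def]
      rw [norm_mul, Complex.norm_real, Real.norm_of_nonneg (hw0 _ _), norm_mul, Complex.norm_real,
        Real.norm_eq_abs, show -(charRoot * (p.1 : ℂ)) * (ρ ξ p.2 : ℂ)
          = -charRoot * ((p.1 * ρ ξ p.2 : ℝ) : ℂ) by push_cast; ring, norm_exp_neg_charRoot_mul]
      refine mul_le_of_le_one_right (hw0 _ _) (mul_le_one₀ ?_ (Real.exp_pos _).le ?_)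
      · refine (abs_Wsym_le_s2 hξ (by linarith [hp.2])).trans ?_
        linarith [hp.1]
      · refine Real.exp_le_one_iff.mpr ?_
        linarith [mul_nonneg hp.1.le (hρ0 ξ p.2)]
  have hXi : Xi d (n + 1) (fun η => (F η : ℂ)) (fun η => -charRoot * ‖η‖ * F η) 1 (1 / 2) ξ
      = -∫ x, (w ξ x : ℂ) * J (ρ ξ x) ∂μ := by
    rw [Xi_one, Ik]
    congr 1
    have h1 : ∀ s ∈ uIcc (0 : ℝ) (1 / 2), ((Wsym (1 / 2 - s) ‖ξ‖ : ℝ) : ℂ) *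
        listConv d (List.ofFn fun _ : Fin (n + 1) => Vflow d (fun η => (F η : ℂ))
          (fun η => -charRoot * ‖η‖ * F η) s) ξ
        = ∫ x, (w ξ x : ℂ) * (((Wsym (1 / 2 - s) ‖ξ‖ : ℝ) : ℂ) *
          Complex.exp (-(charRoot * s) * ρ ξ x)) ∂μ := by
      intro s hs
      rw [uIcc_of_le (by norm_num)] at hs
      rw [listConv_ofFn_const, Vflow_charRoot hFz, hconv (charRoot * s) _ ξ,
        ← integral_const_mul]
      · refine integral_congr_ae (ae_of_all _ fun x => ?_)
        simp only
        ring
      · rw [Complex.re_mul_ofReal, charRoot_re]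
        linarith [hs.1]
    rw [intervalIntegral.integral_congr h1, intervalIntegral.integral_of_le (by norm_num),
      integral_integral_swap hprod]
    refine integral_congr_ae (ae_of_all _ fun x => ?_)
    simp only [hJ]
    rw [integral_const_mul, intervalIntegral.integral_of_le (by norm_num)]
  have hJi : Integrable (fun x => (w ξ x : ℂ) * J (ρ ξ x)) μ := by
    have := hprod.integral_prod_right
    refine this.congr (ae_of_all _ fun x => ?_)
    simp only [hJ, Function.uncurry_def]
    rw [integral_const_mul, intervalIntegral.integral_of_le (by norm_num)]
  have hb : 0 < b := by linarith
  have hpt : ∀ x, w ξ x * (1 / (10 * ((n + 1) * b)))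
      ≤ (charRoot * ((w ξ x : ℂ) * J (ρ ξ x))).re := by
    intro x
    rw [mul_left_comm charRoot, Complex.re_ofReal_mul]
    by_cases hx : w ξ x = 0
    · simp [hx]
    obtain ⟨h1, h2⟩ := hwρ ξ x hx
    have hρ400 : 400 ≤ ρ ξ x := by
      have : (0 : ℝ) ≤ n * a := by positivity
      linarith
    refine mul_le_mul_of_nonneg_left (le_trans ?_ (le_re_duhamel hξ hξ1 hρ400)) (hw0 _ _)
    refine one_div_le_one_div_of_le (by linarith) (by linarith)
  have hmain : ∫ x, w ξ x * (1 / (10 * ((n + 1) * b))) ∂μ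
      ≤ ‖∫ x, (w ξ x : ℂ) * J (ρ ξ x) ∂μ‖ := by
    calc ∫ x, w ξ x * (1 / (10 * ((n + 1) * b))) ∂μ
        ≤ ∫ x, (charRoot * ((w ξ x : ℂ) * J (ρ ξ x))).re ∂μ :=
          integral_mono (hwi.mul_const _) (hJi.const_mul _).re hpt
      _ = (∫ x, charRoot * ((w ξ x : ℂ) * J (ρ ξ x)) ∂μ).re :=
          integral_re (𝕜 := ℂ) (hJi.const_mul charRoot)
      _ ≤ ‖∫ x, charRoot * ((w ξ x : ℂ) * J (ρ ξ x)) ∂μ‖ := Complex.re_le_norm _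
      _ = ‖∫ x, (w ξ x : ℂ) * J (ρ ξ x) ∂μ‖ := by
          rw [integral_const_mul, norm_mul, norm_charRoot, one_mul]
  rw [hXi, norm_neg]
  refine le_trans (le_of_eq ?_) (ENNReal.ofReal_le_ofReal hmain)
  rw [integral_mul_const, ENNReal.ofReal_mul (integral_nonneg (hw0 ξ)),
    ofReal_integral_eq_lintegral_ofReal hwi (ae_of_all _ (hw0 ξ)), hlw]

/-- The iterated convolution of a function bounded below on the annulus `N ≤ |η| ≤ 6N` is bounded
below near the origin. -/
theorem le_lconvIter_annulus {d : ℕ} (hd : 1 ≤ d) {F : Edim d → ℝ≥0∞} {R : ℝ≥0∞} {N : ℝ}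
    (hN : 40 ≤ N) (hF : ∀ η, N ≤ ‖η‖ → ‖η‖ ≤ 6 * N → R ≤ F η) {n : ℕ} (hn : 1 ≤ n) (hn4 : n ≤ 4)
    {ξ : Edim d} (hξ : ‖ξ‖ ≤ 1) :
    R ^ (n + 1) * volume (Metric.ball (0 : Edim d) (N / 20)) ^ n ≤ lconvIter d F n ξ := by
  obtain ⟨p, hp⟩ : ∃ p : Edim d, ‖p‖ = 5 * N / 4 := by
    refine ⟨EuclideanSpace.single ⟨0, hd⟩ (5 * N / 4), ?_⟩
    rw [PiLp.norm_single, Real.norm_of_nonneg (by linarith)]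
  have hball : ∀ q : Edim d, ∀ r : ℝ, N + r ≤ ‖q‖ → ‖q‖ + r ≤ 6 * N →
      ∀ η ∈ Metric.ball q r, R ≤ F η := by
    intro q r h1 h2 η hη
    rw [mem_ball_iff_norm] at hη
    have h3 := abs_le.mp (abs_norm_sub_norm_le η q)
    exact hF η (by linarith) (by linarith)
  set v := volume (Metric.ball (0 : Edim d) (N / 20))
  have hj : ∀ j : ℕ, ∀ ξ ∈ Metric.ball (((j : ℝ) + 1) • p) (N / 4 - j * (N / 20)),
      R ^ (j + 1) * v ^ j ≤ lconvIter d F j ξ := by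
    intro j
    induction j with
    | zero =>
      intro ξ hξ
      simp only [Nat.cast_zero, zero_add, one_smul, zero_mul, sub_zero] at hξ
      simpa [lconvIter] using hball p (N / 4) (by linarith) (by linarith) ξ hξ
    | succ j ih =>
      intro ξ hξ
      have h := le_lconvIter_succ (n := j) (r := N / 20) (ρ := N / 4 - (j + 1) * (N / 20))
        (Q := ((j : ℝ) + 1) • p) (hball p (N / 20) (by linarith) (by linarith))
        (c := R ^ (j + 1) * v ^ j)
        (by rw [show N / 4 - ((j : ℝ) + 1) * (N / 20) + N / 20 = N / 4 - j * (N / 20) by ring]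
            exact ih)
      push_cast at hξ
      refine le_trans (le_of_eq ?_) (h ξ ?_)
      · ring
      · rwa [add_smul _ (1 : ℝ), one_smul] at hξ
  obtain ⟨m, rfl⟩ : ∃ m, n = m + 1 := ⟨n - 1, by omega⟩
  have hm : (m : ℝ) ≤ 3 := by exact_mod_cast (by omega : m ≤ 3)
  have hm0 : (0 : ℝ) ≤ m := Nat.cast_nonneg m
  have hq : ‖-(((m : ℝ) + 1) • p)‖ = (m + 1) * (5 * N / 4) := by
    rw [norm_neg, norm_smul, hp, Real.norm_of_nonneg (by positivity)]
  have h := le_lconvIter_succ (n := m) (r := N / 20) (ρ := N / 4 - (m + 1) * (N / 20))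
    (Q := ((m : ℝ) + 1) • p) (hball (-(((m : ℝ) + 1) • p)) (N / 20)
      (by rw [hq]; nlinarith) (by rw [hq]; nlinarith))
    (c := R ^ (m + 1) * v ^ m)
    (by rw [show N / 4 - ((m : ℝ) + 1) * (N / 20) + N / 20 = N / 4 - m * (N / 20) by ring]
        exact hj m)
  refine le_trans (le_of_eq ?_) (h ξ ?_)
  · ring
  · rw [add_neg_cancel, mem_ball_zero_iff]
    nlinarith

theorem norm_charRoot_data {d : ℕ} {F : Edim d → ℝ} (hF0 : ∀ η, 0 ≤ F η) (η : Edim d) :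
    ‖-charRoot * (‖η‖ : ℂ) * (F η : ℂ)‖ = ‖η‖ * F η := by
  simp [norm_charRoot, abs_of_nonneg (hF0 η)]

theorem HsNormSq_charRoot_data_le {d : ℕ} {F : Edim d → ℝ} (hF0 : ∀ η, 0 ≤ F η) (s : ℝ) :
    HsNormSq d (s - 1) (fun η => -charRoot * ‖η‖ * F η) ≤ HsNormSq d s (fun η => (F η : ℂ)) := by
  refine lintegral_mono fun η => ENNReal.ofReal_le_ofReal ?_
  have h1 : 0 < 1 + ‖η‖ ^ 2 := by positivity
  rw [norm_charRoot_data hF0, Complex.norm_real, Real.norm_of_nonneg (hF0 η), mul_pow, ← mul_assoc,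
    Real.rpow_sub_one h1.ne']
  refine mul_le_mul_of_nonneg_right ?_ (sq_nonneg _)
  rw [div_mul_eq_mul_div, div_le_iff₀ h1]
  exact mul_le_mul_of_nonneg_left (by linarith) (by positivity)

theorem FLm1Norm_charRoot_data_le {d : ℕ} {F : Edim d → ℝ} (hF0 : ∀ η, 0 ≤ F η) :
    FLm1Norm d (fun η => -charRoot * ‖η‖ * F η) ≤ ∫⁻ η, ENNReal.ofReal (F η) := by
  refine lintegral_mono fun η => ENNReal.ofReal_le_ofReal ?_
  have h1 : 0 < 1 + ‖η‖ ^ 2 := by positivity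
  rw [norm_charRoot_data hF0, ← mul_assoc]
  refine mul_le_of_le_one_left (hF0 η) ?_
  rw [show (-(1 : ℝ) / 2) = -(1 / 2) by ring, Real.rpow_neg h1.le, ← Real.sqrt_eq_rpow,
    inv_mul_le_one₀ (by positivity)]
  exact Real.le_sqrt_of_sq_le (by linarith)

theorem FLNorm_ofReal {d : ℕ} {F : Edim d → ℝ} (hF0 : ∀ η, 0 ≤ F η) :
    FLNorm d (fun η => (F η : ℂ)) = ∫⁻ η, ENNReal.ofReal (F η) := by
  refine lintegral_congr fun η => ?_
  rw [← enorm_eq_nnnorm, ← ofReal_norm, Complex.norm_real, Real.norm_of_nonneg (hF0 η)]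

theorem rpow_le_rpow_abs {x y s : ℝ} (hx : 1 ≤ x) (hxy : x ≤ y) : x ^ s ≤ y ^ |s| :=
  (Real.rpow_le_rpow_of_exponent_le hx (le_abs_self s)).trans
    (Real.rpow_le_rpow (by linarith) hxy (abs_nonneg s))

/-- The annulus `N ≤ |η| ≤ 6N`. -/
def annulus (d : ℕ) (N : ℝ) : Set (Edim d) := {η | N ≤ ‖η‖ ∧ ‖η‖ ≤ 6 * N}

theorem measurableSet_annulus (d : ℕ) (N : ℝ) : MeasurableSet (annulus d N) :=
  (measurableSet_le measurable_const measurable_norm).inter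
    (measurableSet_le measurable_norm measurable_const)

theorem volume_ball_eq (d : ℕ) {r : ℝ} (hr : 0 < r) :
    volume (Metric.ball (0 : Edim d) r)
      = ENNReal.ofReal (r ^ d * (volume (Metric.ball (0 : Edim d) 1)).toReal) := by
  rw [Measure.addHaar_ball_of_pos volume _ hr, finrank_euclideanSpace_fin,
    ENNReal.ofReal_mul (by positivity), ENNReal.ofReal_toReal measure_ball_lt_top.ne]

theorem volume_annulus_le (d : ℕ) {N : ℝ} (hN : 0 < N) : volume (annulus d N)
    ≤ ENNReal.ofReal ((7 * N) ^ d * (volume (Metric.ball (0 : Edim d) 1)).toReal) := by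
  rw [← volume_ball_eq d (by positivity)]
  refine measure_mono fun η hη => ?_
  rw [mem_ball_zero_iff]
  linarith [hη.2]

theorem HsNormSq_annulus_le (d : ℕ) (s : ℝ) {N R : ℝ} (hN : 1 ≤ N) :
    HsNormSq d s (fun η => (((annulus d N).indicator (fun _ => R) η : ℝ) : ℂ))
      ≤ ENNReal.ofReal (37 ^ |s| * 7 ^ d * (volume (Metric.ball (0 : Edim d) 1)).toReal
        * (R ^ 2 * N ^ (2 * s + d))) := by
  have hN0 : 0 < N := by linarith
  have hpt : ∀ η, ENNReal.ofReal ((1 + ‖η‖ ^ 2) ^ s *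
      ‖(((annulus d N).indicator (fun _ => R) η : ℝ) : ℂ)‖ ^ 2)
      ≤ (annulus d N).indicator (fun _ => ENNReal.ofReal (N ^ (2 * s) * 37 ^ |s| * R ^ 2)) η := by
    intro η
    by_cases hη : η ∈ annulus d N
    · rw [indicator_of_mem hη, indicator_of_mem hη]
      refine ENNReal.ofReal_le_ofReal ?_
      rw [Complex.norm_real, Real.norm_eq_abs, sq_abs]
      refine mul_le_mul_of_nonneg_right ?_ (sq_nonneg _)
      have h1 : 1 + ‖η‖ ^ 2 = N ^ 2 * ((1 + ‖η‖ ^ 2) / N ^ 2) := by field_simp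
      have h2 : N ^ (2 * s) = (N ^ 2) ^ s := by
        rw [Real.rpow_mul hN0.le, Real.rpow_two]
      rw [h1, Real.mul_rpow (by positivity) (by positivity), h2]
      refine mul_le_mul_of_nonneg_left (rpow_le_rpow_abs ?_ ?_) (by positivity)
      · rw [one_le_div (by positivity)]
        nlinarith [hη.1]
      · rw [div_le_iff₀ (by positivity)]
        nlinarith [hη.2, norm_nonneg η]
    · rw [indicator_of_notMem hη, indicator_of_notMem hη]
      simp
  refine (lintegral_mono hpt).trans ?_
  rw [lintegral_indicator_const (measurableSet_annulus d N)]
  refine (mul_le_mul_right (volume_annulus_le d hN0) _).trans (le_of_eq ?_)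
  rw [← ENNReal.ofReal_mul (by positivity), Real.rpow_add hN0, Real.rpow_natCast, mul_pow]
  congr 1
  ring

/-- A pointwise lower bound on the unit ball minus the origin bounds the `H^s` norm below. -/
theorem exists_le_HsNorm (d : ℕ) (hd : 1 ≤ d) (s : ℝ) : ∃ c : ℝ, 0 < c ∧
    ∀ (G : Edim d → ℂ) (Y : ℝ), 0 ≤ Y → (∀ ξ, 0 < ‖ξ‖ → ‖ξ‖ ≤ 1 → Y ≤ ‖G ξ‖) →
      ENNReal.ofReal (c * Y) ≤ HsNorm d s G := by
  obtain ⟨e, he⟩ : ∃ e : Edim d, ‖e‖ = 1 / 2 := by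
    refine ⟨EuclideanSpace.single ⟨0, hd⟩ (1 / 2), ?_⟩
    rw [PiLp.norm_single, Real.norm_of_nonneg (by norm_num)]
  set V := (volume (Metric.ball e (1 / 4))).toReal with hV
  have hVpos : 0 < V := ENNReal.toReal_pos (Metric.measure_ball_pos _ _ (by norm_num)).ne'
    measure_ball_lt_top.ne
  refine ⟨Real.sqrt ((2 ^ |s|)⁻¹ * V), by positivity, fun G Y hY hG => ?_⟩
  have h1 : ENNReal.ofReal ((2 ^ |s|)⁻¹ * Y ^ 2) * volume (Metric.ball e (1 / 4))
      ≤ HsNormSq d s G := by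
    rw [← setLIntegral_const]
    refine le_trans (setLIntegral_mono' Metric.isOpen_ball.measurableSet fun ξ hξ => ?_)
      (setLIntegral_le_lintegral (Metric.ball e (1 / 4)) _)
    rw [mem_ball_iff_norm] at hξ
    have h3 := abs_le.mp (abs_norm_sub_norm_le ξ e)
    have h4 : 0 < ‖ξ‖ := by linarith
    have h5 : ‖ξ‖ ≤ 1 := by linarith
    refine ENNReal.ofReal_le_ofReal (mul_le_mul ?_ ?_ (by positivity) (by positivity))
    · rw [inv_le_comm₀ (by positivity) (by positivity), ← Real.rpow_neg (by positivity)]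
      have := rpow_le_rpow_abs (x := 1 + ‖ξ‖ ^ 2) (y := 2) (s := -s) (by nlinarith) (by nlinarith)
      rwa [abs_neg] at this
    · exact pow_le_pow_left₀ hY (hG ξ h4 h5) 2
  rw [← ENNReal.ofReal_toReal (measure_ball_lt_top (μ := volume) (x := e) (r := 1 / 4)).ne, ← hV,
    ← ENNReal.ofReal_mul (by positivity)] at h1
  refine le_trans (le_of_eq ?_) (ENNReal.rpow_le_rpow h1 (by norm_num : (0 : ℝ) ≤ 1 / 2))
  rw [ENNReal.ofReal_rpow_of_nonneg (by positivity) (by norm_num), ← Real.sqrt_eq_rpow,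
    show (2 ^ |s|)⁻¹ * Y ^ 2 * V = (2 ^ |s|)⁻¹ * V * Y ^ 2 by ring,
    Real.sqrt_mul (by positivity) (Y ^ 2), Real.sqrt_sq hY]

/-- Theorem 1.1 (3): for `2 ≤ k ≤ 5` and `s < d(1/2 - 1/k) - 1/k`, the
first Picard iterate `Ξ₁` is unbounded on the unit ball of `𝓗^s` for times `t ∈ (0,1)`;
hence the solution map of vNLW fails to be `C^k` in `𝓗^s(ℝ^d)`. -/
theorem vNLW_solution_map_not_Ck
    (d k : ℕ) (hd : 1 ≤ d) (hk2 : 2 ≤ k) (hk5 : k ≤ 5) (s : ℝ)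
    (hs : s < (d : ℝ) * (1 / 2 - 1 / (k : ℝ)) - 1 / (k : ℝ)) :
    sSup {x : ℝ≥0∞ | ∃ (F₀ F₁ : Edim d → ℂ) (t : ℝ),
        MemFLPair d F₀ F₁ ∧ MemHsPair d s F₀ F₁ ∧
        pairHsNorm d s F₀ F₁ ≤ 1 ∧ t ∈ Set.Ioo (0 : ℝ) 1 ∧
        x = HsNorm d s (Xi d k F₀ F₁ 1 t)} = ⊤ := by
  obtain ⟨n, rfl⟩ : ∃ n, k = n + 1 := ⟨k - 1, by omega⟩
  have hn : 1 ≤ n := by omega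
  obtain ⟨c, hc, hlow⟩ := exists_le_HsNorm d hd s
  set V := (volume (Metric.ball (0 : Edim d) 1)).toReal with hV
  have hVpos : 0 < V := ENNReal.toReal_pos (Metric.measure_ball_pos _ _ one_pos).ne'
    measure_ball_lt_top.ne
  set C : ℝ := 2 * (37 ^ |s| * 7 ^ d * V) with hC
  have hCpos : 0 < C := by positivity
  set β : ℝ := (d : ℝ) * n - 1 - (n + 1) * (s + d / 2) with hβdef
  have hβ : 0 < β := by
    have hk : (0 : ℝ) < (n : ℝ) + 1 := by positivity
    push_cast at hs
    have h := mul_lt_mul_of_pos_left hs hk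
    have h2 : ((n : ℝ) + 1) * ((d : ℝ) * (1 / 2 - 1 / (n + 1)) - 1 / (n + 1))
        = (n + 1) * d / 2 - d - 1 := by field_simp
    rw [h2] at h
    rw [hβdef]
    linarith
  set K : ℝ := c * ((Real.sqrt C)⁻¹ ^ (n + 1) * (V / 20 ^ d) ^ n / (60 * (n + 1))) with hK
  have hKpos : 0 < K := by positivity
  refine ENNReal.eq_top_of_forall_nnreal_le fun M => ?_
  obtain ⟨N, hMN, hN⟩ := (((tendsto_rpow_atTop hβ).const_mul_atTop hKpos).eventually_ge_atTop
    (M : ℝ) |>.and (eventually_ge_atTop 400)).exists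
  have hN0 : 0 < N := by linarith
  set R : ℝ := (Real.sqrt C)⁻¹ * N ^ (-(s + d / 2)) with hR
  have hRpos : 0 < R := by positivity
  set F : Edim d → ℝ := (annulus d N).indicator (fun _ => R) with hF
  have hFm : Measurable F := measurable_const.indicator (measurableSet_annulus d N)
  have hF0 : ∀ η, 0 ≤ F η := fun η => indicator_nonneg (fun _ _ => hRpos.le) η
  have hFR : ∀ η, F η ≤ R := fun η => indicator_le_self' (fun _ _ => hRpos.le) η
  have hsupp : ∀ η, F η ≠ 0 → N ≤ ‖η‖ ∧ ‖η‖ ≤ 6 * N := fun η hη =>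
    show η ∈ annulus d N from mem_of_indicator_ne_zero hη
  have hFval : ∀ η, N ≤ ‖η‖ → ‖η‖ ≤ 6 * N → ENNReal.ofReal R ≤ ENNReal.ofReal (F η) :=
    fun η h1 h2 => by rw [hF, indicator_of_mem (show η ∈ annulus d N from ⟨h1, h2⟩)]
  have hint : ∫⁻ η, ENNReal.ofReal (F η) ≠ ⊤ := by
    have h1 : ∀ η, ENNReal.ofReal (F η)
        = (annulus d N).indicator (fun _ => ENNReal.ofReal R) η := fun η => by
      by_cases h : η ∈ annulus d N <;> simp [hF, h]
    simp_rw [h1]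
    rw [lintegral_indicator_const (measurableSet_annulus d N)]
    exact (ENNReal.mul_lt_top ENNReal.ofReal_lt_top
      ((volume_annulus_le d hN0).trans_lt ENNReal.ofReal_lt_top)).ne
  have hR2 : R ^ 2 * N ^ (2 * s + d) = C⁻¹ := by
    rw [hR, mul_pow, inv_pow, Real.sq_sqrt hCpos.le, ← Real.rpow_natCast (N ^ _),
      ← Real.rpow_mul hN0.le, mul_assoc, ← Real.rpow_add hN0, show -(s + (d : ℝ) / 2) * ((2 : ℕ) : ℝ) + (2 * s + d) = 0 by
        push_cast; ring, Real.rpow_zero, mul_one]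
  have hH0 : HsNormSq d s (fun η => (F η : ℂ)) ≤ ENNReal.ofReal (1 / 2) := by
    refine (HsNormSq_annulus_le d s (by linarith)).trans (ENNReal.ofReal_le_ofReal (le_of_eq ?_))
    rw [hR2, ← hV, hC]
    field_simp
  have hH1 := (HsNormSq_charRoot_data_le hF0 s).trans hH0
  have hF0m : Measurable fun η => (F η : ℂ) := Complex.measurable_ofReal.comp hFm
  have hF1m : Measurable fun η : Edim d => -charRoot * ‖η‖ * (F η : ℂ) := by fun_prop
  refine le_trans ?_ (le_sSup ⟨fun η => (F η : ℂ), fun η => -charRoot * ‖η‖ * F η, 1 / 2,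
    ⟨hF0m, hF1m, ?_⟩, ⟨⟨hF0m, hH0.trans_lt ENNReal.ofReal_lt_top⟩,
      ⟨hF1m, hH1.trans_lt ENNReal.ofReal_lt_top⟩⟩, ?_, by norm_num, rfl⟩)
  · have hY : ∀ ξ : Edim d, 0 < ‖ξ‖ → ‖ξ‖ ≤ 1 →
        R ^ (n + 1) * ((N / 20) ^ d * V) ^ n * (1 / (10 * ((n + 1) * (6 * N))))
          ≤ ‖Xi d (n + 1) (fun η => (F η : ℂ)) (fun η => -charRoot * ‖η‖ * F η) 1 (1 / 2) ξ‖ := by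
      intro ξ h1 h2
      have hX := lconvIter_mul_le_Xi_one hFm hF0 hN hsupp (by linarith) hFR hint n h1 h2
      have hL := le_lconvIter_annulus hd (by linarith) hFval hn (by omega) h2
      rw [← ENNReal.ofReal_le_ofReal_iff (norm_nonneg _)]
      refine le_trans (le_of_eq ?_) ((mul_le_mul_left hL _).trans hX)
      rw [volume_ball_eq d (by positivity), ← ENNReal.ofReal_pow (by positivity),
        ← ENNReal.ofReal_pow (by positivity), ← ENNReal.ofReal_mul (by positivity),
        ← ENNReal.ofReal_mul (by positivity)]
    refine le_trans ?_ (hlow _ _ (by positivity) hY)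
    rw [← ENNReal.ofReal_coe_nnreal]
    refine ENNReal.ofReal_le_ofReal (hMN.trans (le_of_eq ?_))
    have hpow : N ^ β = (N ^ (-(s + (d : ℝ) / 2))) ^ (n + 1) * (N ^ d) ^ n * N⁻¹ := by
      rw [← Real.rpow_natCast (N ^ _), ← Real.rpow_mul hN0.le, ← pow_mul, ← Real.rpow_natCast N,
        ← Real.rpow_neg_one, ← Real.rpow_add hN0, ← Real.rpow_add hN0]
      congr 1
      push_cast
      ring
    rw [hpow, hK, hR, mul_pow, div_pow, div_pow, mul_pow, div_pow]
    field_simp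
    ring
  · rw [pairFLNorm, FLNorm_ofReal hF0]
    exact ENNReal.add_lt_top.mpr ⟨hint.lt_top, (FLm1Norm_charRoot_data_le hF0).trans_lt hint.lt_top⟩
  · have h : HsNormSq d s (fun η => (F η : ℂ))
        + HsNormSq d (s - 1) (fun η => -charRoot * ‖η‖ * F η) ≤ 1 := by
      refine (add_le_add hH0 hH1).trans (le_of_eq ?_)
      rw [← ENNReal.ofReal_add (by norm_num) (by norm_num)]
      norm_num
    exact ENNReal.rpow_le_one h (by norm_num)

end
end
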